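/- Let N ≥ 3 be an integer, let a, b > −2, and let p ≥ q > 0 with pq > 1. Assume that N/(p+1) + N/(q+1) > N−2, that (N+a)/(p+1) + (N+b)/(q+1) > N−2, and that 2(p+1)/(pq−1) > N−3. Then there exists no positive solution (u, v) of the Hardy–Hénon system on ℝ^N. -/

import Mathlib

open MeasureTheory Metric Set Filter

/-- The Euclidean Laplacian of `u : ℝ^N → ℝ`, as the sum of the second derivatives
along the standard coordinate directions. -/
noncomputable def lap {N : ℕ} (u : EuclideanSpace ℝ (Fin N) → ℝ)
    (x : EuclideanSpace ℝ (Fin N)) : ℝ :=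
  ∑ i : Fin N, iteratedFDeriv ℝ 2 u x ![EuclideanSpace.single i 1, EuclideanSpace.single i 1]

/-- `(u, v)` is a positive solution of the Hardy–Hénon system
`-Δu = |x|^a v^p`, `-Δv = |x|^b u^q` on the set `Ω`:
`u, v` are continuous on `Ω`, `C²` on `Ω \ {0}`, positive on `Ω`, and
the equations hold on `Ω \ {0}`. -/
def IsHHSol {N : ℕ} (a b p q : ℝ) (Ω : Set (EuclideanSpace ℝ (Fin N)))
    (u v : EuclideanSpace ℝ (Fin N) → ℝ) : Prop :=
  ContinuousOn u Ω ∧ ContinuousOn v Ω ∧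
  ContDiffOn ℝ 2 u (Ω \ {0}) ∧ ContDiffOn ℝ 2 v (Ω \ {0}) ∧
  (∀ x ∈ Ω, 0 < u x) ∧ (∀ x ∈ Ω, 0 < v x) ∧
  (∀ x ∈ Ω \ {0}, -lap u x = ‖x‖ ^ a * v x ^ p) ∧
  (∀ x ∈ Ω \ {0}, -lap v x = ‖x‖ ^ b * u x ^ q)

/-- Euclidean space of dimension `N`. -/
abbrev Euc (N : ℕ) := EuclideanSpace ℝ (Fin N)

/-- The partial derivative in the `i`-th coordinate direction. -/
noncomputable def pd {N : ℕ} (i : Fin N) (u : Euc N → ℝ) (x : Euc N) : ℝ :=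
  fderiv ℝ u x (EuclideanSpace.single i 1)

section Calculus

variable {N : ℕ}

theorem lap_eq_sum_pd {u : Euc N → ℝ} {x : Euc N} (hu : ContDiffAt ℝ 2 u x) :
    lap u x = ∑ i, pd i (pd i u) x := by
  have h1 : DifferentiableAt ℝ (fderiv ℝ u) x :=
    (hu.fderiv_right (m := 1) (by norm_num)).differentiableAt (by norm_num)
  unfold lap
  refine Finset.sum_congr rfl fun i _ => ?_
  rw [iteratedFDeriv_two_apply]
  unfold pd
  rw [fderiv_clm_apply h1 (differentiableAt_const _)]
  simp

theorem contDiffAt_pd {n : ℕ} {u : Euc N → ℝ} {x : Euc N}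
    (hu : ContDiffAt ℝ (n + 1 : ℕ) u x) (i : Fin N) : ContDiffAt ℝ n (pd i u) x := by
  unfold pd
  exact (hu.fderiv_right (m := n) (by norm_cast)).clm_apply contDiffAt_const

theorem contDiff_pd {n : ℕ} {u : Euc N → ℝ}
    (hu : ContDiff ℝ (n + 1 : ℕ) u) (i : Fin N) : ContDiff ℝ n (pd i u) :=
  contDiff_iff_contDiffAt.2 fun _ => contDiffAt_pd hu.contDiffAt i

theorem contDiffOn_pd {n : ℕ} {u : Euc N → ℝ} {U : Set (Euc N)} (hU : IsOpen U)
    (hu : ContDiffOn ℝ (n + 1 : ℕ) u U) (i : Fin N) : ContDiffOn ℝ n (pd i u) U :=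
  fun _ hx => (contDiffAt_pd (hu.contDiffAt (hU.mem_nhds hx)) i).contDiffWithinAt

theorem tsupport_pd_subset (u : Euc N → ℝ) (i : Fin N) : tsupport (pd i u) ⊆ tsupport u := by
  refine closure_minimal (fun _ hx => ?_) (isClosed_tsupport u)
  refine support_fderiv_subset ℝ (f := u) ?_
  intro h
  exact hx (by simp [pd, h])

theorem hasCompactSupport_pd {u : Euc N → ℝ} (hu : HasCompactSupport u) (i : Fin N) :
    HasCompactSupport (pd i u) :=
  hu.of_isClosed_subset (isClosed_tsupport _) (tsupport_pd_subset u i)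

/-- A function continuous on an open set, times a continuous function compactly supported
in this set, is continuous. -/
theorem continuous_mul_of_tsupport_subset {f g : Euc N → ℝ} {U : Set (Euc N)} (hU : IsOpen U)
    (hf : ContinuousOn f U) (hg : Continuous g) (hgU : tsupport g ⊆ U) :
    Continuous fun x => f x * g x := by
  refine continuous_of_tsupport fun x hx => ?_
  have hxU : x ∈ U := hgU (closure_mono (Function.support_mul_subset_right f g) hx)
  exact (hf.continuousAt (hU.mem_nhds hxU)).mul hg.continuousAt

theorem integrable_mul_of_tsupport_subset {f g : Euc N → ℝ} {U : Set (Euc N)} (hU : IsOpen U)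
    (hf : ContinuousOn f U) (hg : Continuous g) (hgc : HasCompactSupport g)
    (hgU : tsupport g ⊆ U) : Integrable fun x => f x * g x :=
  (continuous_mul_of_tsupport_subset hU hf hg hgU).integrable_of_hasCompactSupport hgc.mul_left

theorem integral_mul_pd {f g : Euc N → ℝ} {U : Set (Euc N)} (hU : IsOpen U)
    (hf : ContDiffOn ℝ 1 f U) (hg : ContDiff ℝ 1 g) (hgc : HasCompactSupport g)
    (hgU : tsupport g ⊆ U) (i : Fin N) :
    ∫ x, f x * pd i g x = -∫ x, pd i f x * g x := by
  have hpf : ContinuousOn (pd i f) U :=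
    (contDiffOn_pd (n := 0) hU (by simpa using hf) i).continuousOn
  have hpg : Continuous (pd i g) := (contDiff_pd (n := 0) (by simpa using hg) i).continuous
  refine integral_mul_fderiv_eq_neg_fderiv_mul_of_integrable
    (integrable_mul_of_tsupport_subset hU hpf hg.continuous hgc hgU)
    (integrable_mul_of_tsupport_subset hU hf.continuousOn hpg (hasCompactSupport_pd hgc i)
      ((tsupport_pd_subset g i).trans hgU))
    (integrable_mul_of_tsupport_subset hU hf.continuousOn hg.continuous hgc hgU)
    (fun x hx => (hf.contDiffAt (hU.mem_nhds (hgU hx))).differentiableAt (by norm_num))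
    (fun x _ => hg.differentiable (by norm_num) x)

theorem integral_mul_lap {u ψ : Euc N → ℝ} {U : Set (Euc N)} (hU : IsOpen U)
    (hu : ContDiffOn ℝ 2 u U) (hψ : ContDiff ℝ 2 ψ) (hc : HasCompactSupport ψ)
    (hψU : tsupport ψ ⊆ U) :
    ∫ x, u x * lap ψ x = ∫ x, lap u x * ψ x := by
  have hu1 : ∀ i, ContDiffOn ℝ 1 (pd i u) U := fun i =>
    contDiffOn_pd (n := 1) hU (by simpa using hu) i
  have hψ1 : ∀ i, ContDiff ℝ 1 (pd i ψ) := fun i =>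
    contDiff_pd (n := 1) (by simpa using hψ) i
  have e1 : ∀ x, u x * lap ψ x = ∑ i, u x * pd i (pd i ψ) x := fun x => by
    rw [lap_eq_sum_pd hψ.contDiffAt, Finset.mul_sum]
  have e2 : ∀ x, lap u x * ψ x = ∑ i, pd i (pd i u) x * ψ x := fun x => by
    by_cases hx : x ∈ U
    · rw [lap_eq_sum_pd (hu.contDiffAt (hU.mem_nhds hx)), Finset.sum_mul]
    · simp [image_eq_zero_of_notMem_tsupport fun h => hx (hψU h)]
  simp_rw [e1, e2]
  rw [integral_finsetSum, integral_finsetSum]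
  · refine Finset.sum_congr rfl fun i _ => ?_
    rw [integral_mul_pd hU (hu.of_le (by norm_num)) (hψ1 i) (hasCompactSupport_pd hc i)
      ((tsupport_pd_subset _ i).trans hψU) i,
      integral_mul_pd hU (hu1 i) (hψ.of_le (by norm_num)) hc hψU i, neg_neg]
  · intro i _
    exact integrable_mul_of_tsupport_subset hU
      (contDiffOn_pd (n := 0) hU (by simpa using hu1 i) i).continuousOn hψ.continuous hc hψU
  · intro i _
    exact integrable_mul_of_tsupport_subset hU hu.continuousOn
      (contDiff_pd (n := 0) (by simpa using hψ1 i) i).continuous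
      (hasCompactSupport_pd (hasCompactSupport_pd hc i) i)
      (((tsupport_pd_subset _ i).trans (tsupport_pd_subset _ i)).trans hψU)

theorem continuousOn_lap {u : Euc N → ℝ} {U : Set (Euc N)} (hU : IsOpen U)
    (hu : ContDiffOn ℝ 2 u U) : ContinuousOn (lap u) U := by
  have h : ContinuousOn (fun x => ∑ i, pd i (pd i u) x) U :=
    continuousOn_finsetSum _ fun i _ =>
      (contDiffOn_pd (n := 0) hU
        (by simpa using contDiffOn_pd (n := 1) hU (by simpa using hu) i) i).continuousOn
  exact h.congr fun x hx => lap_eq_sum_pd (hu.contDiffAt (hU.mem_nhds hx))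

end Calculus

section Kernels

variable {N : ℕ}

theorem pd_comm {u : Euc N → ℝ} {x : Euc N} (hu : ContDiffAt ℝ 2 u x) (i j : Fin N) :
    pd i (pd j u) x = pd j (pd i u) x := by
  have h1 : DifferentiableAt ℝ (fderiv ℝ u) x :=
    (hu.fderiv_right (m := 1) (by norm_num)).differentiableAt (by norm_num)
  have hs := hu.isSymmSndFDerivAt (by simp)
  unfold pd
  rw [fderiv_clm_apply h1 (differentiableAt_const _), fderiv_clm_apply h1 (differentiableAt_const _)]
  simpa using hs _ _

theorem fderiv_apply_eq_sum (u : Euc N → ℝ) (x z : Euc N) :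
    fderiv ℝ u x z = ∑ i, z i * pd i u x := by
  conv_lhs => rw [← (EuclideanSpace.basisFun (Fin N) ℝ).sum_repr z]
  simp [pd, map_sum]

theorem pd_comp_smul_sub {θ : Euc N → ℝ} (hθ : Differentiable ℝ θ) (c : ℝ) (x : Euc N)
    (i : Fin N) :
    pd i (fun y => θ (c • (y - x))) = fun y => c * pd i θ (c • (y - x)) := by
  funext y
  have h : HasFDerivAt (fun y : Euc N => c • (y - x)) (c • ContinuousLinearMap.id ℝ (Euc N)) y :=
    ((hasFDerivAt_id y).sub_const x).const_smul c
  have := (hθ (c • (y - x))).hasFDerivAt.comp y h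
  unfold pd
  rw [show (fun y => θ (c • (y - x))) = θ ∘ (fun y => c • (y - x)) from rfl, this.fderiv]
  simp

theorem pd_const_mul {u : Euc N → ℝ} {x : Euc N} (hu : DifferentiableAt ℝ u x) (c : ℝ)
    (i : Fin N) : pd i (fun y => c * u y) x = c * pd i u x := by
  unfold pd
  rw [fderiv_const_mul hu]; simp

theorem lap_comp_smul_sub {θ : Euc N → ℝ} (hθ : ContDiff ℝ 2 θ) (c : ℝ) (x y : Euc N) :
    lap (fun y => θ (c • (y - x))) y = c ^ 2 * lap θ (c • (y - x)) := by
  have h2 : ContDiff ℝ 2 (fun y : Euc N => θ (c • (y - x))) := by fun_prop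
  rw [lap_eq_sum_pd h2.contDiffAt, lap_eq_sum_pd hθ.contDiffAt, Finset.mul_sum]
  refine Finset.sum_congr rfl fun i _ => ?_
  have hd : ContDiff ℝ 1 (pd i θ) := contDiff_pd (n := 1) (by simpa using hθ) i
  rw [pd_comp_smul_sub (hθ.differentiable (by norm_num))]
  have h3 : DifferentiableAt ℝ (fun y => pd i θ (c • (y - x))) y := by
    have : ContDiff ℝ 1 (fun y => pd i θ (c • (y - x))) := by fun_prop
    exact this.differentiable (by norm_num) y
  rw [pd_const_mul h3, pd_comp_smul_sub (hd.differentiable (by norm_num))]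
  ring

/-- A bump function on the line. -/
noncomputable def lineBump : ContDiffBump (0 : ℝ) := ⟨1 / 2, 1, by norm_num, by norm_num⟩

/-- The radial averaging kernel on `ℝ^N`. -/
noncomputable def rhoKer (N : ℕ) (z : Euc N) : ℝ := lineBump (‖z‖ ^ 2)

/-- The radial potential of the averaging kernel: `∇ η = - z ρ`. -/
noncomputable def etaKer (N : ℕ) (z : Euc N) : ℝ := 1 / 2 * ∫ t in (‖z‖ ^ 2)..1, lineBump t

theorem contDiff_rhoKer {n : ℕ} : ContDiff ℝ n (rhoKer N) :=
  lineBump.contDiff.comp (contDiff_norm_sq ℝ)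

theorem rhoKer_nonneg (z : Euc N) : 0 ≤ rhoKer N z := lineBump.nonneg

theorem rhoKer_eq_one {z : Euc N} (hz : ‖z‖ ≤ 1 / 2) : rhoKer N z = 1 := by
  refine lineBump.one_of_mem_closedBall ?_
  rw [mem_closedBall_zero_iff, Real.norm_of_nonneg (sq_nonneg _)]
  change ‖z‖ ^ 2 ≤ 1 / 2
  nlinarith [norm_nonneg z]

theorem rhoKer_eq_zero {z : Euc N} (hz : 1 ≤ ‖z‖) : rhoKer N z = 0 := by
  refine lineBump.zero_of_le_dist ?_
  rw [Real.dist_eq, sub_zero, abs_of_nonneg (sq_nonneg _)]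
  change 1 ≤ ‖z‖ ^ 2
  nlinarith

theorem hasDerivAt_integral_lineBump (t : ℝ) :
    HasDerivAt (fun t => 1 / 2 * ∫ τ in t..1, lineBump τ) (-(1 / 2) * lineBump t) t := by
  have := intervalIntegral.integral_hasDerivAt_left (a := t) (b := 1) (f := lineBump)
    (lineBump.continuous.intervalIntegrable _ _)
    (lineBump.continuous.stronglyMeasurableAtFilter _ _) lineBump.continuous.continuousAt
  simpa using this.const_mul (1 / 2 : ℝ)

theorem pd_etaKer (i : Fin N) (z : Euc N) : pd i (etaKer N) z = -(z i * rhoKer N z) := by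
  have h1 := (hasDerivAt_integral_lineBump (‖z‖ ^ 2)).comp_hasFDerivAt z
    (hasStrictFDerivAt_norm_sq z).hasFDerivAt
  have h2 : HasFDerivAt (etaKer N) _ z := h1
  unfold pd
  rw [h2.fderiv]
  have h3 : inner ℝ z (EuclideanSpace.single i (1 : ℝ)) = z i := by
    simp [EuclideanSpace.inner_single_right]
  simp [rhoKer, h3]
  ring

theorem contDiff_etaKer {n : ℕ} : ContDiff ℝ n (etaKer N) := by
  have h : ContDiff ℝ (n + 1 : ℕ) (fun t => 1 / 2 * ∫ τ in t..1, lineBump τ) := by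
    push_cast
    rw [contDiff_succ_iff_deriv]
    refine ⟨fun t => (hasDerivAt_integral_lineBump t).differentiableAt, by simp, ?_⟩
    rw [show deriv (fun t => 1 / 2 * ∫ τ in t..1, lineBump τ) = fun t => -(1 / 2) * lineBump t from
      funext fun t => (hasDerivAt_integral_lineBump t).deriv]
    exact contDiff_const.mul lineBump.contDiff
  exact (h.of_le (by norm_cast; omega)).comp (contDiff_norm_sq ℝ)

theorem etaKer_eq_zero {z : Euc N} (hz : 1 ≤ ‖z‖) : etaKer N z = 0 := by
  unfold etaKer
  rw [intervalIntegral.integral_congr (g := fun _ => (0 : ℝ))]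
  · simp
  · intro t ht
    rw [uIcc_of_ge (by nlinarith)] at ht
    refine lineBump.zero_of_le_dist ?_
    rw [Real.dist_eq, sub_zero]
    exact ht.1.trans (le_abs_self t)

theorem etaKer_nonneg (z : Euc N) : 0 ≤ etaKer N z := by
  by_cases hz : 1 ≤ ‖z‖
  · rw [etaKer_eq_zero hz]
  · have : ‖z‖ ^ 2 ≤ 1 := by nlinarith [norm_nonneg z]
    exact mul_nonneg (by norm_num)
      (intervalIntegral.integral_nonneg this fun t _ => lineBump.nonneg)

theorem le_etaKer {z : Euc N} (hz : ‖z‖ ≤ 1 / 2) : 1 / 8 ≤ etaKer N z := by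
  have h1 : ‖z‖ ^ 2 ≤ 1 / 4 := by nlinarith [norm_nonneg z]
  have hc := fun a b : ℝ => lineBump.continuous.intervalIntegrable (μ := volume) a b
  unfold etaKer
  rw [← intervalIntegral.integral_add_adjacent_intervals (hc _ (1 / 4)) (hc (1 / 4) 1),
    ← intervalIntegral.integral_add_adjacent_intervals (hc _ (1 / 2)) (hc (1 / 2) 1)]
  have a1 : 0 ≤ ∫ t in (‖z‖ ^ 2)..(1 / 4), lineBump t :=
    intervalIntegral.integral_nonneg h1 fun t _ => lineBump.nonneg
  have a2 : 0 ≤ ∫ t in (1 / 2 : ℝ)..1, lineBump t :=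
    intervalIntegral.integral_nonneg (by norm_num) fun t _ => lineBump.nonneg
  have a3 : ∫ t in (1 / 4 : ℝ)..(1 / 2), lineBump t = 1 / 4 := by
    rw [intervalIntegral.integral_congr (g := fun _ => (1 : ℝ))]
    · norm_num
    · intro t ht
      rw [uIcc_of_le (by norm_num)] at ht
      refine lineBump.one_of_mem_closedBall ?_
      rw [mem_closedBall_zero_iff, Real.norm_eq_abs, abs_le]
      change -(1 / 2) ≤ t ∧ t ≤ 1 / 2
      constructor <;> linarith [ht.1, ht.2]
  linarith

/-- A pair of compactly supported kernels such that the scaled averages against `κ` have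
derivative (with respect to the scale) the Laplacian of the scaled `θ`. -/
structure IsMeanKernel (j : ℕ) (κ θ : Euc N → ℝ) : Prop where
  contDiff_left : ContDiff ℝ 2 κ
  contDiff_right : ContDiff ℝ 2 θ
  left_eq_zero : ∀ z, 1 ≤ ‖z‖ → κ z = 0
  right_eq_zero : ∀ z, 1 ≤ ‖z‖ → θ z = 0
  lap_eq : ∀ z, lap θ z = -((N + j : ℕ) * κ z) - fderiv ℝ κ z z

theorem hasFDerivAt_coord (i : Fin N) (z : Euc N) :
    HasFDerivAt (fun z : Euc N => z i) (EuclideanSpace.proj (𝕜 := ℝ) i : Euc N →L[ℝ] ℝ) z :=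
  (EuclideanSpace.proj (𝕜 := ℝ) i : Euc N →L[ℝ] ℝ).hasFDerivAt

theorem pd_mul {u v : Euc N → ℝ} {x : Euc N} (hu : DifferentiableAt ℝ u x)
    (hv : DifferentiableAt ℝ v x) (i : Fin N) :
    pd i (fun y => u y * v y) x = pd i u x * v x + u x * pd i v x := by
  unfold pd
  rw [fderiv_fun_mul hu hv]
  simp; ring

theorem pd_coord (i j : Fin N) (x : Euc N) :
    pd i (fun z : Euc N => z j) x = if i = j then 1 else 0 := by
  unfold pd
  rw [(hasFDerivAt_coord j x).fderiv]
  simp [eq_comm]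

theorem pd_neg (u : Euc N → ℝ) (x : Euc N) (i : Fin N) :
    pd i (fun y => -u y) x = -pd i u x := by
  unfold pd
  rw [fderiv_fun_neg]; simp

theorem pd_add {u v : Euc N → ℝ} {x : Euc N} (hu : DifferentiableAt ℝ u x)
    (hv : DifferentiableAt ℝ v x) (i : Fin N) :
    pd i (fun y => u y + v y) x = pd i u x + pd i v x := by
  unfold pd
  rw [fderiv_fun_add hu hv]; simp

theorem pd_sum {ι : Type*} (s : Finset ι) {u : ι → Euc N → ℝ} {x : Euc N}
    (hu : ∀ k ∈ s, DifferentiableAt ℝ (u k) x) (i : Fin N) :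
    pd i (fun y => ∑ k ∈ s, u k y) x = ∑ k ∈ s, pd i (u k) x := by
  unfold pd
  rw [fderiv_fun_sum hu]; simp

theorem differentiableAt_coord (i : Fin N) (z : Euc N) :
    DifferentiableAt ℝ (fun z : Euc N => z i) z := (hasFDerivAt_coord i z).differentiableAt

theorem lap_etaKer (z : Euc N) :
    lap (etaKer N) z = -(N * rhoKer N z) - ∑ i, z i * pd i (rhoKer N) z := by
  have hd : DifferentiableAt ℝ (rhoKer N) z :=
    (contDiff_rhoKer (n := 1)).differentiable (by norm_num) z
  rw [lap_eq_sum_pd (contDiff_etaKer (n := 2)).contDiffAt]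
  have : ∀ i, pd i (pd i (etaKer N)) z = -(rhoKer N z + z i * pd i (rhoKer N) z) := by
    intro i
    rw [show pd i (etaKer N) = fun z => -(z i * rhoKer N z) from funext (pd_etaKer i), pd_neg,
      pd_mul (differentiableAt_coord i z) hd, pd_coord]
    simp
  simp_rw [this]
  rw [Finset.sum_neg_distrib, Finset.sum_add_distrib]
  simp; ring

theorem isMeanKernel_rhoKer : IsMeanKernel 0 (rhoKer N) (etaKer N) where
  contDiff_left := contDiff_rhoKer (n := 2)
  contDiff_right := contDiff_etaKer (n := 2)
  left_eq_zero _ := rhoKer_eq_zero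
  right_eq_zero _ := etaKer_eq_zero
  lap_eq z := by rw [lap_etaKer, fderiv_apply_eq_sum]; simp

theorem isMeanKernel_pd_rhoKer (i : Fin N) :
    IsMeanKernel 1 (pd i (rhoKer N)) (fun z => -(z i * rhoKer N z)) where
  contDiff_left := contDiff_pd (n := 2) contDiff_rhoKer i
  contDiff_right := by
    have := contDiff_pd (n := 2) (contDiff_etaKer (N := N)) i
    rwa [show pd i (etaKer N) = fun z => -(z i * rhoKer N z) from funext (pd_etaKer i)] at this
  left_eq_zero z hz := by
    have hmin : IsMinOn (rhoKer N) univ z := fun y _ => by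
      simpa [rhoKer_eq_zero hz] using rhoKer_nonneg y
    have := (hmin.isLocalMin univ_mem).fderiv_eq_zero
    simp [pd, this]
  right_eq_zero z hz := by simp [rhoKer_eq_zero hz]
  lap_eq z := by
    have hη : ∀ n : ℕ, ContDiff ℝ n (etaKer N) := fun n => contDiff_etaKer
    have hρ : ∀ n : ℕ, ContDiff ℝ n (rhoKer N) := fun n => contDiff_rhoKer
    rw [show (fun z : Euc N => -(z i * rhoKer N z)) = pd i (etaKer N) from
      (funext (pd_etaKer i)).symm, lap_eq_sum_pd (contDiff_pd (n := 2) (hη 3) i).contDiffAt]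
    have e1 : ∀ j, pd j (pd j (pd i (etaKer N))) z = pd i (pd j (pd j (etaKer N))) z := by
      intro j
      rw [show pd j (pd i (etaKer N)) = pd i (pd j (etaKer N)) from
        funext fun y => pd_comm (hη 2).contDiffAt j i,
        pd_comm (contDiff_pd (n := 2) (hη 3) j).contDiffAt j i]
    have hd : ∀ j, DifferentiableAt ℝ (pd j (rhoKer N)) z := fun j =>
      (contDiff_pd (n := 1) (hρ 2) j).differentiable (by norm_num) z
    have hl : lap (etaKer N) =
        fun z => -(N * rhoKer N z + ∑ j, z j * pd j (rhoKer N) z) := by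
      funext y; rw [lap_etaKer]; ring
    simp_rw [e1]
    rw [← pd_sum _ fun j _ => (contDiff_pd (n := 1) (contDiff_pd (n := 2) (hη 3) j) j).differentiable
        (by norm_num) z,
      show (fun y => ∑ j, pd j (pd j (etaKer N)) y) = lap (etaKer N) from
        funext fun y => (lap_eq_sum_pd (hη 2).contDiffAt).symm, hl, pd_neg]
    have hd0 : DifferentiableAt ℝ (rhoKer N) z := (hρ 1).differentiable (by norm_num) z
    have hs : ∀ j ∈ Finset.univ,
        DifferentiableAt ℝ (fun z : Euc N => z j * pd j (rhoKer N) z) z := fun j _ =>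
      (differentiableAt_coord j z).mul (hd j)
    have e2 : pd i (fun z => N * rhoKer N z + ∑ j, z j * pd j (rhoKer N) z) z =
        N * pd i (rhoKer N) z + ∑ j, pd i (fun z => z j * pd j (rhoKer N) z) z := by
      rw [← pd_const_mul hd0, ← pd_sum (u := fun j z => z j * pd j (rhoKer N) z) _ hs]
      exact pd_add (hd0.const_mul _) (DifferentiableAt.fun_sum hs) i
    rw [e2, fderiv_apply_eq_sum]
    have e3 : ∀ j, pd i (fun z => z j * pd j (rhoKer N) z) z =
        (if i = j then pd j (rhoKer N) z else 0) + z j * pd j (pd i (rhoKer N)) z := by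
      intro j
      rw [pd_mul (differentiableAt_coord j z) (hd j), pd_coord, pd_comm (hρ 2).contDiffAt i j]
      simp
    simp_rw [e3]
    rw [Finset.sum_add_distrib]
    simp; ring

end Kernels

section MeanValue

variable {N : ℕ}

theorem integral_intervalIntegral_swap_of_continuousOn {H : ℝ → Euc N → ℝ} {K : Set (Euc N)}
    (hK : IsCompact K) {s t : ℝ} (hst : s ≤ t)
    (hH : ContinuousOn (Function.uncurry H) (Icc s t ×ˢ K)) :
    ∫ y in K, ∫ τ in s..t, H τ y = ∫ τ in s..t, ∫ y in K, H τ y := by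
  simp_rw [intervalIntegral.integral_of_le hst, ← integral_Icc_eq_integral_Ioc]
  refine (integral_integral_swap ?_).symm
  rw [Measure.prod_restrict]
  exact hH.integrableOn_compact (isCompact_Icc.prod hK)

/-- The average at scale `s` around `x` of `u` against a kernel of homogeneity `k`. -/
noncomputable def scaledKer (k : ℕ) (κ : Euc N → ℝ) (x : Euc N) (s : ℝ) (y : Euc N) : ℝ :=
  (s⁻¹) ^ k * κ (s⁻¹ • (y - x))

/-- The potential generated by `θ` between the scales `s` and `t`. -/
noncomputable def potKer (m : ℕ) (θ : Euc N → ℝ) (s t : ℝ) (w : Euc N) : ℝ :=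
  ∫ τ in s..t, (τ⁻¹) ^ m * θ (τ⁻¹ • w)

theorem hasDerivAt_scaledKer {j m : ℕ} {κ θ : Euc N → ℝ} (h : IsMeanKernel j κ θ)
    (hm : N + j = m + 1) (x y : Euc N) {s : ℝ} (hs : s ≠ 0) :
    HasDerivAt (fun s => scaledKer (N + j) κ x s y)
      ((s⁻¹) ^ m * lap (fun y => θ (s⁻¹ • (y - x))) y) s := by
  have h1 : HasDerivAt (fun s : ℝ => s⁻¹) (-(s ^ 2)⁻¹) s := hasDerivAt_inv hs
  have h2 := h1.pow (N + j)
  have h3 : HasDerivAt (fun s : ℝ => s⁻¹ • (y - x)) (-(s ^ 2)⁻¹ • (y - x)) s :=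
    h1.smul_const (y - x)
  have h4 := ((h.contDiff_left.differentiable (by norm_num)
    (s⁻¹ • (y - x))).hasFDerivAt).comp_hasDerivAt s h3
  have h5 := h2.mul h4
  refine h5.congr_deriv ?_
  rw [lap_comp_smul_sub h.contDiff_right, h.lap_eq, hm]
  have e : (-(s ^ 2)⁻¹ • (y - x)) = -s⁻¹ • (s⁻¹ • (y - x)) := by
    rw [smul_smul]; congr 1; field_simp
  rw [e, map_smul]
  simp only [smul_eq_mul, Function.comp, Nat.add_sub_cancel, Pi.pow_apply]
  rw [show (s ^ 2)⁻¹ = s⁻¹ ^ 2 by simp]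
  ring

theorem tsupport_comp_smul_sub_subset {θ : Euc N → ℝ} (hθ : ∀ z, 1 ≤ ‖z‖ → θ z = 0)
    (x : Euc N) {s : ℝ} (hs : 0 < s) :
    tsupport (fun y => θ (s⁻¹ • (y - x))) ⊆ closedBall x s := by
  refine closure_minimal (fun y hy => ?_) isClosed_closedBall
  by_contra hc
  refine hy (hθ _ ?_)
  rw [mem_closedBall, not_le, dist_eq_norm] at hc
  rw [norm_smul, norm_inv, Real.norm_of_nonneg hs.le, inv_mul_eq_div, one_le_div hs]
  exact hc.le

theorem zero_notMem_closedBall {x : Euc N} {δ : ℝ} (hδ : δ < ‖x‖) :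
    closedBall x δ ⊆ {0}ᶜ := by
  intro y hy h0
  rw [mem_singleton_iff.1 h0, mem_closedBall, dist_zero_left] at hy
  linarith

theorem mean_representation {j m : ℕ} {κ θ : Euc N → ℝ} (h : IsMeanKernel j κ θ)
    (hm : N + j = m + 1) {u : Euc N → ℝ} (hu : ContDiffOn ℝ 2 u {0}ᶜ) {x : Euc N} {s δ : ℝ}
    (hs : 0 < s) (hsδ : s ≤ δ) (hδ : δ < ‖x‖) :
    (∫ y in closedBall x δ, u y * scaledKer (N + j) κ x δ y) -
      ∫ y in closedBall x δ, u y * scaledKer (N + j) κ x s y =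
    ∫ y in closedBall x δ, lap u y * potKer m θ s δ (y - x) := by
  have hK : IsCompact (closedBall x δ) := isCompact_closedBall x δ
  have hK0 := zero_notMem_closedBall hδ
  have hcu : ContinuousOn u (closedBall x δ) := hu.continuousOn.mono hK0
  have hlu : ContinuousOn (lap u) (closedBall x δ) :=
    (continuousOn_lap isOpen_compl_singleton hu).mono hK0
  have hlθ : Continuous (lap θ) := by
    have := continuousOn_lap isOpen_univ h.contDiff_right.contDiffOn
    rwa [continuousOn_univ] at this
  have hinv : ContinuousOn (fun z : ℝ × Euc N => z.1⁻¹) (Icc s δ ×ˢ closedBall x δ) :=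
    continuousOn_fst.inv₀ fun z hz => (hs.trans_le hz.1.1).ne'
  have hz : ContinuousOn (fun z : ℝ × Euc N => z.1⁻¹ • (z.2 - x)) (Icc s δ ×ˢ closedBall x δ) :=
    hinv.smul (continuousOn_snd.sub continuousOn_const)
  have hlam : ∀ (τ : ℝ) (y : Euc N), lap (fun y => θ (τ⁻¹ • (y - x))) y =
      (τ⁻¹) ^ 2 * lap θ (τ⁻¹ • (y - x)) := fun τ y => lap_comp_smul_sub h.contDiff_right _ x y
  have hk : ∀ τ, Continuous (scaledKer (N + j) κ x τ) := fun τ => by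
    have := h.contDiff_left.continuous
    unfold scaledKer; fun_prop
  have hI : ∀ τ, IntegrableOn (fun y => u y * scaledKer (N + j) κ x τ y) (closedBall x δ) :=
    fun τ => (hcu.mul (hk τ).continuousOn).integrableOn_compact hK
  have hne : ∀ τ ∈ uIcc s δ, τ ≠ 0 := fun τ hτ => by
    rw [uIcc_of_le hsδ] at hτ; exact (hs.trans_le hτ.1).ne'
  have hftc : ∀ y, u y * scaledKer (N + j) κ x δ y - u y * scaledKer (N + j) κ x s y =
      ∫ τ in s..δ, u y * ((τ⁻¹) ^ m * lap (fun y => θ (τ⁻¹ • (y - x))) y) := by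
    intro y
    rw [intervalIntegral.integral_const_mul, ← mul_sub,
      intervalIntegral.integral_eq_sub_of_hasDerivAt
        (fun τ hτ => hasDerivAt_scaledKer h hm x y (hne τ hτ))]
    refine ContinuousOn.intervalIntegrable ?_
    simp_rw [hlam]
    have hi : ContinuousOn (fun τ : ℝ => τ⁻¹) (uIcc s δ) := continuousOn_id.inv₀ hne
    exact (hi.pow m).mul ((hi.pow 2).mul (hlθ.comp_continuousOn (hi.smul continuousOn_const)))
  rw [← integral_sub (hI δ) (hI s)]
  simp_rw [hftc]
  rw [integral_intervalIntegral_swap_of_continuousOn hK hsδ]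
  · have e : ∀ y, lap u y * potKer m θ s δ (y - x) =
        ∫ τ in s..δ, lap u y * ((τ⁻¹) ^ m * θ (τ⁻¹ • (y - x))) := fun y => by
      rw [intervalIntegral.integral_const_mul]; rfl
    simp_rw [e]
    rw [integral_intervalIntegral_swap_of_continuousOn hK hsδ]
    · refine intervalIntegral.integral_congr fun τ hτ => ?_
      rw [uIcc_of_le hsδ] at hτ
      have hτ0 := hs.trans_le hτ.1
      have hsub := (tsupport_comp_smul_sub_subset h.right_eq_zero x hτ0)
      have hsub2 := hsub.trans (closedBall_subset_closedBall hτ.2)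
      have hcs : HasCompactSupport fun y => θ (τ⁻¹ • (y - x)) :=
        hK.of_isClosed_subset (isClosed_tsupport _) hsub2
      have h2 : ContDiff ℝ 2 fun y : Euc N => θ (τ⁻¹ • (y - x)) := by
        have := h.contDiff_right; fun_prop
      have key := integral_mul_lap isOpen_compl_singleton hu h2 hcs (hsub2.trans hK0)
      have hv : ∀ y, y ∉ closedBall x δ → θ (τ⁻¹ • (y - x)) = 0 := fun y hy =>
        image_eq_zero_of_notMem_tsupport (f := fun y => θ (τ⁻¹ • (y - x))) fun hc => hy (hsub2 hc)
      have hv2 : ∀ y, y ∉ closedBall x δ → lap (fun y => θ (τ⁻¹ • (y - x))) y = 0 := by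
        intro y hy
        rw [lap_eq_sum_pd h2.contDiffAt]
        refine Finset.sum_eq_zero fun i _ => image_eq_zero_of_notMem_tsupport fun hc => hy ?_
        exact hsub2 (tsupport_pd_subset _ i (tsupport_pd_subset _ i hc))
      have e1 : ∀ y, u y * ((τ⁻¹) ^ m * lap (fun y => θ (τ⁻¹ • (y - x))) y) =
          (τ⁻¹) ^ m * (u y * lap (fun y => θ (τ⁻¹ • (y - x))) y) := fun y => by ring
      have e2 : ∀ y, lap u y * ((τ⁻¹) ^ m * θ (τ⁻¹ • (y - x))) =
          (τ⁻¹) ^ m * (lap u y * θ (τ⁻¹ • (y - x))) := fun y => by ring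
      simp_rw [e1, e2]
      rw [integral_const_mul, integral_const_mul,
        setIntegral_eq_integral_of_forall_compl_eq_zero fun y hy => by rw [hv2 y hy, mul_zero],
        setIntegral_eq_integral_of_forall_compl_eq_zero fun y hy => by rw [hv y hy, mul_zero], key]
    · exact (hlu.comp continuousOn_snd fun z hz => hz.2).mul
        ((hinv.pow m).mul (h.contDiff_right.continuous.comp_continuousOn hz))
  · simp_rw [hlam]
    exact (hcu.comp continuousOn_snd fun z hz => hz.2).mul
      ((hinv.pow m).mul ((hinv.pow 2).mul (hlθ.comp_continuousOn hz)))

theorem scaledKer_eq_zero {κ : Euc N → ℝ} (hκ : ∀ z, 1 ≤ ‖z‖ → κ z = 0) (k : ℕ) {x y : Euc N}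
    {s : ℝ} (hs : 0 < s) (hy : y ∉ closedBall x s) : scaledKer k κ x s y = 0 := by
  unfold scaledKer
  rw [image_eq_zero_of_notMem_tsupport (f := fun y => κ (s⁻¹ • (y - x)))
    fun hc => hy (tsupport_comp_smul_sub_subset hκ x hs hc), mul_zero]

theorem integral_scaledKer (κ : Euc N → ℝ) (x : Euc N) {s : ℝ} (hs : 0 < s) :
    ∫ y, scaledKer N κ x s y = ∫ z, κ z := by
  unfold scaledKer
  rw [integral_const_mul, integral_sub_right_eq_self (fun y => κ (s⁻¹ • y)),
    Measure.integral_comp_smul]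
  simp only [finrank_euclideanSpace, Fintype.card_fin, inv_pow, inv_inv, smul_eq_mul]
  rw [abs_of_pos (by positivity), ← mul_assoc, inv_mul_cancel₀ (by positivity), one_mul]

theorem exists_abs_integral_scaledKer_sub_le {w : Euc N → ℝ} {x : Euc N} {δ : ℝ} (hδ : 0 < δ)
    (hw : ContinuousOn w (closedBall x δ)) {ε : ℝ} (hε : 0 < ε) :
    ∃ s₀ > 0, ∀ s, 0 < s → s ≤ s₀ →
      |(∫ y in closedBall x δ, w y * scaledKer N (rhoKer N) x s y) -
        w x * ∫ z, rhoKer N z| ≤ ε := by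
  set m₀ := ∫ z, rhoKer N z
  have hm₀ : 0 ≤ m₀ := integral_nonneg rhoKer_nonneg
  have hx := hw.continuousAt (closedBall_mem_nhds x hδ)
  obtain ⟨d, hd, hdw⟩ := Metric.continuousAt_iff.1 hx (ε / (m₀ + 1)) (by positivity)
  refine ⟨min (d / 2) δ, by positivity, fun s hs hs0 => ?_⟩
  have hsd : s ≤ d / 2 := hs0.trans (min_le_left _ _)
  have hsδ : s ≤ δ := hs0.trans (min_le_right _ _)
  have hK : IsCompact (closedBall x δ) := isCompact_closedBall x δ
  have hck : Continuous (scaledKer N (rhoKer N) x s) := by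
    have := (contDiff_rhoKer (N := N) (n := 0)).continuous
    unfold scaledKer; fun_prop
  have hk0 : ∀ y, 0 ≤ scaledKer N (rhoKer N) x s y := fun y =>
    mul_nonneg (by positivity) (rhoKer_nonneg _)
  have hkI : ∫ y in closedBall x δ, scaledKer N (rhoKer N) x s y = m₀ := by
    refine Eq.trans ?_ (integral_scaledKer (rhoKer N) x hs)
    exact setIntegral_eq_integral_of_forall_compl_eq_zero fun y hy =>
      scaledKer_eq_zero (fun z => rhoKer_eq_zero) N hs
        fun hc => hy (closedBall_subset_closedBall hsδ hc)
  have hi : IntegrableOn (scaledKer N (rhoKer N) x s) (closedBall x δ) :=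
    hck.continuousOn.integrableOn_compact hK
  have hi2 : IntegrableOn (fun y => w y * scaledKer N (rhoKer N) x s y) (closedBall x δ) :=
    (hw.mul hck.continuousOn).integrableOn_compact hK
  rw [← hkI, ← integral_const_mul, ← integral_sub hi2 (hi.const_mul _)]
  calc |∫ y in closedBall x δ, (w y * scaledKer N (rhoKer N) x s y -
          w x * scaledKer N (rhoKer N) x s y)|
      ≤ ∫ y in closedBall x δ, ε / (m₀ + 1) * scaledKer N (rhoKer N) x s y := by
        rw [← Real.norm_eq_abs]
        refine norm_integral_le_of_norm_le (hi.const_mul _) (Eventually.of_forall fun y => ?_)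
        rw [← sub_mul, norm_mul, Real.norm_of_nonneg (hk0 y)]
        by_cases hy : y ∈ closedBall x s
        · refine mul_le_mul_of_nonneg_right ?_ (hk0 y)
          have := hdw (x := y) (by rw [mem_closedBall] at hy; linarith)
          rw [Real.dist_eq] at this
          exact this.le
        · rw [scaledKer_eq_zero (fun z => rhoKer_eq_zero) N hs hy]; simp
    _ = ε / (m₀ + 1) * m₀ := by rw [integral_const_mul, hkI]
    _ ≤ ε := by
        rw [div_mul_eq_mul_div, div_le_iff₀ (by positivity)]
        nlinarith

end MeanValue

section Estimates

variable {N : ℕ}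

theorem hasCompactSupport_of_eq_zero {θ : Euc N → ℝ} (hθ : ∀ z, 1 ≤ ‖z‖ → θ z = 0) :
    HasCompactSupport θ := by
  refine HasCompactSupport.intro (isCompact_closedBall (0 : Euc N) 1) fun z hz => hθ z ?_
  rw [mem_closedBall_zero_iff, not_le] at hz
  exact hz.le

theorem integral_rhoKer_pos : 0 < ∫ z : Euc N, rhoKer N z := by
  refine (contDiff_rhoKer (n := 0)).continuous.integral_pos_of_hasCompactSupport_nonneg_nonzero
    (hasCompactSupport_of_eq_zero fun z => rhoKer_eq_zero) rhoKer_nonneg (x := 0) ?_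
  rw [rhoKer_eq_one (by simp)]; exact one_ne_zero

theorem continuousOn_potKer_integrand {m : ℕ} {θ : Euc N → ℝ} (hθ : Continuous θ) {s t : ℝ}
    (hs : 0 < s) (w : Euc N) : ContinuousOn (fun τ : ℝ => (τ⁻¹) ^ m * θ (τ⁻¹ • w)) (Icc s t) := by
  have hi : ContinuousOn (fun τ : ℝ => τ⁻¹) (Icc s t) :=
    continuousOn_id.inv₀ fun τ hτ => (hs.trans_le hτ.1).ne'
  exact (hi.pow m).mul (hθ.comp_continuousOn (hi.smul continuousOn_const))

theorem potKer_etaKer_nonneg (m : ℕ) {s t : ℝ} (hs : 0 < s) (hst : s ≤ t) (w : Euc N) :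
    0 ≤ potKer m (etaKer N) s t w :=
  intervalIntegral.integral_nonneg hst fun τ hτ => by
    have : 0 < τ := hs.trans_le hτ.1
    exact mul_nonneg (by positivity) (etaKer_nonneg _)

theorem le_potKer_etaKer (m : ℕ) {s δ : ℝ} (hs : 0 < s) (hsδ : s ≤ δ / 2) {w : Euc N}
    (hw : ‖w‖ ≤ δ / 4) : (δ⁻¹) ^ m * (δ / 16) ≤ potKer m (etaKer N) s δ w := by
  have hη := (contDiff_etaKer (N := N) (n := 0)).continuous
  have hδ : 0 < δ := by linarith
  have hi : ∀ a b : ℝ, 0 < a → a ≤ b → IntervalIntegrable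
      (fun τ : ℝ => (τ⁻¹) ^ m * etaKer N (τ⁻¹ • w)) volume a b := fun a b ha hab =>
    ContinuousOn.intervalIntegrable (by
      rw [uIcc_of_le hab]; exact continuousOn_potKer_integrand hη ha w)
  unfold potKer
  rw [← intervalIntegral.integral_add_adjacent_intervals (hi _ _ hs hsδ)
    (hi (δ / 2) δ (by positivity) (by linarith))]
  have h1 := potKer_etaKer_nonneg m hs hsδ w
  have h2 : ∫ _ in (δ / 2)..δ, (δ⁻¹) ^ m * (1 / 8) ≤
      ∫ τ in (δ / 2)..δ, (τ⁻¹) ^ m * etaKer N (τ⁻¹ • w) := by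
    refine intervalIntegral.integral_mono_on (by linarith) (by simp)
      (hi _ _ (by positivity) (by linarith)) fun τ hτ => ?_
    have hτ0 : 0 < τ := by linarith [hτ.1]
    refine mul_le_mul ?_ (le_etaKer ?_) (by norm_num) (by positivity)
    · gcongr; exact hτ.2
    · rw [norm_smul, norm_inv, Real.norm_of_nonneg hτ0.le, inv_mul_le_iff₀ hτ0]
      linarith [hτ.1]
  rw [intervalIntegral.integral_const, smul_eq_mul] at h2
  unfold potKer at h1
  nlinarith

theorem lintegral_Ioi_inv_pow_le {m : ℕ} (hm : 2 ≤ m) {c : ℝ} (hc : 0 < c) :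
    ∫⁻ τ in Ioi c, ENNReal.ofReal ((τ⁻¹) ^ m) ≤ ENNReal.ofReal (c ^ (-((m : ℝ) - 1))) := by
  have hm' : (2 : ℝ) ≤ m := by exact_mod_cast hm
  have e : ∀ τ ∈ Ioi c, (τ⁻¹) ^ m = τ ^ (-(m : ℝ)) := fun τ hτ => by
    rw [Real.rpow_neg (hc.trans hτ).le, Real.rpow_natCast, inv_pow]
  rw [setLIntegral_congr_fun (g := fun τ => ENNReal.ofReal (τ ^ (-(m : ℝ)))) measurableSet_Ioi
      fun τ hτ => by simp only [e τ hτ],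
    ← ofReal_integral_eq_lintegral_ofReal (integrableOn_Ioi_rpow_of_lt (by linarith) hc)
    ((ae_restrict_iff' measurableSet_Ioi).2 <| Eventually.of_forall fun τ hτ =>
      Real.rpow_nonneg (hc.trans hτ).le _),
    integral_Ioi_rpow_of_lt (by linarith) hc]
  refine ENNReal.ofReal_le_ofReal ?_
  rw [show -(m : ℝ) + 1 = -((m : ℝ) - 1) by ring, neg_div_neg_eq]
  exact div_le_self (Real.rpow_nonneg hc.le _) (by linarith)

theorem enorm_potKer_le {m : ℕ} (hm : 2 ≤ m) {θ : Euc N → ℝ} (hθ : ∀ z, 1 ≤ ‖z‖ → θ z = 0)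
    {C : ℝ} (hC : ∀ z, |θ z| ≤ C) {s δ : ℝ} (hs : 0 < s) (hsδ : s ≤ δ) (w : Euc N) :
    ‖potKer m θ s δ w‖ₑ ≤ ENNReal.ofReal C * ‖w‖ₑ ^ (-((m : ℝ) - 1)) := by
  have hm' : (2 : ℝ) ≤ m := by exact_mod_cast hm
  have hC0 : 0 ≤ C := (abs_nonneg _).trans (hC 0)
  rcases eq_or_ne w 0 with rfl | hw
  · rcases hC0.eq_or_lt with rfl | hC0
    · have : θ = 0 := funext fun z => abs_nonpos_iff.1 (hC z)
      simp [potKer, this]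
    · rw [enorm_zero, ENNReal.zero_rpow_of_neg (by linarith), ENNReal.mul_top (by simpa)]
      exact le_top
  have hwp := norm_pos_iff.2 hw
  unfold potKer
  rw [intervalIntegral.integral_of_le hsδ]
  calc ‖∫ τ in Ioc s δ, (τ⁻¹) ^ m * θ (τ⁻¹ • w)‖ₑ
      ≤ ∫⁻ τ in Ioc s δ, ‖(τ⁻¹) ^ m * θ (τ⁻¹ • w)‖ₑ := enorm_integral_le_lintegral_enorm _
    _ ≤ ∫⁻ τ in Ioc s δ, (Ioi ‖w‖).indicator
          (fun τ => ENNReal.ofReal C * ENNReal.ofReal ((τ⁻¹) ^ m)) τ := by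
        refine setLIntegral_mono' measurableSet_Ioc fun τ hτ => ?_
        have hτ0 : 0 < τ := hs.trans hτ.1
        by_cases h : τ ∈ Ioi ‖w‖
        · rw [indicator_of_mem h, enorm_mul, mul_comm, Real.enorm_eq_ofReal_abs,
            Real.enorm_eq_ofReal_abs,
            abs_of_nonneg (pow_nonneg (inv_nonneg.2 hτ0.le) m)]
          gcongr
          exact hC _
        · rw [hθ, mul_zero, enorm_zero]
          · exact zero_le
          · rw [mem_Ioi, not_lt] at h
            rw [norm_smul, norm_inv, Real.norm_of_nonneg hτ0.le, inv_mul_eq_div, one_le_div hτ0]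
            exact h
    _ ≤ ∫⁻ τ, (Ioi ‖w‖).indicator
          (fun τ => ENNReal.ofReal C * ENNReal.ofReal ((τ⁻¹) ^ m)) τ := setLIntegral_le_lintegral _ _
    _ = ENNReal.ofReal C * ∫⁻ τ in Ioi ‖w‖, ENNReal.ofReal ((τ⁻¹) ^ m) := by
        rw [lintegral_indicator measurableSet_Ioi, lintegral_const_mul _ (by fun_prop)]
    _ ≤ _ := by
        gcongr
        refine (lintegral_Ioi_inv_pow_le hm hwp).trans_eq ?_
        rw [← ENNReal.ofReal_rpow_of_pos hwp, ofReal_norm]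

/-- A positive function, continuous on the whole space, twice continuously differentiable and
superharmonic away from the origin. -/
structure IsSuperharm (u : Euc N → ℝ) : Prop where
  continuous : Continuous u
  contDiffOn : ContDiffOn ℝ 2 u {0}ᶜ
  pos : ∀ x, 0 < u x
  lap_nonpos : ∀ x, x ≠ 0 → lap u x ≤ 0

theorem continuous_scaledKer {κ : Euc N → ℝ} (hκ : Continuous κ) (k : ℕ) (x : Euc N) (s : ℝ) :
    Continuous (scaledKer k κ x s) := by
  unfold scaledKer; fun_prop

theorem IsSuperharm.representation_rhoKer (hN : 3 ≤ N) {u : Euc N → ℝ} (hu : IsSuperharm u)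
    {x : Euc N} {s δ : ℝ} (hs : 0 < s) (hsδ : s ≤ δ) (hδ : δ < ‖x‖) :
    ∫ y in closedBall x δ, u y * scaledKer N (rhoKer N) x s y =
      (∫ y in closedBall x δ, u y * scaledKer N (rhoKer N) x δ y) +
      ∫ y in closedBall x δ, -lap u y * potKer (N - 1) (etaKer N) s δ (y - x) := by
  have := mean_representation (isMeanKernel_rhoKer (N := N)) (m := N - 1) (by omega)
    hu.contDiffOn hs hsδ hδ
  simp only [neg_mul, integral_neg]
  rw [← this]; simp

theorem continuous_potKer {m : ℕ} {θ : Euc N → ℝ} (hθ : Continuous θ) {s t : ℝ}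
    (hs : 0 < s) (hst : s ≤ t) : Continuous (potKer m θ s t) := by
  have e : potKer m θ s t = fun w => ∫ τ in s..t, ((max τ s)⁻¹) ^ m * θ ((max τ s)⁻¹ • w) := by
    funext w
    refine intervalIntegral.integral_congr fun τ hτ => ?_
    rw [uIcc_of_le hst] at hτ
    simp only [max_eq_left hτ.1]
  rw [e]
  refine intervalIntegral.continuous_parametric_intervalIntegral_of_continuous' ?_ s t
  have hi : Continuous fun z : Euc N × ℝ => (max z.2 s)⁻¹ :=
    (continuous_snd.max continuous_const).inv₀ fun z => (lt_max_of_lt_right hs).ne'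
  exact (hi.pow m).mul (hθ.comp (hi.smul continuous_fst))

theorem IsSuperharm.lower_of_forall {u : Euc N → ℝ} (hu : IsSuperharm u)
    {x : Euc N} {δ A : ℝ} (hδ0 : 0 < δ)
    (h : ∀ s, 0 < s → s ≤ δ / 2 → A ≤
      ∫ y in closedBall x δ, u y * scaledKer N (rhoKer N) x s y) :
    A ≤ (∫ z, rhoKer N z) * u x := by
  refine le_of_forall_pos_le_add fun ε hε => ?_
  obtain ⟨s₀, hs₀, hs⟩ := exists_abs_integral_scaledKer_sub_le hδ0
    (hu.continuous.continuousOn (s := closedBall x δ)) hε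
  have h1 := hs (min s₀ (δ / 2)) (by positivity) (min_le_left _ _)
  have h2 := h (min s₀ (δ / 2)) (by positivity) (min_le_right _ _)
  rw [abs_le] at h1
  linarith [h1.2]

theorem IsSuperharm.lower (hN : 3 ≤ N) {u : Euc N → ℝ} (hu : IsSuperharm u)
    {x : Euc N} {δ : ℝ} (hδ0 : 0 < δ) (hδ : δ < ‖x‖) :
    (δ⁻¹) ^ N * (∫ y in closedBall x (δ / 2), u y) +
      (δ⁻¹) ^ (N - 1) * (δ / 16) * (∫ y in closedBall x (δ / 4), -lap u y) ≤
      (∫ z, rhoKer N z) * u x := by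
  refine hu.lower_of_forall hδ0 fun s hs hsδ => ?_
  have hK0 := zero_notMem_closedBall hδ
  have hK : IsCompact (closedBall x δ) := isCompact_closedBall x δ
  have hlu : ContinuousOn (lap u) (closedBall x δ) :=
    (continuousOn_lap isOpen_compl_singleton hu.contDiffOn).mono hK0
  have hρ := (contDiff_rhoKer (N := N) (n := 0)).continuous
  have hη := (contDiff_etaKer (N := N) (n := 0)).continuous
  rw [hu.representation_rhoKer hN hs (by linarith) hδ]
  have hl : ∀ y ∈ closedBall x δ, 0 ≤ -lap u y := fun y hy => by
    linarith [hu.lap_nonpos y (hK0 hy)]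
  refine add_le_add ?_ ?_
  · rw [← integral_const_mul]
    have hI : IntegrableOn (fun y => u y * scaledKer N (rhoKer N) x δ y) (closedBall x δ) :=
      ((hu.continuous.mul (continuous_scaledKer hρ N x δ)).continuousOn).integrableOn_compact hK
    have hsub : closedBall x (δ / 2) ⊆ closedBall x δ := closedBall_subset_closedBall (by linarith)
    refine (setIntegral_mono_on ?_ (hI.mono_set hsub) measurableSet_closedBall ?_).trans
      (setIntegral_mono_set hI ?_ hsub.eventuallyLE)
    · exact ((hu.continuous.const_mul _).continuousOn).integrableOn_compact
        (isCompact_closedBall x _)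
    · intro y hy
      unfold scaledKer
      rw [rhoKer_eq_one, mul_one, mul_comm]
      rw [mem_closedBall, dist_eq_norm] at hy
      rw [norm_smul, norm_inv, Real.norm_of_nonneg hδ0.le, inv_mul_le_iff₀ hδ0]
      linarith
    · exact Eventually.of_forall fun y => mul_nonneg (hu.pos y).le
        (mul_nonneg (by positivity) (rhoKer_nonneg _))
  · rw [← integral_const_mul]
    have hI : IntegrableOn (fun y => -lap u y * potKer (N - 1) (etaKer N) s δ (y - x))
        (closedBall x δ) :=
      (hlu.neg.mul ((continuous_potKer hη hs (by linarith)).comp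
        (continuous_id.sub continuous_const)).continuousOn).integrableOn_compact hK
    have hsub : closedBall x (δ / 4) ⊆ closedBall x δ := closedBall_subset_closedBall (by linarith)
    refine (setIntegral_mono_on ?_ (hI.mono_set hsub) measurableSet_closedBall ?_).trans
      (setIntegral_mono_set hI ?_ hsub.eventuallyLE)
    · exact ((continuousOn_const.mul hlu.neg).mono hsub).integrableOn_compact
        (isCompact_closedBall x _)
    · intro y hy
      rw [mul_comm]
      refine mul_le_mul_of_nonneg_left (le_potKer_etaKer _ hs hsδ ?_) (hl y (hsub hy))
      rwa [mem_closedBall, dist_eq_norm] at hy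
    · exact (ae_restrict_iff' measurableSet_closedBall).2 <| Eventually.of_forall fun y hy =>
        mul_nonneg (hl y hy) (potKer_etaKer_nonneg _ hs (by linarith) _)

theorem exists_bound_of_eq_zero {θ : Euc N → ℝ} (hc : Continuous θ)
    (hθ : ∀ z, 1 ≤ ‖z‖ → θ z = 0) : ∃ C, 0 < C ∧ ∀ z, |θ z| ≤ C := by
  obtain ⟨C, hC⟩ := (hasCompactSupport_of_eq_zero hθ).exists_bound_of_continuous hc
  exact ⟨max C 1, by positivity, fun z => (hC z).trans (le_max_left _ _)⟩

/-- Uniform bound for averages against a scaled mean kernel. -/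
theorem exists_enorm_integral_scaledKer_le (hN : 3 ≤ N) {j : ℕ} {κ θ : Euc N → ℝ}
    (h : IsMeanKernel j κ θ) : ∃ C, 0 < C ∧ ∀ u : Euc N → ℝ, IsSuperharm u → ∀ (x : Euc N)
      (s δ : ℝ), 0 < s → s ≤ δ → δ < ‖x‖ →
      ‖∫ y in closedBall x δ, u y * scaledKer (N + j) κ x s y‖ₑ ≤ ENNReal.ofReal C *
        (ENNReal.ofReal ((δ⁻¹) ^ (N + j) * ∫ y in closedBall x δ, u y) +
        ∫⁻ y in closedBall x δ, ‖lap u y‖ₑ * ‖y - x‖ₑ ^ (-((N : ℝ) + j - 2))) := by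
  obtain ⟨C₁, hC₁, h₁⟩ := exists_bound_of_eq_zero h.contDiff_left.continuous h.left_eq_zero
  obtain ⟨C₂, hC₂, h₂⟩ := exists_bound_of_eq_zero h.contDiff_right.continuous h.right_eq_zero
  refine ⟨max C₁ C₂, by positivity, fun u hu x s δ hs hsδ hδ => ?_⟩
  have hrep := mean_representation h (m := N + j - 1) (by omega) hu.contDiffOn hs hsδ hδ
  have hδ0 := hs.trans_le hsδ
  have hui : IntegrableOn u (closedBall x δ) :=
    hu.continuous.continuousOn.integrableOn_compact (isCompact_closedBall x δ)
  rw [← sub_sub_cancel (∫ y in closedBall x δ, u y * scaledKer (N + j) κ x δ y)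
    (∫ y in closedBall x δ, u y * scaledKer (N + j) κ x s y), hrep, mul_add]
  refine enorm_sub_le.trans (add_le_add ?_ ?_)
  · rw [← ENNReal.ofReal_mul (by positivity), Real.enorm_eq_ofReal_abs, ← Real.norm_eq_abs,
      ← mul_assoc, ← integral_const_mul]
    refine ENNReal.ofReal_le_ofReal (norm_integral_le_of_norm_le (hui.const_mul _)
      (Eventually.of_forall fun y => ?_))
    unfold scaledKer
    rw [norm_mul, norm_mul, Real.norm_of_nonneg (hu.pos y).le,
      Real.norm_of_nonneg (by positivity), mul_comm]
    refine mul_le_mul_of_nonneg_right ?_ (hu.pos y).le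
    rw [mul_comm]
    exact mul_le_mul_of_nonneg_right ((h₁ _).trans (le_max_left _ _)) (by positivity)
  · refine (enorm_integral_le_lintegral_enorm _).trans ?_
    rw [← lintegral_const_mul' _ _ ENNReal.ofReal_ne_top]
    refine lintegral_mono fun y => ?_
    rw [enorm_mul, mul_left_comm]
    have := enorm_potKer_le (m := N + j - 1) (by omega) h.right_eq_zero
      (fun z => (h₂ z).trans (le_max_right C₁ C₂)) hs hsδ (y - x)
    rw [show ((N + j - 1 : ℕ) : ℝ) - 1 = (N : ℝ) + j - 2 by
      rw [Nat.cast_sub (by omega)]; push_cast; ring] at this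
    gcongr

theorem le_of_forall_pos_ofReal_le {a b : ℝ} {c : ENNReal}
    (h : ∀ ε > 0, ∃ t, |t - a * b| ≤ ε ∧ ‖t‖ₑ ≤ c) : ENNReal.ofReal |a * b| ≤ c := by
  refine ENNReal.le_of_forall_pos_le_add fun ε hε _ => ?_
  obtain ⟨t, ht, htc⟩ := h ε (by exact_mod_cast hε)
  calc ENNReal.ofReal |a * b| ≤ ENNReal.ofReal (|t| + ε) := by
        refine ENNReal.ofReal_le_ofReal ?_
        have := abs_sub_abs_le_abs_sub (a * b) t
        rw [abs_sub_comm] at this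
        linarith
    _ = ENNReal.ofReal |t| + ε := by
        rw [ENNReal.ofReal_add (abs_nonneg _) (by positivity), ENNReal.ofReal_coe_nnreal]
    _ ≤ c + ε := by
        gcongr; rwa [← Real.enorm_eq_ofReal_abs]

theorem pd_scaledKer (i : Fin N) (x : Euc N) (s : ℝ) :
    pd i (scaledKer N (rhoKer N) x s) = scaledKer (N + 1) (pd i (rhoKer N)) x s := by
  have hρ : Differentiable ℝ (rhoKer N) :=
    (contDiff_rhoKer (n := 1)).differentiable (by norm_num)
  funext y
  have hd : DifferentiableAt ℝ (fun y : Euc N => rhoKer N (s⁻¹ • (y - x))) y := by fun_prop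
  unfold scaledKer
  rw [pd_const_mul hd, pd_comp_smul_sub hρ]
  ring

theorem exists_upper (hN : 3 ≤ N) : ∃ C, 0 < C ∧ ∀ u : Euc N → ℝ, IsSuperharm u →
    ∀ (x : Euc N) (δ : ℝ), 0 < δ → δ < ‖x‖ →
      ENNReal.ofReal (u x) ≤ ENNReal.ofReal C *
        (ENNReal.ofReal ((δ⁻¹) ^ N * ∫ y in closedBall x δ, u y) +
        ∫⁻ y in closedBall x δ, ‖lap u y‖ₑ * ‖y - x‖ₑ ^ (-((N : ℝ) - 2))) := by
  obtain ⟨C, hC, h⟩ := exists_enorm_integral_scaledKer_le hN (isMeanKernel_rhoKer (N := N))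
  have hm := integral_rhoKer_pos (N := N)
  refine ⟨C / ∫ z : Euc N, rhoKer N z, by positivity, fun u hu x δ hδ0 hδ => ?_⟩
  have key : ENNReal.ofReal |u x * ∫ z, rhoKer N z| ≤ _ :=
    le_of_forall_pos_ofReal_le fun ε hε => by
      obtain ⟨s₀, hs₀, hs⟩ := exists_abs_integral_scaledKer_sub_le hδ0
        (hu.continuous.continuousOn (s := closedBall x δ)) hε
      exact ⟨_, hs (min s₀ δ) (by positivity) (min_le_left _ _),
        h u hu x (min s₀ δ) δ (by positivity) (min_le_right _ _) hδ⟩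
  rw [abs_of_pos (mul_pos (hu.pos x) hm), ENNReal.ofReal_mul (hu.pos x).le] at key
  rw [ENNReal.ofReal_div_of_pos hm, ENNReal.mul_comm_div, ← mul_div_assoc, mul_comm,
    ENNReal.le_div_iff_mul_le (by simp [hm]) (by simp)]
  · simpa [mul_comm] using key

theorem exists_grad_upper (hN : 3 ≤ N) : ∃ C, 0 < C ∧ ∀ u : Euc N → ℝ, IsSuperharm u →
    ∀ (x : Euc N) (δ : ℝ) (i : Fin N), 0 < δ → δ < ‖x‖ →
      ENNReal.ofReal |pd i u x| ≤ ENNReal.ofReal C *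
        (ENNReal.ofReal ((δ⁻¹) ^ (N + 1) * ∫ y in closedBall x δ, u y) +
        ∫⁻ y in closedBall x δ, ‖lap u y‖ₑ * ‖y - x‖ₑ ^ (-((N : ℝ) - 1))) := by
  have hex := fun i => exists_enorm_integral_scaledKer_le hN (isMeanKernel_pd_rhoKer (N := N) i)
  choose C hC h using hex
  have hm := integral_rhoKer_pos (N := N)
  have hsum : 0 ≤ ∑ i, C i := Finset.sum_nonneg fun i _ => (hC i).le
  refine ⟨(1 + ∑ i, C i) / ∫ z : Euc N, rhoKer N z, by positivity, fun u hu x δ i hδ0 hδ => ?_⟩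
  have hCi : C i ≤ 1 + ∑ i, C i := by
    have := Finset.single_le_sum (fun i _ => (hC i).le) (Finset.mem_univ i)
    linarith
  have hK0 := zero_notMem_closedBall hδ
  have hρ := contDiff_rhoKer (N := N) (n := 1)
  have hcp : ContinuousOn (pd i u) (closedBall x δ) :=
    (contDiffOn_pd (n := 0) isOpen_compl_singleton
      (by simpa using hu.contDiffOn.of_le (by norm_num)) i).continuousOn.mono hK0
  have key : ENNReal.ofReal |pd i u x * ∫ z, rhoKer N z| ≤ _ :=
    le_of_forall_pos_ofReal_le fun ε hε => by
      obtain ⟨s₀, hs₀, hs⟩ := exists_abs_integral_scaledKer_sub_le hδ0 hcp hε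
      have hs0 : 0 < min s₀ δ := by positivity
      refine ⟨_, hs (min s₀ δ) hs0 (min_le_left _ _), ?_⟩
      refine le_of_eq_of_le ?_ (h i u hu x (min s₀ δ) δ hs0 (min_le_right _ _) hδ)
      set s := min s₀ δ
      have hsδ : s ≤ δ := min_le_right _ _
      have hsc : ContDiff ℝ 1 (scaledKer N (rhoKer N) x s) := by
        unfold scaledKer
        have : ContDiff ℝ 1 (rhoKer N) := hρ
        fun_prop
      have hts : tsupport (scaledKer N (rhoKer N) x s) ⊆ closedBall x s :=
        closure_minimal (fun y hy => by
          by_contra hc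
          exact hy (scaledKer_eq_zero (fun z => rhoKer_eq_zero) N hs0 hc)) isClosed_closedBall
      have hts2 := hts.trans (closedBall_subset_closedBall hsδ)
      have hcs : HasCompactSupport (scaledKer N (rhoKer N) x s) :=
        (isCompact_closedBall x δ).of_isClosed_subset (isClosed_tsupport _) hts2
      have e := integral_mul_pd isOpen_compl_singleton (hu.contDiffOn.of_le (by norm_num)) hsc hcs
        (hts2.trans hK0) i
      rw [setIntegral_eq_integral_of_forall_compl_eq_zero,
        setIntegral_eq_integral_of_forall_compl_eq_zero, ← pd_scaledKer, e, enorm_neg]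
      · intro y hy
        rw [← pd_scaledKer, image_eq_zero_of_notMem_tsupport fun hc =>
          hy (hts2 (tsupport_pd_subset _ i hc)), mul_zero]
      · intro y hy
        rw [image_eq_zero_of_notMem_tsupport fun hc => hy (hts2 hc), mul_zero]
  rw [abs_mul, abs_of_pos hm, ENNReal.ofReal_mul (abs_nonneg _)] at key
  rw [ENNReal.ofReal_div_of_pos hm, ENNReal.mul_comm_div, ← mul_div_assoc, mul_comm,
    ENNReal.le_div_iff_mul_le (by simp [hm]) (by simp)]
  · rw [show -((N : ℝ) + (1 : ℕ) - 2) = -((N : ℝ) - 1) by push_cast; ring] at key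
    refine key.trans ?_
    rw [mul_comm]
    gcongr

end Estimates

section Energy

variable {N : ℕ}

/-- Positive solutions of the system on the whole space, with superharmonicity recorded. -/
structure IsSol (a b p q : ℝ) (u v : Euc N → ℝ) : Prop where
  left : IsSuperharm u
  right : IsSuperharm v
  eq_left : ∀ x, x ≠ 0 → -lap u x = ‖x‖ ^ a * v x ^ p
  eq_right : ∀ x, x ≠ 0 → -lap v x = ‖x‖ ^ b * u x ^ q

theorem IsSol.symm {a b p q : ℝ} {u v : Euc N → ℝ} (h : IsSol a b p q u v) :
    IsSol b a q p v u := ⟨h.right, h.left, h.eq_right, h.eq_left⟩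

theorem IsHHSol.isSol {a b p q : ℝ} {u v : Euc N → ℝ} (h : IsHHSol a b p q univ u v) :
    IsSol a b p q u v := by
  obtain ⟨h1, h2, h3, h4, h5, h6, h7, h8⟩ := h
  have e : (univ \ {0} : Set (Euc N)) = {0}ᶜ := by ext; simp
  rw [e] at h3 h4 h7 h8
  rw [continuousOn_univ] at h1 h2
  refine ⟨⟨h1, h3, fun x => h5 x trivial, fun x hx => ?_⟩,
    ⟨h2, h4, fun x => h6 x trivial, fun x hx => ?_⟩, h7, h8⟩
  · have := h7 x hx
    have h0 : 0 ≤ ‖x‖ ^ a * v x ^ p :=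
      mul_nonneg (Real.rpow_nonneg (norm_nonneg _) _) (Real.rpow_nonneg (h6 x trivial).le _)
    linarith
  · have := h8 x hx
    have h0 : 0 ≤ ‖x‖ ^ b * u x ^ q :=
      mul_nonneg (Real.rpow_nonneg (norm_nonneg _) _) (Real.rpow_nonneg (h5 x trivial).le _)
    linarith

theorem IsSuperharm.continuousOn_lap {u : Euc N → ℝ} (hu : IsSuperharm u) :
    ContinuousOn (lap u) {0}ᶜ :=
  _root_.continuousOn_lap isOpen_compl_singleton hu.contDiffOn

theorem exists_rpow_bounds (a : ℝ) {s t : ℝ} (hs : 0 < s) :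
    ∃ c C, 0 < c ∧ 0 < C ∧ ∀ τ, s ≤ τ → τ ≤ t → c ≤ τ ^ a ∧ τ ^ a ≤ C := by
  by_cases hst : s ≤ t
  · have hc : ContinuousOn (fun τ : ℝ => τ ^ a) (Icc s t) :=
      continuousOn_id.rpow_const fun τ hτ => Or.inl (hs.trans_le hτ.1).ne'
    have hne : (Icc s t).Nonempty := ⟨s, le_rfl, hst⟩
    obtain ⟨m, hm, hmin⟩ := isCompact_Icc.exists_isMinOn hne hc
    obtain ⟨M, hM, hmax⟩ := isCompact_Icc.exists_isMaxOn hne hc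
    exact ⟨m ^ a, M ^ a, Real.rpow_pos_of_pos (hs.trans_le hm.1) a,
      Real.rpow_pos_of_pos (hs.trans_le hM.1) a, fun τ h1 h2 => ⟨hmin ⟨h1, h2⟩, hmax ⟨h1, h2⟩⟩⟩
  · exact ⟨1, 1, one_pos, one_pos, fun τ h1 h2 => absurd (h1.trans h2) hst⟩

/-- The closed annulus of radii `1/2` and `5/2`. -/
def shell (N : ℕ) : Set (Euc N) := {y | 1 / 2 ≤ ‖y‖ ∧ ‖y‖ ≤ 5 / 2}

theorem norm_bounds_of_mem {x y : Euc N} (hx : x ∈ shell N) {τ : ℝ} (hτ : τ ≤ 1 / 4)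
    (hy : y ∈ closedBall x τ) : 1 / 4 ≤ ‖y‖ ∧ ‖y‖ ≤ 3 := by
  rw [mem_closedBall, dist_eq_norm] at hy
  have h1 := norm_sub_norm_le y x
  have h2 := norm_sub_norm_le x y
  rw [norm_sub_rev x y] at h2
  constructor <;> linarith [hx.1, hx.2]

theorem IsSuperharm.integrableOn_lap {u : Euc N → ℝ} (hu : IsSuperharm u) {K : Set (Euc N)}
    (hK : IsCompact K) (h0 : K ⊆ {0}ᶜ) : IntegrableOn (fun y => -lap u y) K :=
  (hu.continuousOn_lap.mono h0).neg.integrableOn_compact hK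

theorem exists_local_lower (hN : 3 ≤ N) : ∃ c, 0 < c ∧ ∀ u : Euc N → ℝ, IsSuperharm u →
    ∀ x ∈ shell N, ∀ y ∈ closedBall x (1 / 32),
      c * (∫ z in closedBall x (1 / 32), u z) ≤ u y ∧
      c * (∫ z in closedBall x (1 / 32), -lap u z) ≤ u y := by
  have hm := integral_rhoKer_pos (N := N)
  set m := ∫ z, rhoKer N z
  refine ⟨(1 / 64) / m, by positivity, fun u hu x hx y hy => ?_⟩
  have hyb := norm_bounds_of_mem hx (by norm_num) hy
  have hy2 : (15 : ℝ) / 32 ≤ ‖y‖ := by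
    rw [mem_closedBall, dist_eq_norm] at hy
    have h2 := norm_sub_norm_le x y
    rw [norm_sub_rev x y] at h2
    linarith [hx.1]
  have h := hu.lower hN (x := y) (δ := 1 / 4) (by norm_num) (by linarith)
  have hsub : ∀ r : ℝ, 1 / 16 ≤ r → closedBall x (1 / 32) ⊆ closedBall y r := fun r hr z hz => by
    rw [mem_closedBall] at *
    have := dist_triangle z x y
    rw [dist_comm x y] at this
    linarith
  have hK0 : closedBall y (1 / 4 / 4) ⊆ {0}ᶜ := zero_notMem_closedBall (by linarith)
  have hl : ∀ z ∈ closedBall y (1 / 4 / 4), 0 ≤ -lap u z := fun z hz => by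
    linarith [hu.lap_nonpos z (hK0 hz)]
  have h1 : ∫ z in closedBall x (1 / 32), u z ≤ ∫ z in closedBall y (1 / 4 / 2), u z :=
    setIntegral_mono_set (hu.continuous.continuousOn.integrableOn_compact
      (isCompact_closedBall _ _)) (Eventually.of_forall fun z => (hu.pos z).le)
      (hsub _ (by norm_num)).eventuallyLE
  have h2 : ∫ z in closedBall x (1 / 32), -lap u z ≤ ∫ z in closedBall y (1 / 4 / 4), -lap u z :=
    setIntegral_mono_set (hu.integrableOn_lap (isCompact_closedBall _ _) hK0)
      ((ae_restrict_iff' measurableSet_closedBall).2 <| Eventually.of_forall hl)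
      (hsub _ (by norm_num)).eventuallyLE
  have hA : 0 ≤ ∫ z in closedBall y (1 / 4 / 2), u z :=
    integral_nonneg fun z => (hu.pos z).le
  have hB : 0 ≤ ∫ z in closedBall y (1 / 4 / 4), -lap u z :=
    setIntegral_nonneg measurableSet_closedBall hl
  have hp : ∀ k : ℕ, (1 : ℝ) ≤ ((1 / 4 : ℝ)⁻¹) ^ k := fun k => one_le_pow₀ (by norm_num)
  have hp1 := hp N
  have hp2 := hp (N - 1)
  have hdiv : ∀ I : ℝ, 1 / 64 * I ≤ m * u y → 1 / 64 / m * I ≤ u y := fun I hI => by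
    rw [div_mul_eq_mul_div, div_le_iff₀ hm, mul_comm (u y)]; exact hI
  have t1 : (∫ z in closedBall y (1 / 4 / 2), u z) ≤
      ((1 / 4 : ℝ)⁻¹) ^ N * ∫ z in closedBall y (1 / 4 / 2), u z := le_mul_of_one_le_left hA hp1
  have t2 : 1 / 64 * (∫ z in closedBall y (1 / 4 / 4), -lap u z) ≤
      ((1 / 4 : ℝ)⁻¹) ^ (N - 1) * (1 / 4 / 16) * ∫ z in closedBall y (1 / 4 / 4), -lap u z :=
    mul_le_mul_of_nonneg_right (by linarith) hB
  exact ⟨hdiv _ (by linarith), hdiv _ (by linarith)⟩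

theorem exists_local_energy_lower (hN : 3 ≤ N) {a b p q : ℝ} (hp : 0 < p) :
    ∃ c, 0 < c ∧ ∀ u v : Euc N → ℝ, IsSol a b p q u v → ∀ x ∈ shell N,
      c * (∫ z in closedBall x (1 / 32), v z) ^ p ≤ ∫ z in closedBall x (1 / 32), -lap u z ∧
      c * (∫ z in closedBall x (1 / 32), -lap v z) ^ p ≤
        ∫ z in closedBall x (1 / 32), -lap u z := by
  obtain ⟨c₁, hc₁, h₁⟩ := exists_local_lower hN
  obtain ⟨c₂, _, hc₂, _, h₂⟩ := exists_rpow_bounds a (s := 1 / 4) (t := 3) (by norm_num)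
  set V := (volume : Measure (Euc N)).real (closedBall 0 (1 / 32))
  have : Nonempty (Fin N) := ⟨⟨0, by omega⟩⟩
  have hV : 0 < V := by
    refine ENNReal.toReal_pos (measure_closedBall_pos _ _ (by norm_num)).ne'
      (isCompact_closedBall _ _).measure_lt_top.ne
  refine ⟨V * (c₂ * c₁ ^ p), by positivity, fun u v huv x hx => ?_⟩
  have hK0 : closedBall x (1 / 32) ⊆ {0}ᶜ := zero_notMem_closedBall (by linarith [hx.1])
  have hVx : (volume : Measure (Euc N)).real (closedBall x (1 / 32)) = V := by
    rw [Measure.real, Measure.addHaar_closedBall_center]; rfl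
  have key : ∀ I : ℝ, 0 ≤ I → (∀ y ∈ closedBall x (1 / 32), c₁ * I ≤ v y) →
      V * (c₂ * c₁ ^ p) * I ^ p ≤ ∫ z in closedBall x (1 / 32), -lap u z := by
    intro I hI hle
    have h3 : ∫ _ in closedBall x (1 / 32), c₂ * (c₁ * I) ^ p ≤
        ∫ z in closedBall x (1 / 32), -lap u z := by
      refine setIntegral_mono_on
        (continuousOn_const.integrableOn_compact (isCompact_closedBall _ _))
        (huv.left.integrableOn_lap (isCompact_closedBall _ _) hK0) measurableSet_closedBall
        fun y hy => ?_
      rw [huv.eq_left y (hK0 hy)]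
      have hyb := norm_bounds_of_mem hx (by norm_num) hy
      exact mul_le_mul (h₂ _ hyb.1 hyb.2).1
        (Real.rpow_le_rpow (by positivity) (hle y hy) hp.le) (by positivity) (by positivity)
    rw [setIntegral_const, hVx, smul_eq_mul, Real.mul_rpow hc₁.le hI] at h3
    linarith
  refine ⟨key _ (integral_nonneg fun z => (huv.right.pos z).le)
    fun y hy => (h₁ v huv.right x hx y hy).1,
    key _ (setIntegral_nonneg measurableSet_closedBall fun z hz => ?_)
    fun y hy => (h₁ v huv.right x hx y hy).2⟩
  linarith [huv.right.lap_nonpos z (hK0 hz)]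

theorem exists_bound_of_mul_rpow_le {c r : ℝ} (hc : 0 < c) (hr : 0 < r) (M : ℝ) (hM : 0 ≤ M) :
    ∃ C, 0 < C ∧ ∀ t : ℝ, 0 ≤ t → c * t ^ r ≤ M → t ≤ C := by
  refine ⟨(M / c) ^ r⁻¹ + 1, by positivity, fun t ht h => ?_⟩
  have h1 : t ^ r ≤ M / c := by rwa [le_div_iff₀ hc, mul_comm]
  have h2 := Real.rpow_le_rpow (Real.rpow_nonneg ht r) h1 (inv_nonneg.2 hr.le)
  rw [Real.rpow_rpow_inv ht hr.ne'] at h2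
  linarith

theorem exists_local_energy_upper (hN : 3 ≤ N) {a b p q : ℝ} (hp : 0 < p) (hq : 0 < q)
    (hpq : 1 < p * q) : ∃ C, 0 < C ∧ ∀ u v : Euc N → ℝ, IsSol a b p q u v → ∀ x ∈ shell N,
      ∫ z in closedBall x (1 / 32), v z ≤ C ∧ ∫ z in closedBall x (1 / 32), -lap u z ≤ C := by
  obtain ⟨c₁, hc₁, h₁⟩ := exists_local_energy_lower (N := N) (a := a) (b := b) (q := q) hN hp
  obtain ⟨c₂, hc₂, h₂⟩ := exists_local_energy_lower (N := N) (a := b) (b := a) (q := p) hN hq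
  obtain ⟨C₁, hC₁, hb₁⟩ := exists_bound_of_mul_rpow_le (c := c₁ * c₂ ^ p) (by positivity)
    (sub_pos.2 hpq) 1 zero_le_one
  obtain ⟨C₂, hC₂, hb₂⟩ := exists_bound_of_mul_rpow_le hc₁ hp C₁ hC₁.le
  refine ⟨max C₁ C₂, by positivity, fun u v huv x hx => ?_⟩
  have hK0 : closedBall x (1 / 32) ⊆ {0}ᶜ := zero_notMem_closedBall (by linarith [hx.1])
  obtain ⟨k1, k2⟩ := h₁ u v huv x hx
  obtain ⟨-, k3⟩ := h₂ v u huv.symm x hx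
  set A := ∫ z in closedBall x (1 / 32), -lap u z
  set B := ∫ z in closedBall x (1 / 32), -lap v z
  have hA : 0 ≤ A := setIntegral_nonneg measurableSet_closedBall fun z hz => by
    linarith [huv.left.lap_nonpos z (hK0 hz)]
  have hB : 0 ≤ B := setIntegral_nonneg measurableSet_closedBall fun z hz => by
    linarith [huv.right.lap_nonpos z (hK0 hz)]
  have hAC : A ≤ C₁ := by
    rcases hA.eq_or_lt with h0 | hA
    · rw [← h0]; exact hC₁.le
    · refine hb₁ A hA.le ?_
      have h4 : (c₂ * A ^ q) ^ p ≤ B ^ p := Real.rpow_le_rpow (by positivity) k3 hp.le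
      rw [Real.mul_rpow hc₂.le (by positivity), ← Real.rpow_mul hA.le, mul_comm q p] at h4
      rw [Real.rpow_sub_one hA.ne', ← mul_div_assoc, div_le_one hA]
      refine le_trans ?_ k2
      rw [mul_assoc]
      exact mul_le_mul_of_nonneg_left h4 hc₁.le
  exact ⟨(hb₂ _ (integral_nonneg fun z => (huv.right.pos z).le) (k1.trans hAC)).trans
    (le_max_right _ _), hAC.trans (le_max_left _ _)⟩

theorem isCompact_shell : IsCompact (shell N) := by
  refine (isCompact_closedBall (0 : Euc N) (5 / 2)).of_isClosed_subset ?_ fun y hy => ?_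
  · exact (isClosed_le continuous_const continuous_norm).inter
      (isClosed_le continuous_norm continuous_const)
  · rw [mem_closedBall_zero_iff]; exact hy.2

theorem exists_shell_energy_aux (hN : 3 ≤ N) {a b p q : ℝ} (hp : 0 < p) (hq : 0 < q)
    (hpq : 1 < p * q) : ∃ C, 0 < C ∧ ∀ u v : Euc N → ℝ, IsSol a b p q u v →
      ∫⁻ z in shell N, ‖v z‖ₑ ≤ ENNReal.ofReal C ∧
      ∫⁻ z in shell N, ‖lap u z‖ₑ ≤ ENNReal.ofReal C := by
  obtain ⟨C, hC, h⟩ := exists_local_energy_upper (N := N) (a := a) (b := b) hN hp hq hpq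
  obtain ⟨t, ht, hcov⟩ := isCompact_shell (N := N).elim_nhds_subcover
    (fun x => closedBall x (1 / 32)) fun x _ => closedBall_mem_nhds x (by norm_num)
  have key : ∀ w : Euc N → ℝ, (∀ x ∈ t, ∫⁻ z in closedBall x (1 / 32), ‖w z‖ₑ ≤
      ENNReal.ofReal C) → ∫⁻ z in shell N, ‖w z‖ₑ ≤ ENNReal.ofReal ((t.card + 1) * C) := by
    intro w hw
    calc ∫⁻ z in shell N, ‖w z‖ₑ
        ≤ ∫⁻ z in ⋃ x ∈ t, closedBall x (1 / 32), ‖w z‖ₑ := lintegral_mono_set hcov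
      _ ≤ ∑ x ∈ t, ∫⁻ z in closedBall x (1 / 32), ‖w z‖ₑ := by
        have e : (⋃ x ∈ t, closedBall x (1 / 32)) = ⋃ x : t, closedBall (x : Euc N) (1 / 32) :=
          biUnion_eq_iUnion (t : Set (Euc N)) fun x _ => closedBall x (1 / 32)
        rw [e]
        refine (lintegral_iUnion_le _ _).trans_eq ?_
        rw [tsum_fintype]
        exact Finset.sum_coe_sort t fun x => ∫⁻ z in closedBall x (1 / 32), ‖w z‖ₑ
      _ ≤ ∑ x ∈ t, ENNReal.ofReal C := Finset.sum_le_sum hw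
      _ ≤ ENNReal.ofReal ((t.card + 1) * C) := by
        rw [Finset.sum_const, nsmul_eq_mul, ENNReal.ofReal_mul (by positivity)]
        gcongr
        rw [← ENNReal.ofReal_natCast]
        exact ENNReal.ofReal_le_ofReal (by linarith)
  refine ⟨(t.card + 1) * C, by positivity, fun u v huv => ⟨key v fun x hx => ?_,
    key (lap u) fun x hx => ?_⟩⟩
  · have h1 := (h u v huv x (ht x hx)).1
    refine le_trans (le_of_eq ?_) (ENNReal.ofReal_le_ofReal h1)
    rw [ofReal_integral_eq_lintegral_ofReal
      (huv.right.continuous.continuousOn.integrableOn_compact (isCompact_closedBall _ _))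
      (Eventually.of_forall fun z => (huv.right.pos z).le)]
    refine lintegral_congr fun z => ?_
    rw [Real.enorm_eq_ofReal (huv.right.pos z).le]
  · have h1 := (h u v huv x (ht x hx)).2
    have hK0 : closedBall x (1 / 32) ⊆ {0}ᶜ :=
      zero_notMem_closedBall (by linarith [(ht x hx).1])
    have hl : ∀ z ∈ closedBall x (1 / 32), 0 ≤ -lap u z := fun z hz => by
      linarith [huv.left.lap_nonpos z (hK0 hz)]
    refine le_trans (le_of_eq ?_) (ENNReal.ofReal_le_ofReal h1)
    rw [ofReal_integral_eq_lintegral_ofReal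
      (huv.left.integrableOn_lap (isCompact_closedBall _ _) hK0)
      ((ae_restrict_iff' measurableSet_closedBall).2 <| Eventually.of_forall hl)]
    refine setLIntegral_congr_fun measurableSet_closedBall fun z hz => ?_
    rw [← enorm_neg, Real.enorm_eq_ofReal (hl z hz)]

/-- Universal local energy bounds on the shell. -/
theorem exists_shell_energy (hN : 3 ≤ N) {a b p q : ℝ} (hp : 0 < p) (hq : 0 < q)
    (hpq : 1 < p * q) : ∃ C, 0 < C ∧ ∀ u v : Euc N → ℝ, IsSol a b p q u v →
      ∫⁻ z in shell N, ‖u z‖ₑ ≤ ENNReal.ofReal C ∧ ∫⁻ z in shell N, ‖v z‖ₑ ≤ ENNReal.ofReal C ∧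
      ∫⁻ z in shell N, ‖lap u z‖ₑ ≤ ENNReal.ofReal C ∧
      ∫⁻ z in shell N, ‖lap v z‖ₑ ≤ ENNReal.ofReal C := by
  obtain ⟨C₁, hC₁, h₁⟩ := exists_shell_energy_aux (N := N) (a := a) (b := b) hN hp hq hpq
  obtain ⟨C₂, hC₂, h₂⟩ := exists_shell_energy_aux (N := N) (a := b) (b := a) hN hq hp
    (by rwa [mul_comm])
  have l1 := ENNReal.ofReal_le_ofReal (le_max_left C₁ C₂)
  have l2 := ENNReal.ofReal_le_ofReal (le_max_right C₁ C₂)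
  refine ⟨max C₁ C₂, by positivity, fun u v huv => ?_⟩
  obtain ⟨k1, k2⟩ := h₁ u v huv
  obtain ⟨k3, k4⟩ := h₂ v u huv.symm
  exact ⟨k3.trans l2, k1.trans l1, k2.trans l1, k4.trans l2⟩

end Energy

section Comparison

variable {N : ℕ}

theorem eventuallyEq_pd {u w : Euc N → ℝ} {x : Euc N} (h : u =ᶠ[nhds x] w) (i : Fin N) :
    pd i u =ᶠ[nhds x] pd i w := by
  filter_upwards [h.fderiv (𝕜 := ℝ)] with y hy
  simp [pd, hy]

theorem eventually_contDiffAt {n : ℕ} {u : Euc N → ℝ} {x : Euc N} (hu : ContDiffAt ℝ n u x) :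
    ∀ᶠ y in nhds x, ContDiffAt ℝ n u y := hu.eventually (by simp)

theorem differentiableAt_pd {u : Euc N → ℝ} {x : Euc N} (hu : ContDiffAt ℝ 2 u x) (i : Fin N) :
    DifferentiableAt ℝ (pd i u) x :=
  (contDiffAt_pd (n := 1) (by simpa using hu) i).differentiableAt (by norm_num)

theorem lap_sub_const_mul {u w : Euc N → ℝ} {x : Euc N} (hu : ContDiffAt ℝ 2 u x)
    (hw : ContDiffAt ℝ 2 w x) (c : ℝ) :
    lap (fun y => u y - c * w y) x = lap u x - c * lap w x := by
  rw [lap_eq_sum_pd (hu.sub (contDiffAt_const.mul hw)), lap_eq_sum_pd hu, lap_eq_sum_pd hw,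
    Finset.mul_sum, ← Finset.sum_sub_distrib]
  refine Finset.sum_congr rfl fun i _ => ?_
  have hs : ∀ {f g : Euc N → ℝ} {y : Euc N}, DifferentiableAt ℝ f y → DifferentiableAt ℝ g y →
      pd i (fun y => f y - c * g y) y = pd i f y - c * pd i g y := fun hf hg => by
    unfold pd
    rw [fderiv_fun_sub hf (hg.const_mul c), fderiv_const_mul hg]
    simp
  have h1 : pd i (fun y => u y - c * w y) =ᶠ[nhds x] fun y => pd i u y - c * pd i w y := by
    filter_upwards [eventually_contDiffAt (n := 2) hu, eventually_contDiffAt (n := 2) hw]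
      with y h1 h2
    exact hs (h1.differentiableAt (by norm_num)) (h2.differentiableAt (by norm_num))
  rw [(eventuallyEq_pd h1 i).self_of_nhds, hs (differentiableAt_pd hu i) (differentiableAt_pd hw i)]

theorem pd_rpow {u : Euc N → ℝ} {x : Euc N} (hu : DifferentiableAt ℝ u x) (hx : 0 < u x) (r : ℝ)
    (i : Fin N) : pd i (fun y => u y ^ r) x = r * u x ^ (r - 1) * pd i u x := by
  unfold pd
  rw [(hu.hasFDerivAt.rpow_const (Or.inl hx.ne')).fderiv]
  simp

theorem lap_rpow {u : Euc N → ℝ} {x : Euc N} (hu : ContDiffAt ℝ 2 u x) (hx : 0 < u x) (r : ℝ) :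
    lap (fun y => u y ^ r) x =
      r * u x ^ (r - 1) * lap u x + r * (r - 1) * u x ^ (r - 2) * ∑ i, pd i u x ^ 2 := by
  rw [lap_eq_sum_pd (hu.rpow_const_of_ne hx.ne'), lap_eq_sum_pd hu,
    Finset.mul_sum, Finset.mul_sum, ← Finset.sum_add_distrib]
  refine Finset.sum_congr rfl fun i _ => ?_
  have hd : DifferentiableAt ℝ u x := hu.differentiableAt (by norm_num)
  have h1 : pd i (fun y => u y ^ r) =ᶠ[nhds x] fun y => r * (u y ^ (r - 1) * pd i u y) := by
    filter_upwards [eventually_contDiffAt (n := 2) hu,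
      hu.continuousAt.eventually (lt_mem_nhds hx)] with y h1 h2
    rw [pd_rpow (h1.differentiableAt (by norm_num)) h2]; ring
  have hr : DifferentiableAt ℝ (fun y => u y ^ (r - 1)) x := hd.rpow_const (Or.inl hx.ne')
  have hm : DifferentiableAt ℝ (fun y => u y ^ (r - 1) * pd i u y) x :=
    hr.mul (differentiableAt_pd hu i)
  rw [(eventuallyEq_pd h1 i).self_of_nhds, pd_const_mul hm,
    pd_mul hr (differentiableAt_pd hu i), pd_rpow hd hx, show r - 1 - 1 = r - 2 by ring]
  ring

theorem pd_pd_nonpos_of_isLocalMax {u : Euc N → ℝ} {x : Euc N} (hu : ContDiffAt ℝ 2 u x)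
    (hmax : IsLocalMax u x) (i : Fin N) : pd i (pd i u) x ≤ 0 := by
  set e : Euc N := EuclideanSpace.single i 1
  by_contra! hpos
  have hl : ∀ t : ℝ, HasDerivAt (fun t : ℝ => x + t • e) e t := fun t => by
    simpa using ((hasDerivAt_id t).smul_const e).const_add x
  have hlc : ContinuousAt (fun t : ℝ => x + t • e) 0 := (hl 0).continuousAt
  have hx0 : x + (0 : ℝ) • e = x := by simp
  have hev : ∀ {P : Euc N → Prop}, (∀ᶠ y in nhds x, P y) → ∀ᶠ t in nhds (0 : ℝ), P (x + t • e) :=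
    fun hP => hlc.eventually (by simpa using hP)
  have hder : ∀ {w : Euc N → ℝ} {t : ℝ}, DifferentiableAt ℝ w (x + t • e) →
      HasDerivAt (fun t : ℝ => w (x + t • e)) (pd i w (x + t • e)) t := fun hw =>
    hw.hasFDerivAt.comp_hasDerivAt _ (hl _)
  have h1 : deriv (fun t : ℝ => u (x + t • e)) =ᶠ[nhds 0] fun t => pd i u (x + t • e) := by
    filter_upwards [hev (eventually_contDiffAt (n := 2) hu)] with t ht
    exact (hder (ht.differentiableAt (by norm_num))).deriv
  have h2 : deriv (deriv fun t : ℝ => u (x + t • e)) 0 = pd i (pd i u) x := by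
    rw [h1.deriv_eq, (hder (w := pd i u) (t := 0) (by rw [hx0]; exact differentiableAt_pd hu i)).deriv,
      hx0]
  have hM : IsLocalMax (fun t : ℝ => u (x + t • e)) 0 := by
    have : ∀ᶠ y in nhds x, u y ≤ u (x + (0 : ℝ) • e) := by rw [hx0]; exact hmax
    exact hev this
  have hm : IsLocalMin (fun t : ℝ => u (x + t • e)) 0 :=
    isLocalMin_of_deriv_deriv_pos (by rw [h2]; exact hpos) hM.deriv_eq_zero
      (hder (w := u) (t := 0) (by rw [hx0]; exact hu.differentiableAt (by norm_num))).continuousAt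
  have hc : (fun t : ℝ => u (x + t • e)) =ᶠ[nhds 0] fun _ => u (x + (0 : ℝ) • e) := by
    filter_upwards [hM, hm] with t h3 h4
    exact le_antisymm h3 h4
  have h3 := hc.deriv.deriv_eq
  simp only [deriv_const', h2] at h3
  exact hpos.ne' h3

theorem lap_nonpos_of_isLocalMax {u : Euc N → ℝ} {x : Euc N} (hu : ContDiffAt ℝ 2 u x)
    (hmax : IsLocalMax u x) : lap u x ≤ 0 := by
  rw [lap_eq_sum_pd hu]
  exact Finset.sum_nonpos fun i _ => pd_pd_nonpos_of_isLocalMax hu hmax i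

theorem pd_sub_norm_sq (r : ℝ) (x₀ x : Euc N) (i : Fin N) :
    pd i (fun y => r - ‖y - x₀‖ ^ 2) x = -2 * (x i - x₀ i) := by
  have h := ((hasStrictFDerivAt_norm_sq (x - x₀)).hasFDerivAt.comp x
    ((hasFDerivAt_id x).sub_const x₀)).const_sub r
  have h2 : HasFDerivAt (fun y => r - ‖y - x₀‖ ^ 2) _ x := h
  have h3 : ∀ z : Euc N, inner ℝ z (EuclideanSpace.single i (1 : ℝ)) = z i := fun z => by
    simp [EuclideanSpace.inner_single_right]
  unfold pd
  rw [h2.fderiv]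
  simp [h3]

theorem contDiff_sub_norm_sq (r : ℝ) (x₀ : Euc N) :
    ContDiff ℝ 2 fun y : Euc N => r - ‖y - x₀‖ ^ 2 :=
  contDiff_const.sub ((contDiff_norm_sq ℝ).comp (contDiff_id.sub contDiff_const))

theorem lap_sub_norm_sq (r : ℝ) (x₀ x : Euc N) :
    lap (fun y => r - ‖y - x₀‖ ^ 2) x = -2 * N := by
  rw [lap_eq_sum_pd (contDiff_sub_norm_sq r x₀).contDiffAt]
  have : ∀ i, pd i (pd i fun y => r - ‖y - x₀‖ ^ 2) x = -2 := fun i => by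
    rw [show pd i (fun y : Euc N => r - ‖y - x₀‖ ^ 2) = fun x => -2 * (x i - x₀ i) from
      funext fun x => pd_sub_norm_sq r x₀ x i, pd_const_mul ((differentiableAt_coord i x).sub_const _)]
    unfold pd
    rw [fderiv_sub_const, (hasFDerivAt_coord i x).fderiv]
    simp
  simp [this]; ring

/-- The Keller–Osserman bound. -/
theorem exists_keller_osserman {σ : ℝ} (hσ : 1 < σ) : ∃ C, 0 < C ∧ ∀ (w : Euc N → ℝ) (x₀ : Euc N),
    (∀ x ∈ closedBall x₀ (1 / 2), ContDiffAt ℝ 2 w x) →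
    (∀ x ∈ closedBall x₀ (1 / 2), 0 < w x → w x ^ σ ≤ lap w x) → w x₀ ≤ C := by
  set μ := 2 / (σ - 1) with hμdef
  have hμ : 0 < μ := div_pos two_pos (by linarith)
  have hμσ : μ * σ = μ + 2 := by
    rw [hμdef]; field_simp [(sub_pos.2 hσ).ne']; ring
  set Cμ := N * μ / 2 + μ * (μ + 1) with hCμdef
  have hCμ : 0 < Cμ := by positivity
  refine ⟨Cμ ^ (σ - 1)⁻¹ * 4 ^ μ, by positivity, fun w x₀ hw hle => ?_⟩
  by_contra! hcon
  have hw0 : 0 < w x₀ := lt_trans (by positivity) hcon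
  set d : Euc N → ℝ := fun x => 1 / 4 - ‖x - x₀‖ ^ 2 with hddef
  have hd2 : ContDiff ℝ 2 d := contDiff_sub_norm_sq _ _
  have hK : IsCompact (closedBall x₀ (1 / 2)) := isCompact_closedBall _ _
  have hcont : ContinuousOn (fun x => w x * d x ^ μ) (closedBall x₀ (1 / 2)) := by
    refine ContinuousOn.mul (fun x hx => (hw x hx).continuousAt.continuousWithinAt) ?_
    exact hd2.continuous.continuousOn.rpow_const fun x _ => Or.inr hμ.le
  obtain ⟨x₁, hx₁, hmax⟩ := hK.exists_isMaxOn ⟨x₀, mem_closedBall_self (by norm_num)⟩ hcont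
  set M := w x₁ * d x₁ ^ μ with hM
  have hd0 : d x₀ = 1 / 4 := by simp [hddef]
  have hM0 : w x₀ * (1 / 4) ^ μ ≤ M := by
    have := hmax (mem_closedBall_self (x := x₀) (by norm_num : (0 : ℝ) ≤ 1 / 2))
    simpa [hd0] using this
  have hMC : Cμ ^ (σ - 1)⁻¹ < M := by
    refine lt_of_lt_of_le ?_ hM0
    rw [one_div, Real.inv_rpow (by norm_num), ← div_eq_mul_inv, lt_div_iff₀ (by positivity)]
    exact hcon
  have hMpos : 0 < M := lt_trans (by positivity) hMC
  have hdn : 0 ≤ d x₁ := by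
    rw [mem_closedBall, dist_eq_norm] at hx₁
    simp only [hddef]
    nlinarith [norm_nonneg (x₁ - x₀)]
  have hdp : 0 < d x₁ := by
    rcases hdn.eq_or_lt with h0 | h0
    · rw [hM, ← h0, Real.zero_rpow hμ.ne', mul_zero] at hMpos
      exact absurd hMpos (lt_irrefl _)
    · exact h0
  have hball : x₁ ∈ ball x₀ (1 / 2) := by
    rw [mem_ball, dist_eq_norm]
    simp only [hddef] at hdp
    nlinarith [norm_nonneg (x₁ - x₀)]
  have hdr : ∀ y, 0 < d y → d y ^ (-μ) * d y ^ μ = 1 := fun y hy => by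
    rw [← Real.rpow_add hy]; simp
  have hw1 : w x₁ = M * d x₁ ^ (-μ) := by
    rw [hM, mul_assoc, mul_comm (d x₁ ^ μ), hdr x₁ hdp, mul_one]
  have hloc : IsLocalMax (fun y => w y - M * d y ^ (-μ)) x₁ := by
    filter_upwards [isOpen_ball.mem_nhds hball,
      hd2.continuous.continuousAt.eventually (lt_mem_nhds hdp)] with y hy hdy
    have h1 : w y * d y ^ μ ≤ M := hmax (ball_subset_closedBall hy)
    rw [hw1, sub_self, sub_nonpos]
    calc w y = w y * d y ^ μ * d y ^ (-μ) := by
          rw [mul_assoc, mul_comm (d y ^ μ), hdr y hdy, mul_one]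
      _ ≤ M * d y ^ (-μ) := mul_le_mul_of_nonneg_right h1 (by positivity)
  have hr2 : ContDiffAt ℝ 2 (fun y => d y ^ (-μ)) x₁ := hd2.contDiffAt.rpow_const_of_ne hdp.ne'
  have hlap := lap_nonpos_of_isLocalMax
    ((hw x₁ hx₁).sub (contDiffAt_const.mul hr2)) hloc
  rw [lap_sub_const_mul (hw x₁ hx₁) hr2, lap_rpow hd2.contDiffAt hdp, lap_sub_norm_sq] at hlap
  have hgrad : ∑ i, pd i d x₁ ^ 2 ≤ 1 := by
    have e : ∑ i, pd i d x₁ ^ 2 = 4 * ‖x₁ - x₀‖ ^ 2 := by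
      rw [EuclideanSpace.norm_sq_eq, Finset.mul_sum]
      refine Finset.sum_congr rfl fun i _ => ?_
      rw [pd_sub_norm_sq]; simp; ring
    rw [e]
    simp only [hddef] at hdp
    linarith
  have hwp : 0 < w x₁ := by rw [hw1]; positivity
  have h1 := hle x₁ hx₁ hwp
  have hpow : w x₁ ^ σ = M ^ σ * d x₁ ^ (-μ - 2) := by
    rw [hw1, Real.mul_rpow hMpos.le (by positivity), ← Real.rpow_mul hdp.le,
      show -μ * σ = -μ - 2 by linarith]
  have hd14 : d x₁ ≤ 1 / 4 := by
    simp only [hddef]; nlinarith [sq_nonneg ‖x₁ - x₀‖]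
  have hd1 : d x₁ ^ (-μ - 1) ≤ d x₁ ^ (-μ - 2) * (1 / 4) := by
    rw [show -μ - 1 = (-μ - 2) + 1 by ring, Real.rpow_add_one hdp.ne']
    exact mul_le_mul_of_nonneg_left hd14 (by positivity)
  have hP : 0 < d x₁ ^ (-μ - 2) := by positivity
  have h2 : M ^ σ * d x₁ ^ (-μ - 2) ≤ M * (Cμ * d x₁ ^ (-μ - 2)) := by
    rw [← hpow]
    refine h1.trans ((sub_nonpos.1 hlap).trans (mul_le_mul_of_nonneg_left ?_ hMpos.le))
    have e1 : -μ * d x₁ ^ (-μ - 1) * (-2 * (N : ℝ)) ≤ N * μ / 2 * d x₁ ^ (-μ - 2) := by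
      have := mul_le_mul_of_nonneg_left hd1 (by positivity : (0 : ℝ) ≤ 2 * N * μ)
      linarith
    have e2 : -μ * (-μ - 1) * d x₁ ^ (-μ - 2) * ∑ i, pd i d x₁ ^ 2 ≤
        μ * (μ + 1) * d x₁ ^ (-μ - 2) := by
      have := mul_le_mul_of_nonneg_left hgrad
        (by positivity : (0 : ℝ) ≤ μ * (μ + 1) * d x₁ ^ (-μ - 2))
      linarith
    rw [hCμdef, add_mul]
    linarith
  have h3 : M ^ (σ - 1) ≤ Cμ := by
    rw [Real.rpow_sub_one hMpos.ne', div_le_iff₀ hMpos]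
    refine le_of_mul_le_mul_right ?_ hP
    linarith
  have h4 : M ≤ Cμ ^ (σ - 1)⁻¹ := by
    have := Real.rpow_le_rpow (by positivity) h3 (inv_nonneg.2 (sub_pos.2 hσ).le)
    rwa [Real.rpow_rpow_inv hMpos.le (sub_pos.2 hσ).ne'] at this
  linarith

theorem exists_comparison {a b p q : ℝ} (hq : 0 < q) (hqp : q ≤ p) (hpq : 1 < p * q) :
    ∃ C, 0 < C ∧ ∀ u v : Euc N → ℝ, IsSol a b p q u v → ∀ x, 1 ≤ ‖x‖ → ‖x‖ ≤ 2 →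
      v x ≤ C * u x ^ ((q + 1) / (p + 1)) + C := by
  have hp : 0 < p := hq.trans_le hqp
  set γ := (q + 1) / (p + 1) with hγdef
  have hγ : 0 < γ := by positivity
  have hγ1 : γ ≤ 1 := by rw [hγdef, div_le_one (by positivity)]; linarith
  have hγp : γ * (p + 1) = q + 1 := by rw [hγdef]; field_simp
  set σ := p + (γ - 1) / γ with hσdef
  have hσ : 1 < σ := by
    have : σ = q * (p + 1) / (q + 1) := by
      rw [hσdef, hγdef]; field_simp; ring
    rw [this, lt_div_iff₀ (by positivity)]; nlinarith
  obtain ⟨C, hC, hKO⟩ := exists_keller_osserman (N := N) hσ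
  obtain ⟨c₁, _, hc₁, _, h₁⟩ := exists_rpow_bounds a (s := 1 / 2) (t := 5 / 2) (by norm_num)
  obtain ⟨_, C₂, _, hC₂, h₂⟩ := exists_rpow_bounds b (s := 1 / 2) (t := 5 / 2) (by norm_num)
  set Λ := max 1 ((C₂ + 1) / (γ * c₁)) with hΛdef
  have hΛ1 : 1 ≤ Λ := le_max_left _ _
  have hΛ0 : 0 < Λ := by linarith
  have hΛ2 : C₂ + 1 ≤ Λ * (γ * c₁) := by
    rw [← div_le_iff₀ (by positivity)]; exact le_max_right _ _
  refine ⟨max Λ C, by positivity, fun u v huv x₀ hx1 hx2 => ?_⟩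
  suffices h : v x₀ - Λ * u x₀ ^ γ ≤ C by
    have h1 : Λ * u x₀ ^ γ ≤ max Λ C * u x₀ ^ γ :=
      mul_le_mul_of_nonneg_right (le_max_left _ _) (Real.rpow_nonneg (huv.left.pos x₀).le _)
    linarith [le_max_right Λ C]
  have hnorm : ∀ x ∈ closedBall x₀ (1 / 2), 1 / 2 ≤ ‖x‖ ∧ ‖x‖ ≤ 5 / 2 := fun x hx => by
    rw [mem_closedBall, dist_eq_norm] at hx
    have h1 := norm_sub_norm_le x x₀
    have h2 := norm_sub_norm_le x₀ x
    rw [norm_sub_rev x₀ x] at h2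
    constructor <;> linarith
  have hne : ∀ x ∈ closedBall x₀ (1 / 2), x ≠ 0 := fun x hx h0 => by
    have := (hnorm x hx).1
    rw [h0, norm_zero] at this
    linarith
  have hu2 : ∀ x, x ≠ 0 → ContDiffAt ℝ 2 u x := fun x hx =>
    huv.left.contDiffOn.contDiffAt (isOpen_compl_singleton.mem_nhds hx)
  have hv2 : ∀ x, x ≠ 0 → ContDiffAt ℝ 2 v x := fun x hx =>
    huv.right.contDiffOn.contDiffAt (isOpen_compl_singleton.mem_nhds hx)
  have huγ : ∀ x, x ≠ 0 → ContDiffAt ℝ 2 (fun y => u y ^ γ) x := fun x hx =>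
    (hu2 x hx).rpow_const_of_ne (huv.left.pos x).ne'
  refine hKO (fun x => v x - Λ * u x ^ γ) x₀
    (fun x hx => (hv2 x (hne x hx)).sub (contDiffAt_const.mul (huγ x (hne x hx))))
    fun x hx hwx => ?_
  have hx0 := hne x hx
  have hux := huv.left.pos x
  have hvx := huv.right.pos x
  obtain ⟨hn1, hn2⟩ := hnorm x hx
  rw [lap_sub_const_mul (hv2 x hx0) (huγ x hx0), lap_rpow (hu2 x hx0) hux]
  have hf := huv.eq_left x hx0
  have hg := huv.eq_right x hx0
  have hgrad : 0 ≤ ∑ i, pd i u x ^ 2 := Finset.sum_nonneg fun i _ => sq_nonneg _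
  have hterm : γ * (γ - 1) * u x ^ (γ - 2) * ∑ i, pd i u x ^ 2 ≤ 0 := by
    refine mul_nonpos_of_nonpos_of_nonneg (mul_nonpos_of_nonpos_of_nonneg ?_ (by positivity)) hgrad
    exact mul_nonpos_of_nonneg_of_nonpos hγ.le (by linarith)
  have hlt : u x ^ γ < v x := by
    have : u x ^ γ ≤ Λ * u x ^ γ := le_mul_of_one_le_left (by positivity) hΛ1
    linarith
  have huq : u x ^ q = u x ^ (γ - 1) * (u x ^ γ) ^ p := by
    rw [← Real.rpow_mul hux.le, ← Real.rpow_add hux]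
    congr 1; linarith
  have h1 : u x ^ q ≤ u x ^ (γ - 1) * v x ^ p := by
    rw [huq]
    exact mul_le_mul_of_nonneg_left (Real.rpow_le_rpow (by positivity) hlt.le hp.le) (by positivity)
  set T := u x ^ (γ - 1) * v x ^ p with hT
  have hTpos : 0 < T := by positivity
  have h2 : T ≤ lap v x - Λ * (γ * u x ^ (γ - 1) * lap u x +
      γ * (γ - 1) * u x ^ (γ - 2) * ∑ i, pd i u x ^ 2) := by
    have e1 : -lap v x ≤ C₂ * T := by
      rw [hg]
      exact mul_le_mul (h₂ _ hn1 hn2).2 h1 (by positivity) hC₂.le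
    have e2 : γ * c₁ * T ≤ γ * u x ^ (γ - 1) * -lap u x := by
      rw [hf, hT]
      have := mul_le_mul_of_nonneg_right (h₁ _ hn1 hn2).1
        (by positivity : 0 ≤ γ * (u x ^ (γ - 1) * v x ^ p))
      linarith
    have e3 := mul_le_mul_of_nonneg_left e2 hΛ0.le
    have e4 := mul_le_mul_of_nonneg_right hΛ2 hTpos.le
    have e5 := mul_nonpos_of_nonneg_of_nonpos hΛ0.le hterm
    linarith
  refine le_trans ?_ h2
  have h3 : v x ^ ((γ - 1) / γ) ≤ u x ^ (γ - 1) := by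
    have e : u x ^ (γ - 1) = (u x ^ γ) ^ ((γ - 1) / γ) := by
      rw [← Real.rpow_mul hux.le]; congr 1; field_simp
    rw [e]
    exact Real.rpow_le_rpow_of_nonpos (by positivity) hlt.le
      (div_nonpos_of_nonpos_of_nonneg (by linarith) hγ.le)
  calc (v x - Λ * u x ^ γ) ^ σ ≤ v x ^ σ := by
        refine Real.rpow_le_rpow hwx.le ?_ (by linarith)
        have : 0 ≤ Λ * u x ^ γ := by positivity
        linarith
    _ = v x ^ p * v x ^ ((γ - 1) / γ) := by rw [hσdef, Real.rpow_add hvx]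
    _ ≤ T := by
        rw [hT, mul_comm]
        exact mul_le_mul_of_nonneg_right h3 (by positivity)

end Comparison

section Pohozaev

variable {N : ℕ}

theorem pd_comp_smul (u : Euc N → ℝ) (c : ℝ) (x : Euc N) (i : Fin N) :
    pd i (fun y => u (c • y)) x = c * pd i u (c • x) := by
  unfold pd
  rw [fderiv_comp_smul]
  simp

theorem smul_mem_compl_zero {c : ℝ} (hc : 0 < c) {x : Euc N} (hx : x ≠ 0) : c • x ≠ 0 :=
  smul_ne_zero hc.ne' hx

theorem isOpen_compl_zero : IsOpen ({0}ᶜ : Set (Euc N)) := isOpen_compl_singleton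

theorem IsSuperharm.contDiffAt {u : Euc N → ℝ} (hu : IsSuperharm u) {x : Euc N} (hx : x ≠ 0) :
    ContDiffAt ℝ 2 u x := hu.contDiffOn.contDiffAt (isOpen_compl_zero.mem_nhds hx)

theorem lap_const_mul_comp_smul {u : Euc N → ℝ} {m c : ℝ} {x : Euc N}
    (hu : ContDiffAt ℝ 2 u (c • x)) :
    lap (fun y => m * u (c • y)) x = m * c ^ 2 * lap u (c • x) := by
  have h0 : ContDiffAt ℝ 2 (fun y : Euc N => u (c • y)) x :=
    ContDiffAt.comp x hu (contDiff_const_smul c).contDiffAt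
  rw [lap_eq_sum_pd (contDiffAt_const.mul h0), lap_eq_sum_pd hu, Finset.mul_sum]
  refine Finset.sum_congr rfl fun i _ => ?_
  have h1 : pd i (fun y => m * u (c • y)) =ᶠ[nhds x] fun y => m * c * pd i u (c • y) := by
    filter_upwards [eventually_contDiffAt (n := 2) h0] with y h1
    rw [pd_const_mul (h1.differentiableAt (by norm_num)), pd_comp_smul, mul_assoc]
  have h2 : DifferentiableAt ℝ (fun y => pd i u (c • y)) x :=
    DifferentiableAt.comp x (differentiableAt_pd hu i) (by fun_prop)
  rw [(eventuallyEq_pd h1 i).self_of_nhds, pd_const_mul h2, pd_comp_smul]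
  ring

theorem IsSuperharm.scale {u : Euc N → ℝ} (hu : IsSuperharm u) {m c : ℝ} (hm : 0 < m)
    (hc : 0 < c) : IsSuperharm fun x => m * u (c • x) where
  continuous := continuous_const.mul (hu.continuous.comp (continuous_const_smul c))
  contDiffOn := contDiffOn_const.mul
    (hu.contDiffOn.comp (contDiff_const_smul c).contDiffOn fun _ hx => smul_mem_compl_zero hc hx)
  pos x := mul_pos hm (hu.pos _)
  lap_nonpos x hx := by
    have hx' := smul_mem_compl_zero hc hx
    rw [lap_const_mul_comp_smul (hu.contDiffAt hx')]
    exact mul_nonpos_of_nonneg_of_nonpos (by positivity) (hu.lap_nonpos _ hx')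

theorem IsSol.scale {a b p q α β R : ℝ} {u v : Euc N → ℝ} (h : IsSol a b p q u v)
    (hα : α + 2 + a = p * β) (hβ : β + 2 + b = q * α) (hR : 0 < R) :
    IsSol a b p q (fun x => R ^ α * u (R • x)) (fun x => R ^ β * v (R • x)) := by
  have key : ∀ {a p α β : ℝ} {u v : Euc N → ℝ} (_ : IsSuperharm u) (_ : IsSuperharm v)
      (_ : ∀ x, x ≠ 0 → -lap u x = ‖x‖ ^ a * v x ^ p) (_ : α + 2 + a = p * β),
      ∀ x, x ≠ 0 → -lap (fun x => R ^ α * u (R • x)) x = ‖x‖ ^ a * (R ^ β * v (R • x)) ^ p := by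
    intro a p α β u v hu hv hl hα x hx
    have hx' := smul_mem_compl_zero hR hx
    have h1 := hl _ hx'
    rw [lap_const_mul_comp_smul (hu.contDiffAt hx'), ← mul_neg, h1, norm_smul, Real.norm_of_nonneg hR.le,
      Real.mul_rpow hR.le (norm_nonneg _), Real.mul_rpow (by positivity) (hv.pos _).le,
      ← Real.rpow_mul hR.le, mul_comm β p, ← hα, Real.rpow_add hR, Real.rpow_add hR, Real.rpow_two]
    ring
  exact ⟨h.left.scale (by positivity) hR, h.right.scale (by positivity) hR,
    key h.left h.right h.eq_left hα, key h.right h.left h.eq_right hβ⟩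

/-- The surface measure on the unit sphere. -/
noncomputable abbrev sph (N : ℕ) : Measure (sphere (0 : Euc N) 1) :=
  (volume : Measure (Euc N)).toSphere

theorem lintegral_polar {F : Euc N → ENNReal} (hN : 3 ≤ N) (hF : Measurable F) :
    ∫⁻ x, F x = ∫⁻ t in Ioi (0 : ℝ),
      ENNReal.ofReal (t ^ (N - 1)) * ∫⁻ ω, F (t • (ω : Euc N)) ∂(sph N) := by
  have : Nontrivial (Euc N) := by
    have : Nonempty (Fin N) := ⟨⟨0, by omega⟩⟩
    infer_instance
  have hm : Measurable fun z : sphere (0 : Euc N) 1 × Ioi (0 : ℝ) => F (z.2.1 • z.1.1) :=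
    hF.comp (by fun_prop)
  have hs : Measurable fun t : Ioi (0 : ℝ) => ENNReal.ofReal (t.1 ^ (N - 1)) := by fun_prop
  calc ∫⁻ x, F x = ∫⁻ x : ({0}ᶜ : Set (Euc N)), F x.1 ∂(volume.comap Subtype.val) := by
        rw [lintegral_subtype_comap (measurableSet_singleton _).compl, restrict_compl_singleton]
    _ = ∫⁻ z, F (z.2.1 • z.1.1) ∂((sph N).prod (.volumeIoiPow (N - 1))) := by
        have h := (volume : Measure (Euc N)).measurePreserving_homeomorphUnitSphereProd.lintegral_comp_emb
          (Homeomorph.measurableEmbedding _) (fun z => F (z.2.1 • z.1.1))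
        rw [finrank_euclideanSpace_fin] at h
        rw [← h]
        refine lintegral_congr fun x => ?_
        rw [← homeomorphUnitSphereProd_symm_apply_coe, Homeomorph.symm_apply_apply]
    _ = ∫⁻ t : Ioi (0 : ℝ), ∫⁻ ω, F (t.1 • ω.1) ∂(sph N) ∂(.volumeIoiPow (N - 1)) :=
        lintegral_prod_symm _ hm.aemeasurable
    _ = _ := by
        rw [Measure.volumeIoiPow, lintegral_withDensity_eq_lintegral_mul _ hs
          hm.lintegral_prod_left']
        exact lintegral_subtype_comap measurableSet_Ioi
          (fun t => ENNReal.ofReal (t ^ (N - 1)) * ∫⁻ ω, F (t • (ω : Euc N)) ∂(sph N))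

theorem integral_polar {F : Euc N → ℝ} (hN : 3 ≤ N) (hF : Integrable F) :
    IntegrableOn (fun t : ℝ => t ^ (N - 1) * ∫ ω, F (t • (ω : Euc N)) ∂(sph N)) (Ioi 0) ∧
    ∫ x, F x = ∫ t in Ioi (0 : ℝ), t ^ (N - 1) * ∫ ω, F (t • (ω : Euc N)) ∂(sph N) := by
  have : Nontrivial (Euc N) := by
    have : Nonempty (Fin N) := ⟨⟨0, by omega⟩⟩
    infer_instance
  have hmp := (volume : Measure (Euc N)).measurePreserving_homeomorphUnitSphereProd
  have he : (fun z : sphere (0 : Euc N) 1 × Ioi (0 : ℝ) => F (z.2.1 • z.1.1)) ∘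
      homeomorphUnitSphereProd (Euc N) = F ∘ (Subtype.val : ({0}ᶜ : Set (Euc N)) → Euc N) := by
    funext x
    simp only [Function.comp_apply]
    rw [← homeomorphUnitSphereProd_symm_apply_coe, Homeomorph.symm_apply_apply]
  have hI : Integrable (fun z : sphere (0 : Euc N) 1 × Ioi (0 : ℝ) => F (z.2.1 • z.1.1))
      ((sph N).prod (.volumeIoiPow (N - 1))) := by
    have h := hmp.integrable_comp_emb (Homeomorph.measurableEmbedding _)
      (g := fun z : sphere (0 : Euc N) 1 × Ioi (0 : ℝ) => F (z.2.1 • z.1.1))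
    rw [finrank_euclideanSpace_fin, he] at h
    rw [← h]
    exact (integrableOn_iff_comap_subtypeVal (measurableSet_singleton _).compl).1 hF.integrableOn
  have hs : Measurable fun t : Ioi (0 : ℝ) => Real.toNNReal (t.1 ^ (N - 1)) := by fun_prop
  have hcoe : ∀ t : Ioi (0 : ℝ), ∀ y : ℝ, Real.toNNReal (t.1 ^ (N - 1)) • y = t.1 ^ (N - 1) * y :=
    fun t y => by
      rw [NNReal.smul_def, Real.coe_toNNReal _ (pow_nonneg t.2.out.le _), smul_eq_mul]
  constructor
  · have h := hI.integral_prod_right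
    rw [Measure.volumeIoiPow] at h
    simp only [ENNReal.ofReal] at h
    rw [integrable_withDensity_iff_integrable_smul hs] at h
    simp only [hcoe] at h
    exact (integrableOn_iff_comap_subtypeVal (f := fun t : ℝ => t ^ (N - 1) *
      ∫ ω, F (t • (ω : Euc N)) ∂(sph N)) measurableSet_Ioi).2 h
  calc ∫ x, F x = ∫ x : ({0}ᶜ : Set (Euc N)), F x.1 ∂(volume.comap Subtype.val) := by
        rw [integral_subtype_comap (measurableSet_singleton _).compl, restrict_compl_singleton]
    _ = ∫ z, F (z.2.1 • z.1.1) ∂((sph N).prod (.volumeIoiPow (N - 1))) := by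
        have h := hmp.integral_comp
          (Homeomorph.measurableEmbedding _) (fun z => F (z.2.1 • z.1.1))
        rw [finrank_euclideanSpace_fin] at h
        rw [← h]
        refine integral_congr_ae (Eventually.of_forall fun x => ?_)
        exact (congrFun he x).symm
    _ = ∫ t : Ioi (0 : ℝ), ∫ ω, F (t.1 • ω.1) ∂(sph N) ∂(.volumeIoiPow (N - 1)) :=
        integral_prod_symm _ hI
    _ = _ := by
        rw [Measure.volumeIoiPow]
        simp only [ENNReal.ofReal]
        rw [integral_withDensity_eq_integral_smul hs]
        simp only [hcoe]
        exact integral_subtype_comap measurableSet_Ioi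
          (fun t => t ^ (N - 1) * ∫ ω, F (t • (ω : Euc N)) ∂(sph N))

theorem ofReal_rpow_neg_le_tsum {d c : ℝ} (hd : 0 ≤ d) (hc : 0 ≤ c) :
    ENNReal.ofReal d ^ (-c) ≤ 1 + ∑' j : ℕ, ENNReal.ofReal ((2 ^ c) ^ (j + 1)) *
      (Iic ((1 / 2 : ℝ) ^ j)).indicator 1 d := by
  have h2 : (1 : ℝ) ≤ 2 ^ c := Real.one_le_rpow (by norm_num) hc
  rcases hd.eq_or_lt with rfl | hd
  · have h : ∀ j : ℕ, (1 : ENNReal) ≤ ENNReal.ofReal ((2 ^ c) ^ (j + 1)) *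
        (Iic ((1 / 2 : ℝ) ^ j)).indicator 1 (0 : ℝ) := fun j => by
      rw [indicator_of_mem (by simp [mem_Iic])]
      simpa using one_le_pow₀ h2
    have h3 := ENNReal.tsum_le_tsum h
    rw [ENNReal.tsum_const_eq_top_of_ne_zero one_ne_zero, top_le_iff] at h3
    rw [h3]
    simp
  rcases le_or_gt 1 d with h1 | h1
  · refine le_add_right ?_
    rw [ENNReal.ofReal_rpow_of_pos hd, ENNReal.ofReal_le_one]
    exact Real.rpow_le_one_of_one_le_of_nonpos h1 (by linarith)
  obtain ⟨j, hj1, hj2⟩ := exists_nat_pow_near_of_lt_one hd h1.le (by norm_num : (0 : ℝ) < 1 / 2)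
    (by norm_num)
  refine le_add_left (le_trans ?_ (ENNReal.le_tsum j))
  rw [indicator_of_mem (by exact hj2), ENNReal.ofReal_rpow_of_pos hd]
  simp only [Pi.one_apply, mul_one]
  refine ENNReal.ofReal_le_ofReal ?_
  calc d ^ (-c) ≤ ((1 / 2 : ℝ) ^ (j + 1)) ^ (-c) :=
        Real.rpow_le_rpow_of_nonpos (by positivity) hj1.le (by linarith)
    _ = (2 ^ c) ^ (j + 1) := by
        rw [one_div, inv_pow, Real.rpow_neg (by positivity), Real.inv_rpow (by positivity), inv_inv,
          ← Real.rpow_natCast, ← Real.rpow_natCast, ← Real.rpow_mul (by norm_num),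
          ← Real.rpow_mul (by norm_num), mul_comm]

theorem exists_lintegral_rpow_neg_le {c s : ℝ} (hc : 0 ≤ c) (hcs : c < s) : ∃ C : ENNReal, C ≠ ⊤ ∧
    ∀ {X : Type} [MeasurableSpace X] (ν : Measure X) (d : X → ℝ) (M : ENNReal), Measurable d →
      (∀ x, 0 ≤ d x) → ν univ ≤ M → (∀ ρ : ℝ, 0 < ρ → ν {x | d x ≤ ρ} ≤ M * ENNReal.ofReal (ρ ^ s)) →
      ∫⁻ x, ENNReal.ofReal (d x) ^ (-c) ∂ν ≤ M * C := by
  have hlt : (2 : ℝ) ^ (c - s) < 1 := Real.rpow_lt_one_of_one_lt_of_neg (by norm_num) (by linarith)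
  have hsum : Summable fun j : ℕ => (2 : ℝ) ^ c * (2 ^ (c - s)) ^ j :=
    (summable_geometric_of_lt_one (by positivity) hlt).mul_left _
  refine ⟨1 + ENNReal.ofReal (∑' j : ℕ, (2 : ℝ) ^ c * (2 ^ (c - s)) ^ j),
    ENNReal.add_ne_top.2 ⟨ENNReal.one_ne_top, ENNReal.ofReal_ne_top⟩, ?_⟩
  intro X _ ν d M hd hd0 hM hρ
  have hms : ∀ j : ℕ, MeasurableSet {x | d x ≤ (1 / 2 : ℝ) ^ j} := fun j =>
    measurableSet_le hd measurable_const
  calc ∫⁻ x, ENNReal.ofReal (d x) ^ (-c) ∂ν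
      ≤ ∫⁻ x, (1 + ∑' j : ℕ, ENNReal.ofReal ((2 ^ c) ^ (j + 1)) *
        {x | d x ≤ (1 / 2 : ℝ) ^ j}.indicator 1 x) ∂ν :=
        lintegral_mono fun x => ofReal_rpow_neg_le_tsum (hd0 x) hc
    _ = ν univ + ∑' j : ℕ, ENNReal.ofReal ((2 ^ c) ^ (j + 1)) * ν {x | d x ≤ (1 / 2 : ℝ) ^ j} := by
        have hm : ∀ j : ℕ, Measurable ({x | d x ≤ (1 / 2 : ℝ) ^ j}.indicator (1 : X → ENNReal)) :=
          fun j => measurable_one.indicator (hms j)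
        rw [lintegral_add_left measurable_const, lintegral_const, one_mul,
          lintegral_tsum fun j => ((hm j).const_mul _).aemeasurable]
        congr 1
        refine tsum_congr fun j => ?_
        rw [lintegral_const_mul _ (hm j), lintegral_indicator_one (hms j)]
    _ ≤ M + ∑' j : ℕ, M * ENNReal.ofReal ((2 : ℝ) ^ c * (2 ^ (c - s)) ^ j) := by
        refine add_le_add hM (ENNReal.tsum_le_tsum fun j => ?_)
        refine (mul_le_mul_right (hρ _ (by positivity)) _).trans_eq ?_
        rw [mul_left_comm, ← ENNReal.ofReal_mul (by positivity)]
        congr 2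
        rw [Real.rpow_sub (by norm_num), div_pow (2 ^ c), one_div, inv_pow, Real.inv_rpow (by positivity),
          pow_succ, ← Real.rpow_natCast (2 ^ s), ← Real.rpow_natCast 2 j,
          ← Real.rpow_mul (by norm_num), ← Real.rpow_mul (by norm_num), mul_comm s]
        ring
    _ = M * (1 + ENNReal.ofReal (∑' j : ℕ, (2 : ℝ) ^ c * (2 ^ (c - s)) ^ j)) := by
        rw [ENNReal.tsum_mul_left, ENNReal.ofReal_tsum_of_nonneg (fun j => by positivity) hsum,
          mul_add, mul_one]

theorem exists_lintegral_closedBall_le {c : ℝ} (hN : 3 ≤ N) (hc : 0 ≤ c) (hcN : c < N) (δ : ℝ) :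
    ∃ C : ENNReal, C ≠ ⊤ ∧ ∀ x : Euc N, ∫⁻ y in closedBall x δ, ‖y - x‖ₑ ^ (-c) ≤ C := by
  obtain ⟨C, hC, h⟩ := exists_lintegral_rpow_neg_le hc hcN
  have : Nonempty (Fin N) := ⟨⟨0, by omega⟩⟩
  set V := volume (closedBall (0 : Euc N) 1)
  set V' := volume (closedBall (0 : Euc N) δ)
  have hV : V ≠ ⊤ := measure_closedBall_lt_top.ne
  have hV' : V' ≠ ⊤ := measure_closedBall_lt_top.ne
  refine ⟨(V + V') * C, ENNReal.mul_ne_top (ENNReal.add_ne_top.2 ⟨hV, hV'⟩) hC, fun x => ?_⟩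
  have h1 := h (volume.restrict (closedBall x δ)) (fun y => ‖y - x‖) (V + V') (by fun_prop)
    (fun y => norm_nonneg _) ?_ ?_
  · simpa only [ofReal_norm] using h1
  · rw [Measure.restrict_apply_univ, Measure.addHaar_closedBall_center]
    exact le_add_self
  · intro ρ hρ
    refine (Measure.restrict_apply_le _ _).trans ?_
    have : {y : Euc N | ‖y - x‖ ≤ ρ} = closedBall x ρ := by ext y; simp [dist_eq_norm]
    rw [this, Measure.addHaar_closedBall' _ _ hρ.le, finrank_euclideanSpace_fin, mul_comm,
      Real.rpow_natCast]
    gcongr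
    exact le_self_add

theorem exists_lintegral_abs_sub_le {e : ℝ} (he : 0 ≤ e) (he1 : e < 1) :
    ∃ C : ENNReal, C ≠ ⊤ ∧ ∀ r : ℝ, ∫⁻ t in Icc (1 / 2 : ℝ) (5 / 2), ‖t - r‖ₑ ^ (-e) ≤ C := by
  obtain ⟨C, hC, h⟩ := exists_lintegral_rpow_neg_le he he1
  refine ⟨2 * C, ENNReal.mul_ne_top (by norm_num) hC, fun r => ?_⟩
  have h1 := h (volume.restrict (Icc (1 / 2 : ℝ) (5 / 2))) (fun t => ‖t - r‖) 2 (by fun_prop)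
    (fun y => norm_nonneg _) ?_ ?_
  · simpa only [ofReal_norm] using h1
  · rw [Measure.restrict_apply_univ, Real.volume_Icc]
    norm_num
  · intro ρ hρ
    refine (Measure.restrict_apply_le _ _).trans ?_
    have : {y : ℝ | ‖y - r‖ ≤ ρ} = closedBall r ρ := by ext y; simp [Real.dist_eq]
    rw [this, Real.volume_closedBall, Real.rpow_one, ENNReal.ofReal_mul (by norm_num)]
    simp

open scoped Pointwise in
theorem exists_sph_cap_le (hN : 3 ≤ N) : ∃ C : ENNReal, C ≠ ⊤ ∧
    ∀ (ω₀ : sphere (0 : Euc N) 1) (ρ : ℝ), 0 < ρ →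
      (sph N) {ω | ‖(ω : Euc N) - ω₀‖ ≤ ρ} ≤ C * ENNReal.ofReal (ρ ^ (N - 1)) := by
  set V := volume (closedBall (0 : Euc N) 1)
  have hV : V ≠ ⊤ := measure_closedBall_lt_top.ne
  have : Nonempty (Fin N) := ⟨⟨0, by omega⟩⟩
  refine ⟨N * (ENNReal.ofReal (2 ^ (N + 1)) * V) + sph N univ, ENNReal.add_ne_top.2
    ⟨ENNReal.mul_ne_top (by simp) (ENNReal.mul_ne_top (by simp) hV), measure_ne_top _ _⟩, ?_⟩
  intro ω₀ ρ hρ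
  rw [add_mul]
  rcases le_or_gt 1 ρ with h1 | h1
  · refine le_add_left ((measure_mono (subset_univ _)).trans ?_)
    exact le_mul_of_one_le_right' (by simpa using one_le_pow₀ h1)
  refine le_add_right ?_
  have hms : MeasurableSet {ω : sphere (0 : Euc N) 1 | ‖(ω : Euc N) - ω₀‖ ≤ ρ} :=
    measurableSet_le (by fun_prop) measurable_const
  rw [Measure.toSphere_apply' _ hms, finrank_euclideanSpace_fin, mul_assoc]
  gcongr
  have hsub : Ioo (0 : ℝ) 1 • (Subtype.val '' {ω : sphere (0 : Euc N) 1 | ‖(ω : Euc N) - ω₀‖ ≤ ρ}) ⊆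
      ⋃ j ∈ Finset.range (⌊1 / ρ⌋₊ + 1), closedBall ((j * ρ) • (ω₀ : Euc N)) (2 * ρ) := by
    rintro _ ⟨t, ⟨ht0, ht1⟩, _, ⟨ω, hω, rfl⟩, rfl⟩
    simp only [mem_iUnion, Finset.mem_range]
    refine ⟨⌊t / ρ⌋₊, Nat.lt_succ_of_le (Nat.floor_mono (by gcongr)), ?_⟩
    rw [mem_closedBall, dist_eq_norm]
    have e1 := Nat.floor_le (div_pos ht0 hρ).le
    have e2 := Nat.lt_floor_add_one (t / ρ)
    rw [le_div_iff₀ hρ] at e1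
    rw [div_lt_iff₀ hρ] at e2
    have e3 : t • (ω : Euc N) - ((⌊t / ρ⌋₊ : ℝ) * ρ) • (ω₀ : Euc N) =
        t • ((ω : Euc N) - ω₀) + (t - ⌊t / ρ⌋₊ * ρ) • (ω₀ : Euc N) := by module
    have hω0 : ‖(ω₀ : Euc N)‖ = 1 := by simp
    calc _ ≤ ‖t • ((ω : Euc N) - ω₀)‖ + ‖(t - ⌊t / ρ⌋₊ * ρ) • (ω₀ : Euc N)‖ := by
          simp only [e3]; exact norm_add_le _ _
      _ = t * ‖(ω : Euc N) - ω₀‖ + (t - ⌊t / ρ⌋₊ * ρ) := by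
          rw [norm_smul, norm_smul, hω0, mul_one, Real.norm_of_nonneg ht0.le,
            Real.norm_of_nonneg (by linarith)]
      _ ≤ 1 * ρ + ρ := add_le_add (mul_le_mul ht1.le hω (norm_nonneg _) zero_le_one) (by linarith)
      _ = 2 * ρ := by ring
  calc _ ≤ _ := measure_mono hsub
    _ ≤ ∑ j ∈ Finset.range (⌊1 / ρ⌋₊ + 1), volume (closedBall ((j * ρ) • (ω₀ : Euc N)) (2 * ρ)) :=
        measure_biUnion_finset_le _ _
    _ = ENNReal.ofReal ((⌊1 / ρ⌋₊ + 1) * (2 * ρ) ^ N) * V := by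
        simp only [Measure.addHaar_closedBall' _ _ (by positivity : 0 ≤ 2 * ρ),
          finrank_euclideanSpace_fin, Finset.sum_const, Finset.card_range, nsmul_eq_mul]
        rw [ENNReal.ofReal_mul (by positivity), mul_assoc]
        congr 1
        rw [← Nat.cast_one, ← Nat.cast_add, ENNReal.ofReal_natCast, Nat.cast_add]
    _ ≤ ENNReal.ofReal (2 ^ (N + 1) * ρ ^ (N - 1)) * V := by
        refine mul_le_mul_left (ENNReal.ofReal_le_ofReal ?_) _
        have h2 : (⌊1 / ρ⌋₊ : ℝ) ≤ 1 / ρ := Nat.floor_le (by positivity)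
        have h3 : 1 ≤ 1 / ρ := by rw [le_div_iff₀ hρ]; linarith
        have h4 : ρ ^ N = ρ ^ (N - 1) * ρ := by rw [← pow_succ]; congr 1; omega
        calc _ ≤ (1 / ρ + 1 / ρ) * (2 * ρ) ^ N := by gcongr
          _ = _ := by rw [mul_pow, h4]; field_simp; ring
    _ = _ := by rw [ENNReal.ofReal_mul (by positivity)]; ring

theorem exists_lintegral_sph_le {c : ℝ} (hN : 3 ≤ N) (hc : 0 ≤ c) (hcN : c < N - 1) :
    ∃ C : ENNReal, C ≠ ⊤ ∧ ∀ (r : ℝ) (z : Euc N), 1 / 2 ≤ r →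
      ∫⁻ ω, ‖r • (ω : Euc N) - z‖ₑ ^ (-c) ∂(sph N) ≤ C := by
  obtain ⟨C₁, hC₁, h₁⟩ := exists_sph_cap_le hN
  obtain ⟨C, hC, h⟩ := exists_lintegral_rpow_neg_le hc hcN
  set M := sph N univ + C₁ * ENNReal.ofReal (4 ^ (N - 1))
  have hM : M ≠ ⊤ := ENNReal.add_ne_top.2 ⟨measure_ne_top _ _, ENNReal.mul_ne_top hC₁ (by simp)⟩
  refine ⟨M * C, ENNReal.mul_ne_top hM hC, fun r z hr => ?_⟩
  have h1 := h (sph N) (fun ω => ‖r • (ω : Euc N) - z‖) M (by fun_prop) (fun y => norm_nonneg _)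
    le_self_add ?_
  · simpa only [ofReal_norm] using h1
  intro ρ hρ
  rcases eq_empty_or_nonempty {ω : sphere (0 : Euc N) 1 | ‖r • (ω : Euc N) - z‖ ≤ ρ} with he | ⟨ω₀, h0⟩
  · rw [he, measure_empty]; exact zero_le
  have hsub : {ω : sphere (0 : Euc N) 1 | ‖r • (ω : Euc N) - z‖ ≤ ρ} ⊆
      {ω | ‖(ω : Euc N) - ω₀‖ ≤ 4 * ρ} := by
    intro ω hω
    have e : r • ((ω : Euc N) - ω₀) = (r • (ω : Euc N) - z) - (r • (ω₀ : Euc N) - z) := by module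
    have e2 : r * ‖(ω : Euc N) - ω₀‖ ≤ ρ + ρ := by
      rw [← Real.norm_of_nonneg (by linarith : 0 ≤ r), ← norm_smul, e]
      exact (norm_sub_le _ _).trans (add_le_add hω h0)
    show ‖(ω : Euc N) - ω₀‖ ≤ 4 * ρ
    nlinarith [norm_nonneg ((ω : Euc N) - ω₀)]
  refine ((measure_mono hsub).trans (h₁ ω₀ _ (by positivity))).trans ?_
  have e : ρ ^ ((N : ℝ) - 1) = ρ ^ (N - 1) := by
    rw [← Real.rpow_natCast, Nat.cast_sub (by omega), Nat.cast_one]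
  rw [mul_pow, ENNReal.ofReal_mul (by positivity), ← mul_assoc, e]
  gcongr
  exact le_add_self

theorem exists_lintegral_weight_le {c e : ℝ} (hN : 3 ≤ N) (hc : 0 ≤ c) (hcN : c < N - 1)
    (he : 0 ≤ e) (he1 : e < 1) :
    ∃ C : ENNReal, C ≠ ⊤ ∧ ∀ (r : ℝ) (z : Euc N),
      ∫⁻ y in shell N, ‖‖y‖ - r‖ₑ ^ (-e) * ‖z - y‖ₑ ^ (-c) ≤ C := by
  obtain ⟨C₁, hC₁, h₁⟩ := exists_lintegral_sph_le hN hc hcN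
  obtain ⟨C₂, hC₂, h₂⟩ := exists_lintegral_abs_sub_le he he1
  refine ⟨ENNReal.ofReal ((5 / 2) ^ (N - 1)) * C₁ * C₂,
    ENNReal.mul_ne_top (ENNReal.mul_ne_top (by simp) hC₁) hC₂, fun r z => ?_⟩
  have hmsh : MeasurableSet (shell N) := isCompact_shell.measurableSet
  rw [← lintegral_indicator hmsh, lintegral_polar hN (Measurable.indicator (by fun_prop) hmsh)]
  calc _ ≤ ∫⁻ t in Ioi (0 : ℝ), (Icc (1 / 2 : ℝ) (5 / 2)).indicator (fun t =>
        ENNReal.ofReal ((5 / 2) ^ (N - 1)) * C₁ * ‖t - r‖ₑ ^ (-e)) t := by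
        refine setLIntegral_mono' measurableSet_Ioi fun t ht => ?_
        have hnorm : ∀ ω : sphere (0 : Euc N) 1, ‖t • (ω : Euc N)‖ = t := fun ω => by
          have : ‖(ω : Euc N)‖ = 1 := by simp
          rw [norm_smul, this, mul_one, Real.norm_of_nonneg (le_of_lt ht)]
        by_cases htI : t ∈ Icc (1 / 2 : ℝ) (5 / 2)
        · have hmem : ∀ ω : sphere (0 : Euc N) 1, t • (ω : Euc N) ∈ shell N := fun ω => by
            simpa [shell, hnorm ω] using htI
          rw [indicator_of_mem htI]
          simp only [indicator_of_mem (hmem _), hnorm]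
          rw [lintegral_const_mul _ (by fun_prop)]
          have h3 := h₁ t z htI.1
          simp only [← enorm_neg (z - _), neg_sub]
          calc _ ≤ ENNReal.ofReal ((5 / 2) ^ (N - 1)) * (‖t - r‖ₑ ^ (-e) * C₁) := by
                gcongr
                exacts [by linarith [htI.1], htI.2]
            _ = _ := by ring
        · have hmem : ∀ ω : sphere (0 : Euc N) 1, t • (ω : Euc N) ∉ shell N := fun ω => by
            simpa [shell, hnorm ω] using htI
          simp only [indicator_of_notMem (hmem _)]
          simp
    _ ≤ ∫⁻ t, (Icc (1 / 2 : ℝ) (5 / 2)).indicator (fun t =>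
        ENNReal.ofReal ((5 / 2) ^ (N - 1)) * C₁ * ‖t - r‖ₑ ^ (-e)) t := setLIntegral_le_lintegral _ _
    _ = ENNReal.ofReal ((5 / 2) ^ (N - 1)) * C₁ * ∫⁻ t in Icc (1 / 2 : ℝ) (5 / 2), ‖t - r‖ₑ ^ (-e) := by
        rw [lintegral_indicator measurableSet_Icc, lintegral_const_mul _ (by fun_prop)]
    _ ≤ _ := by gcongr; exact h₂ r

theorem lintegral_rpow_kernel_le {X Y : Type*} [MeasurableSpace X] [MeasurableSpace Y]
    {ν : Measure X} {μ : Measure Y} [SFinite ν] [SFinite μ] {K : X → Y → ENNReal}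
    (hK : Measurable (Function.uncurry K)) {f : Y → ENNReal} (hf : Measurable f) {s m : ℝ}
    (hs : 0 < s) (hm : 0 < m) (hsm : s + 1 / m ≤ 1) {A B : ENNReal}
    (hA : ∀ x, ∫⁻ y, K x y ^ (1 / (s + 1 / m)) ∂μ ≤ A)
    (hB : ∀ y, ∫⁻ x, K x y ^ (1 / (s + 1 / m)) ∂ν ≤ B) :
    ∫⁻ x, (∫⁻ y, K x y * f y ∂μ) ^ m ∂ν ≤
      A ^ (s * m) * B * (∫⁻ y, f y ^ (1 / (1 - s)) ∂μ) ^ ((1 - s) * m) := by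
  have hm1 : 0 < 1 / m := by positivity
  have hs1 : 0 < 1 - s := by linarith
  set κ := 1 / (s + 1 / m) with hκ
  set k := 1 / (1 - s) with hk
  have hκ0 : 0 < κ := by positivity
  have hk0 : 0 < k := by positivity
  have hKx : ∀ x, Measurable (K x) := fun x => hK.comp measurable_prodMk_left
  have hKf : Measurable fun z : X × Y => K z.1 z.2 ^ κ * f z.2 ^ k := by
    have : Measurable fun z : X × Y => K z.1 z.2 := hK
    fun_prop
  set I := ∫⁻ y, f y ^ k ∂μ with hI
  have hpt : ∀ x y, K x y * f y =
      (K x y ^ κ * f y ^ k) ^ (1 / m) * ((K x y ^ κ) ^ s * (f y ^ k) ^ (1 - s - 1 / m)) := by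
    intro x y
    rw [ENNReal.mul_rpow_of_nonneg _ _ hm1.le]
    have e1 : (K x y ^ κ) ^ (1 / m) * (K x y ^ κ) ^ s = K x y := by
      rw [← ENNReal.rpow_add_of_nonneg _ _ hm1.le hs.le, ← ENNReal.rpow_mul, hκ, add_comm (1 / m),
        one_div_mul_cancel (by positivity), ENNReal.rpow_one]
    have e2 : (f y ^ k) ^ (1 / m) * (f y ^ k) ^ (1 - s - 1 / m) = f y := by
      rw [← ENNReal.rpow_add_of_nonneg _ _ hm1.le (by linarith), ← ENNReal.rpow_mul, hk,
        add_sub_cancel, one_div_mul_cancel hs1.ne', ENNReal.rpow_one]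
    calc _ = ((K x y ^ κ) ^ (1 / m) * (K x y ^ κ) ^ s) *
          ((f y ^ k) ^ (1 / m) * (f y ^ k) ^ (1 - s - 1 / m)) := by rw [e1, e2]
      _ = _ := by ring
  have hH : ∀ x, (∫⁻ y, K x y * f y ∂μ) ^ m ≤
      (∫⁻ y, K x y ^ κ * f y ^ k ∂μ) * (A ^ (s * m) * I ^ ((1 - s) * m - 1)) := by
    intro x
    have h := ENNReal.lintegral_prod_norm_pow_le (μ := μ) (Finset.univ : Finset (Fin 3))
      (f := ![fun y => K x y ^ κ * f y ^ k, fun y => K x y ^ κ, fun y => f y ^ k])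
      (p := ![1 / m, s, 1 - s - 1 / m]) ?_ ?_ ?_
    · simp only [Fin.prod_univ_three, Matrix.cons_val_zero, Matrix.cons_val_one,
        Matrix.cons_val, mul_assoc, ← hpt] at h
      calc _ ≤ ((∫⁻ y, K x y ^ κ * f y ^ k ∂μ) ^ (1 / m) *
            (A ^ s * I ^ (1 - s - 1 / m))) ^ m := by
            gcongr
            refine h.trans ?_
            gcongr
            exact hA x
        _ = _ := by
            rw [ENNReal.mul_rpow_of_nonneg _ _ hm.le, ENNReal.mul_rpow_of_nonneg _ _ hm.le,
              ← ENNReal.rpow_mul, ← ENNReal.rpow_mul, ← ENNReal.rpow_mul,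
              one_div_mul_cancel hm.ne', ENNReal.rpow_one, sub_mul _ (1 / m),
              one_div_mul_cancel hm.ne']
    · have := hKx x
      intro i _
      fin_cases i <;> simp <;> fun_prop
    · simp [Fin.sum_univ_three]; ring
    · intro i _
      fin_cases i
      · exact hm1.le
      · exact hs.le
      · show 0 ≤ 1 - s - 1 / m; linarith
  calc _ ≤ ∫⁻ x, (∫⁻ y, K x y ^ κ * f y ^ k ∂μ) * (A ^ (s * m) * I ^ ((1 - s) * m - 1)) ∂ν :=
        lintegral_mono hH
    _ = (∫⁻ y, ∫⁻ x, K x y ^ κ * f y ^ k ∂ν ∂μ) * (A ^ (s * m) * I ^ ((1 - s) * m - 1)) := by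
        rw [lintegral_mul_const _ hKf.lintegral_prod_right', lintegral_lintegral_swap hKf.aemeasurable]
    _ ≤ (∫⁻ y, B * f y ^ k ∂μ) * (A ^ (s * m) * I ^ ((1 - s) * m - 1)) := by
        gcongr with y
        have : Measurable fun x => K x y := hK.comp measurable_prodMk_right
        rw [lintegral_mul_const _ (by fun_prop)]
        gcongr
        exact hB y
    _ = A ^ (s * m) * B * (I * I ^ ((1 - s) * m - 1)) := by
        rw [lintegral_const_mul _ (by fun_prop), ← hI]
        ring
    _ = _ := by
        have : 0 ≤ (1 - s) * m - 1 := by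
          have : (1 / m) * m ≤ (1 - s) * m := by gcongr; linarith
          rw [one_div_mul_cancel hm.ne'] at this
          linarith
        conv_lhs => rw [← ENNReal.rpow_one I, ← ENNReal.rpow_mul, one_mul]
        rw [← ENNReal.rpow_add_of_nonneg _ _ zero_le_one this, add_sub_cancel]

/-- The potential on the sphere of radius `r` generated by `f` with kernel `|x - y|^{-c}`
and density `||y| - r|^{-e}` on the shell. -/
noncomputable def shellPot (c e r : ℝ) (f : Euc N → ENNReal) (ω : sphere (0 : Euc N) 1) : ENNReal :=
  ∫⁻ y in shell N, ‖‖y‖ - r‖ₑ ^ (-e) * (‖r • (ω : Euc N) - y‖ₑ ^ (-c) * f y)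

theorem exists_lintegral_shellPot_le {c e s m : ℝ} (hN : 3 ≤ N) (hs : 0 < s) (hm : 0 < m)
    (hsm : s + 1 / m ≤ 1) (hc : 0 ≤ c) (hcN : c < (N - 1) * (s + 1 / m)) (he : 0 ≤ e)
    (he1 : e < 1) :
    ∃ C : ENNReal, C ≠ ⊤ ∧ ∀ (r : ℝ) (f : Euc N → ENNReal), 1 ≤ r → Measurable f →
      ∫⁻ ω, shellPot c e r f ω ^ m ∂(sph N) ≤
        C * (∫⁻ y in shell N, ‖‖y‖ - r‖ₑ ^ (-e) * f y ^ (1 / (1 - s))) ^ ((1 - s) * m) := by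
  have hκ : 0 < s + 1 / m := by positivity
  have hc' : 0 ≤ c * (1 / (s + 1 / m)) := by positivity
  have hcN' : c * (1 / (s + 1 / m)) < N - 1 := by
    rw [mul_one_div, div_lt_iff₀ hκ]; exact hcN
  obtain ⟨A, hA, h1⟩ := exists_lintegral_weight_le hN hc' hcN' he he1
  obtain ⟨B, hB, h2⟩ := exists_lintegral_sph_le hN hc' hcN'
  refine ⟨A ^ (s * m) * B, ENNReal.mul_ne_top (ENNReal.rpow_ne_top_of_nonneg (by positivity) hA) hB,
    fun r f hr hf => ?_⟩
  set W : Euc N → ENNReal := fun y => ‖‖y‖ - r‖ₑ ^ (-e) with hW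
  have hWm : Measurable W := by fun_prop
  have hd : ∀ {g : Euc N → ENNReal}, Measurable g →
      ∫⁻ y, g y ∂((volume.restrict (shell N)).withDensity W) = ∫⁻ y in shell N, W y * g y :=
    fun hg => lintegral_withDensity_eq_lintegral_mul _ hWm hg
  have h := lintegral_rpow_kernel_le (ν := sph N) (μ := (volume.restrict (shell N)).withDensity W)
    (K := fun ω y => ‖r • (ω : Euc N) - y‖ₑ ^ (-c)) (by unfold Function.uncurry; fun_prop) hf
    hs hm hsm (A := A) (B := B) ?_ ?_
  · rw [hd (by fun_prop)] at h
    refine le_trans (le_of_eq ?_) h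
    refine lintegral_congr fun ω => ?_
    rw [hd (by fun_prop)]
    rfl
  · intro ω
    rw [hd (by fun_prop)]
    simp only [← ENNReal.rpow_mul, neg_mul]
    exact h1 r _
  · intro y
    simp only [← ENNReal.rpow_mul, neg_mul]
    exact h2 r y (by linarith)

theorem exists_bound_closedBall {u : Euc N → ℝ} (hu : Continuous u) (r : ℝ) :
    ∃ M, 0 < M ∧ ∀ x, ‖x‖ ≤ r → u x ≤ M := by
  obtain ⟨M, hM⟩ := (isCompact_closedBall (0 : Euc N) r).exists_bound_of_continuousOn hu.continuousOn
  refine ⟨max M 1, by positivity, fun x hx => ?_⟩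
  exact ((le_abs_self _).trans (hM x (by simpa using hx))).trans (le_max_left _ _)

theorem norm_bounds_of_mem_closedBall {x y : Euc N} (hx : ‖x‖ = 1) (hy : y ∈ closedBall x (1 / 2)) :
    1 / 2 ≤ ‖y‖ ∧ ‖y‖ ≤ 3 / 2 := by
  rw [mem_closedBall, dist_eq_norm] at hy
  constructor
  · have := norm_sub_norm_le x y
    rw [norm_sub_rev] at this
    linarith
  · have := norm_sub_norm_le y x
    linarith

theorem IsSol.exists_grad_bound (hN : 3 ≤ N) {a b p q : ℝ} {u v : Euc N → ℝ} (ha : -2 < a)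
    (hp : 0 < p) (h : IsSol a b p q u v) :
    ∃ C, 0 < C ∧ ∀ x, x ≠ 0 → ‖x‖ ≤ 2 → ∀ i, |pd i u x| ≤ C * ‖x‖⁻¹ := by
  obtain ⟨C₀, hC₀, h0⟩ := exists_grad_upper hN
  obtain ⟨M, hM, hMu⟩ := exists_bound_closedBall h.left.continuous 3
  obtain ⟨M', hM', hMv⟩ := exists_bound_closedBall h.right.continuous 3
  obtain ⟨c, A, _, hA, hb⟩ := exists_rpow_bounds (t := 3 / 2) a (by norm_num : (0 : ℝ) < 1 / 2)
  obtain ⟨J, hJ, hJ'⟩ := exists_lintegral_closedBall_le (N := N) (c := (N : ℝ) - 1) hN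
    (by have : (3 : ℝ) ≤ N := by exact_mod_cast hN
        linarith) (by linarith) (1 / 2)
  set V := volume (closedBall (0 : Euc N) (1 / 2))
  have hV : V ≠ ⊤ := measure_closedBall_lt_top.ne
  set L := (2 : ℝ) ^ (2 + a) * (A * M' ^ p)
  have hL : 0 < L := by positivity
  set T : ENNReal := ENNReal.ofReal C₀ *
    (ENNReal.ofReal ((1 / 2 : ℝ)⁻¹ ^ (N + 1) * (M * V.toReal)) + ENNReal.ofReal L * J)
  have hT : T ≠ ⊤ := ENNReal.mul_ne_top (by simp)
    (ENNReal.add_ne_top.2 ⟨ENNReal.ofReal_ne_top, ENNReal.mul_ne_top (by simp) hJ⟩)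
  refine ⟨T.toReal + 1, by positivity, fun x hx hx2 i => ?_⟩
  set l := ‖x‖
  have hl : 0 < l := norm_pos_iff.2 hx
  have hw := h.left.scale one_pos hl
  set x' := l⁻¹ • x
  have hx' : ‖x'‖ = 1 := by
    simp only [x', norm_smul, norm_inv, l, norm_norm]
    exact inv_mul_cancel₀ hl.ne'
  have hlx : l • x' = x := smul_inv_smul₀ hl.ne' x
  have h1 := h0 _ hw x' (1 / 2) i (by norm_num) (by rw [hx']; norm_num)
  have hle : ∀ y ∈ closedBall x' (1 / 2), ‖l • y‖ ≤ 3 := fun y hy => by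
    rw [norm_smul, Real.norm_of_nonneg hl.le]
    nlinarith [(norm_bounds_of_mem_closedBall hx' hy).2, norm_nonneg y]
  have h2 : ∫ y in closedBall x' (1 / 2), 1 * u (l • y) ≤ M * V.toReal := by
    have h3 := setIntegral_mono_on (μ := volume) (s := closedBall x' (1 / 2))
      (hw.continuous.continuousOn.integrableOn_compact (isCompact_closedBall _ _))
      (integrableOn_const (C := M) measure_closedBall_lt_top.ne) measurableSet_closedBall
      (fun y hy => by rw [one_mul]; exact hMu _ (hle y hy))
    refine h3.trans_eq ?_
    rw [setIntegral_const, smul_eq_mul, mul_comm, measureReal_def, Measure.addHaar_closedBall_center]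
  have h3 : ∫⁻ y in closedBall x' (1 / 2),
      ‖lap (fun x => 1 * u (l • x)) y‖ₑ * ‖y - x'‖ₑ ^ (-((N : ℝ) - 1)) ≤ ENNReal.ofReal L * J := by
    calc _ ≤ ∫⁻ y in closedBall x' (1 / 2), ENNReal.ofReal L * ‖y - x'‖ₑ ^ (-((N : ℝ) - 1)) := by
          refine setLIntegral_mono' measurableSet_closedBall fun y hy => ?_
          have hy1 := norm_bounds_of_mem_closedBall hx' hy
          have hy0 : y ≠ 0 := norm_pos_iff.1 (by linarith)
          have hly := smul_mem_compl_zero hl hy0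
          gcongr
          rw [← ofReal_norm]
          refine ENNReal.ofReal_le_ofReal ?_
          rw [lap_const_mul_comp_smul (h.left.contDiffAt hly), norm_mul, one_mul,
            Real.norm_of_nonneg (by positivity), ← norm_neg, h.eq_left _ hly, norm_smul,
            Real.norm_of_nonneg hl.le, Real.norm_of_nonneg (mul_nonneg (by positivity)
              (Real.rpow_nonneg (h.right.pos _).le _)), Real.mul_rpow hl.le (norm_nonneg _)]
          calc _ = l ^ (2 + a) * (‖y‖ ^ a * v (l • y) ^ p) := by
                rw [Real.rpow_add hl, Real.rpow_two]; ring
            _ ≤ _ := by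
                have := h.right.pos (l • y)
                refine mul_le_mul (Real.rpow_le_rpow hl.le hx2 (by linarith))
                  (mul_le_mul (hb _ hy1.1 hy1.2).2 (Real.rpow_le_rpow this.le (hMv _ (hle y hy))
                  hp.le) (by positivity) hA.le) (by positivity) (by positivity)
      _ = ENNReal.ofReal L * ∫⁻ y in closedBall x' (1 / 2), ‖y - x'‖ₑ ^ (-((N : ℝ) - 1)) :=
          lintegral_const_mul _ (by fun_prop)
      _ ≤ _ := by gcongr; exact hJ' x'
  have h4 : ENNReal.ofReal |pd i (fun x => 1 * u (l • x)) x'| ≤ T := by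
    refine h1.trans (mul_le_mul_right (add_le_add (ENNReal.ofReal_le_ofReal ?_) h3) _)
    exact mul_le_mul_of_nonneg_left h2 (by positivity)
  have h5 : pd i (fun x => 1 * u (l • x)) x' = l * pd i u x := by
    have : (fun x : Euc N => 1 * u (l • x)) = fun x => u (l • x) := by simp
    rw [this, pd_comp_smul, hlx]
  rw [h5, abs_mul, abs_of_pos hl, ENNReal.ofReal_le_iff_le_toReal hT] at h4
  rw [← div_eq_mul_inv, le_div_iff₀ hl]
  linarith

/-- The Euler derivative `x · ∇u`. -/
noncomputable def euler (u : Euc N → ℝ) (x : Euc N) : ℝ := ∑ j, x j * pd j u x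

/-- The product `∇u · ∇v`. -/
noncomputable def gradDot (u v : Euc N → ℝ) (x : Euc N) : ℝ := ∑ j, pd j u x * pd j v x

theorem euler_eq_fderiv (u : Euc N → ℝ) (x : Euc N) : euler u x = fderiv ℝ u x x :=
  (fderiv_apply_eq_sum u x x).symm

theorem gradDot_comm (u v : Euc N → ℝ) (x : Euc N) : gradDot u v x = gradDot v u x :=
  Finset.sum_congr rfl fun _ _ => mul_comm _ _

theorem differentiableAt_euler {u : Euc N → ℝ} {x : Euc N} (hu : ContDiffAt ℝ 2 u x) :
    DifferentiableAt ℝ (euler u) x := by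
  unfold euler
  exact DifferentiableAt.fun_sum fun i _ => (differentiableAt_coord i x).mul (differentiableAt_pd hu i)

theorem differentiableAt_gradDot {u v : Euc N → ℝ} {x : Euc N} (hu : ContDiffAt ℝ 2 u x)
    (hv : ContDiffAt ℝ 2 v x) : DifferentiableAt ℝ (gradDot u v) x := by
  unfold gradDot
  exact DifferentiableAt.fun_sum fun i _ => (differentiableAt_pd hu i).mul (differentiableAt_pd hv i)

theorem pd_euler {u : Euc N → ℝ} {x : Euc N} (hu : ContDiffAt ℝ 2 u x) (i : Fin N) :
    pd i (euler u) x = pd i u x + ∑ j, x j * pd i (pd j u) x := by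
  unfold euler
  have hd : ∀ j ∈ Finset.univ, DifferentiableAt ℝ (fun y : Euc N => y j * pd j u y) x :=
    fun j _ => (differentiableAt_coord j x).mul (differentiableAt_pd hu j)
  rw [pd_sum _ hd]
  have : ∀ j, pd i (fun y : Euc N => y j * pd j u y) x =
      (if i = j then pd j u x else 0) + x j * pd i (pd j u) x := fun j => by
    rw [pd_mul (differentiableAt_coord j x) (differentiableAt_pd hu j), pd_coord]
    split_ifs <;> simp
  simp only [this, Finset.sum_add_distrib]
  simp

theorem euler_gradDot {u v : Euc N → ℝ} {x : Euc N} (hu : ContDiffAt ℝ 2 u x)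
    (hv : ContDiffAt ℝ 2 v x) : euler (gradDot u v) x =
      (∑ i, (∑ j, x j * pd i (pd j u) x) * pd i v x) +
      ∑ i, (∑ j, x j * pd i (pd j v) x) * pd i u x := by
  have h : ∀ j, pd j (gradDot u v) x =
      ∑ i, (pd i (pd j u) x * pd i v x + pd i (pd j v) x * pd i u x) := fun j => by
    unfold gradDot
    have hd : ∀ i ∈ Finset.univ, DifferentiableAt ℝ (fun y => pd i u y * pd i v y) x :=
      fun i _ => (differentiableAt_pd hu i).mul (differentiableAt_pd hv i)
    rw [pd_sum _ hd]
    refine Finset.sum_congr rfl fun i _ => ?_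
    rw [pd_mul (differentiableAt_pd hu i) (differentiableAt_pd hv i), pd_comm hu j i, pd_comm hv j i]
    ring
  unfold euler
  simp only [h, Finset.mul_sum, Finset.sum_mul]
  rw [Finset.sum_comm, ← Finset.sum_add_distrib]
  refine Finset.sum_congr rfl fun i _ => ?_
  rw [← Finset.sum_add_distrib]
  exact Finset.sum_congr rfl fun j _ => by ring

theorem sum_pd_euler_mul {u v : Euc N → ℝ} {x : Euc N} (hu : ContDiffAt ℝ 2 u x)
    (hv : ContDiffAt ℝ 2 v x) : ∑ i, pd i (fun y => euler u y * pd i v y) x =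
      gradDot u v x + (∑ i, (∑ j, x j * pd i (pd j u) x) * pd i v x) + euler u x * lap v x := by
  simp only [pd_mul (differentiableAt_euler hu) (differentiableAt_pd hv _), pd_euler hu, add_mul,
    Finset.sum_add_distrib, ← Finset.mul_sum, lap_eq_sum_pd hv, gradDot]

theorem sum_pd_coord_mul {f : Euc N → ℝ} {x : Euc N} (hf : DifferentiableAt ℝ f x) :
    ∑ i, pd i (fun y => y i * f y) x = N * f x + euler f x := by
  simp only [pd_mul (differentiableAt_coord _ x) hf, pd_coord, Finset.sum_add_distrib, euler]
  simp

theorem sum_pd_mul_pd {u v : Euc N → ℝ} {x : Euc N} (hu : ContDiffAt ℝ 2 u x)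
    (hv : DifferentiableAt ℝ v x) :
    ∑ i, pd i (fun y => v y * pd i u y) x = gradDot v u x + v x * lap u x := by
  simp only [pd_mul hv (differentiableAt_pd hu _), Finset.sum_add_distrib, ← Finset.mul_sum,
    lap_eq_sum_pd hu, gradDot]

/-- The potential energy density. -/
noncomputable def energy (a b p q : ℝ) (u v : Euc N → ℝ) (x : Euc N) : ℝ :=
  ‖x‖ ^ a * v x ^ (p + 1) / (p + 1) + ‖x‖ ^ b * u x ^ (q + 1) / (q + 1)

theorem exists_hasFDerivAt_norm_rpow {x : Euc N} (hx : x ≠ 0) (a : ℝ) :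
    ∃ L : Euc N →L[ℝ] ℝ, HasFDerivAt (fun y : Euc N => ‖y‖ ^ a) L x ∧ L x = a * ‖x‖ ^ a := by
  have hx0 : 0 < ‖x‖ := norm_pos_iff.2 hx
  have h := (hasStrictFDerivAt_norm_sq x).hasFDerivAt.rpow_const (p := a / 2)
    (Or.inl (by positivity))
  have e : ∀ y : Euc N, (‖y‖ ^ 2) ^ (a / 2) = ‖y‖ ^ a := fun y => by
    rw [← Real.rpow_natCast, ← Real.rpow_mul (norm_nonneg _)]
    congr 1; push_cast; ring
  simp only [e] at h
  refine ⟨_, h, ?_⟩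
  simp only [smul_apply, innerSL_apply_apply, real_inner_self_eq_norm_sq,
    smul_eq_mul, nsmul_eq_mul]
  rw [Real.rpow_sub (by positivity), e, Real.rpow_one]
  field_simp
  simp

theorem hasFDerivAt_energy {a b p q : ℝ} (hp : 0 < p) (hq : 0 < q) {u v : Euc N → ℝ} {x : Euc N}
    (hx : x ≠ 0) (hu : DifferentiableAt ℝ u x) (hv : DifferentiableAt ℝ v x) (hu0 : 0 < u x)
    (hv0 : 0 < v x) : DifferentiableAt ℝ (energy a b p q u v) x ∧
    euler (energy a b p q u v) x = a * (‖x‖ ^ a * v x ^ (p + 1) / (p + 1)) +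
      b * (‖x‖ ^ b * u x ^ (q + 1) / (q + 1)) + ‖x‖ ^ a * v x ^ p * euler v x +
      ‖x‖ ^ b * u x ^ q * euler u x := by
  obtain ⟨L, hL, hLx⟩ := exists_hasFDerivAt_norm_rpow hx a
  obtain ⟨L', hL', hLx'⟩ := exists_hasFDerivAt_norm_rpow hx b
  have h : HasFDerivAt (energy a b p q u v) _ x :=
    ((hL.mul (hv.hasFDerivAt.rpow_const (p := p + 1) (Or.inl hv0.ne'))).mul_const (p + 1)⁻¹).add
    ((hL'.mul (hu.hasFDerivAt.rpow_const (p := q + 1) (Or.inl hu0.ne'))).mul_const (q + 1)⁻¹)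
  refine ⟨h.differentiableAt, ?_⟩
  rw [euler_eq_fderiv, h.fderiv, euler_eq_fderiv, euler_eq_fderiv]
  simp [hLx, hLx']
  field_simp
  ring

/-- The vector field in the Pohozaev identity. -/
noncomputable def pohoField (a b p q a₁ a₂ : ℝ) (u v : Euc N → ℝ) (i : Fin N) (x : Euc N) : ℝ :=
  euler u x * pd i v x + euler v x * pd i u x + -(x i * gradDot u v x) +
    x i * energy a b p q u v x + a₁ * (v x * pd i u x) + a₂ * (u x * pd i v x)

/-- The divergence of the Pohozaev vector field. -/
noncomputable def pohoDiv (a b p q c₁ c₂ : ℝ) (u v : Euc N → ℝ) (x : Euc N) : ℝ :=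
  c₁ * (‖x‖ ^ a * v x ^ (p + 1)) + c₂ * (‖x‖ ^ b * u x ^ (q + 1))

theorem IsSol.sum_pd_pohoField {a b p q a₁ a₂ : ℝ} {u v : Euc N → ℝ} (h : IsSol a b p q u v)
    (hp : 0 < p) (hq : 0 < q) (ha : a₁ + a₂ = N - 2) {x : Euc N} (hx : x ≠ 0) :
    ∑ i, pd i (pohoField a b p q a₁ a₂ u v i) x =
      pohoDiv a b p q ((N + a) / (p + 1) - a₁) ((N + b) / (q + 1) - a₂) u v x := by
  have hu := h.left.contDiffAt hx
  have hv := h.right.contDiffAt hx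
  have hu1 : DifferentiableAt ℝ u x := hu.differentiableAt (by norm_num)
  have hv1 : DifferentiableAt ℝ v x := hv.differentiableAt (by norm_num)
  have hu0 := h.left.pos x
  have hv0 := h.right.pos x
  obtain ⟨hB, hB'⟩ := hasFDerivAt_energy (a := a) (b := b) hp hq hx hu1 hv1 hu0 hv0
  have hG := differentiableAt_gradDot hu hv
  have d1 : ∀ i, DifferentiableAt ℝ (fun y => euler u y * pd i v y) x := fun i =>
    (differentiableAt_euler hu).mul (differentiableAt_pd hv i)
  have d2 : ∀ i, DifferentiableAt ℝ (fun y => euler v y * pd i u y) x := fun i =>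
    (differentiableAt_euler hv).mul (differentiableAt_pd hu i)
  have d3 : ∀ i, DifferentiableAt ℝ (fun y : Euc N => -(y i * gradDot u v y)) x := fun i =>
    ((differentiableAt_coord i x).mul hG).neg
  have d4 : ∀ i, DifferentiableAt ℝ (fun y : Euc N => y i * energy a b p q u v y) x := fun i =>
    (differentiableAt_coord i x).mul hB
  have d5 : ∀ i, DifferentiableAt ℝ (fun y => v y * pd i u y) x := fun i =>
    hv1.mul (differentiableAt_pd hu i)
  have d6 : ∀ i, DifferentiableAt ℝ (fun y => u y * pd i v y) x := fun i =>
    hu1.mul (differentiableAt_pd hv i)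
  have hsplit : ∀ i, pd i (pohoField a b p q a₁ a₂ u v i) x =
      pd i (fun y => euler u y * pd i v y) x + pd i (fun y => euler v y * pd i u y) x +
      -pd i (fun y => y i * gradDot u v y) x + pd i (fun y => y i * energy a b p q u v y) x +
      a₁ * pd i (fun y => v y * pd i u y) x + a₂ * pd i (fun y => u y * pd i v y) x := fun i => by
    have e1 := (d1 i).fun_add (d2 i)
    have e2 := e1.fun_add (d3 i)
    have e3 := e2.fun_add (d4 i)
    have e4 := e3.fun_add ((d5 i).const_mul a₁)
    unfold pohoField
    rw [pd_add e4 ((d6 i).const_mul a₂), pd_add e3 ((d5 i).const_mul a₁), pd_add e2 (d4 i),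
      pd_add e1 (d3 i), pd_add (d1 i) (d2 i), pd_neg, pd_const_mul (d5 i), pd_const_mul (d6 i)]
  simp only [hsplit, Finset.sum_add_distrib, Finset.sum_neg_distrib, ← Finset.mul_sum]
  rw [sum_pd_euler_mul hu hv, sum_pd_euler_mul hv hu, sum_pd_coord_mul hG, sum_pd_coord_mul hB,
    sum_pd_mul_pd hu hv1, sum_pd_mul_pd hv hu1, hB', euler_gradDot hu hv, gradDot_comm v u,
    show lap u x = -(‖x‖ ^ a * v x ^ p) by rw [← h.eq_left x hx, neg_neg],
    show lap v x = -(‖x‖ ^ b * u x ^ q) by rw [← h.eq_right x hx, neg_neg]]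
  unfold energy pohoDiv
  rw [Real.rpow_add_one hu0.ne', Real.rpow_add_one hv0.ne']
  have ha' : a₂ = N - 2 - a₁ := by linarith
  subst ha'
  field_simp
  ring

theorem integral_mul_tail_eq {w p : ℝ → ℝ} (hw : Continuous w) (hp : IntegrableOn p (Ioc 0 2)) :
    ∫ t in Ioc (0 : ℝ) 2, (∫ s in t..2, w s) * p t =
      ∫ r in Ioc (0 : ℝ) 2, w r * ∫ t in Ioc 0 r, p t := by
  set μ := (volume : Measure ℝ).restrict (Ioc 0 2)
  have hS : MeasurableSet {z : ℝ × ℝ | z.1 < z.2} := measurableSet_lt measurable_fst measurable_snd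
  have hwi : Integrable w μ := (hw.integrableOn_Icc (a := 0) (b := 2)).mono_set Ioc_subset_Icc_self
  have hi : Integrable ({z : ℝ × ℝ | z.1 < z.2}.indicator fun z => p z.1 * w z.2) (μ.prod μ) :=
    (hp.mul_prod hwi).indicator hS
  have e := integral_integral_swap
    (f := fun t r => {z : ℝ × ℝ | z.1 < z.2}.indicator (fun z => p z.1 * w z.2) (t, r)) hi
  have e1 : ∫ t in Ioc (0 : ℝ) 2, (∫ s in t..2, w s) * p t =
      ∫ t, ∫ r, {z : ℝ × ℝ | z.1 < z.2}.indicator (fun z => p z.1 * w z.2) (t, r) ∂μ ∂μ := by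
    refine setIntegral_congr_fun measurableSet_Ioc fun t ht => ?_
    have h1 : ∀ r, {z : ℝ × ℝ | z.1 < z.2}.indicator (fun z => p z.1 * w z.2) (t, r) =
        (Ioi t).indicator (fun r => p t * w r) r := fun r => by simp [indicator]
    simp only [h1]
    rw [integral_indicator measurableSet_Ioi, Measure.restrict_restrict measurableSet_Ioi,
      integral_const_mul, mul_comm, intervalIntegral.integral_of_le ht.2]
    congr 3
    ext r
    exact ⟨fun h => ⟨h.1, ht.1.trans h.1, h.2⟩, fun h => ⟨h.1, h.2.2⟩⟩
  have e2 : ∫ r in Ioc (0 : ℝ) 2, w r * ∫ t in Ioc 0 r, p t =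
      ∫ r, ∫ t, {z : ℝ × ℝ | z.1 < z.2}.indicator (fun z => p z.1 * w z.2) (t, r) ∂μ ∂μ := by
    refine setIntegral_congr_fun measurableSet_Ioc fun r hr => ?_
    have h1 : ∀ t, {z : ℝ × ℝ | z.1 < z.2}.indicator (fun z => p z.1 * w z.2) (t, r) =
        (Iio r).indicator (fun t => p t * w r) t := fun t => by simp [indicator]
    simp only [h1]
    rw [integral_indicator measurableSet_Iio, Measure.restrict_restrict measurableSet_Iio,
      integral_mul_const, mul_comm, integral_Ioc_eq_integral_Ioo]
    congr 3
    ext t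
    exact ⟨fun h => ⟨h.2, h.1, h.2.le.trans hr.2⟩, fun h => ⟨h.2.1, h.1⟩⟩
  rw [e1, e2, e]

theorem exists_smoothTransition_deriv_bound : ∃ M, 0 ≤ M ∧
    (∀ x, |deriv Real.smoothTransition x| ≤ M) ∧
    ∀ x, x ∉ Icc (0 : ℝ) 1 → deriv Real.smoothTransition x = 0 := by
  have h0 : ∀ x, x ∉ Icc (0 : ℝ) 1 → deriv Real.smoothTransition x = 0 := by
    intro x hx
    rcases lt_or_ge x 0 with h | h
    · have : Real.smoothTransition =ᶠ[nhds x] fun _ => 0 := by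
        filter_upwards [Iio_mem_nhds h] with y hy using Real.smoothTransition.zero_of_nonpos (le_of_lt hy)
      rw [this.deriv_eq, deriv_const]
    · have h1 : 1 < x := not_le.1 fun h' => hx ⟨h, h'⟩
      have : Real.smoothTransition =ᶠ[nhds x] fun _ => 1 := by
        filter_upwards [Ioi_mem_nhds h1] with y hy using Real.smoothTransition.one_of_one_le (le_of_lt hy)
      rw [this.deriv_eq, deriv_const]
  have hc : Continuous (deriv Real.smoothTransition) :=
    (Real.smoothTransition.contDiff (n := 1)).continuous_deriv le_rfl
  obtain ⟨M, hM⟩ := isCompact_Icc.exists_bound_of_continuousOn (s := Icc (0 : ℝ) 1) hc.continuousOn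
  refine ⟨M, (norm_nonneg _).trans (hM 0 (by simp)), fun x => ?_, h0⟩
  by_cases hx : x ∈ Icc (0 : ℝ) 1
  · exact hM x hx
  · rw [h0 x hx, abs_zero]; exact (norm_nonneg _).trans (hM 0 (by simp))

theorem hasDerivAt_tail {w : ℝ → ℝ} (hw : Continuous w) (t : ℝ) :
    HasDerivAt (fun t => ∫ s in t..2, w s) (-w t) t :=
  intervalIntegral.integral_hasDerivAt_left (hw.intervalIntegrable _ _)
    hw.aestronglyMeasurable.stronglyMeasurableAtFilter hw.continuousAt

/-- A one-dimensional du Bois-Reymond lemma, for a function with a weak derivative and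
a weak zero at the origin. -/
theorem ae_eq_integral_of_forall_deriv {A p : ℝ → ℝ}
    (hA : IntegrableOn (fun t => t⁻¹ * A t) (Ioc 0 2)) (hp : IntegrableOn p (Ioc 0 2))
    (h : ∀ g : ℝ → ℝ, ContDiff ℝ 1 g → tsupport g ⊆ Ioi 0 → HasCompactSupport g →
      ∫ t in Ioi (0 : ℝ), deriv g t * A t = -∫ t in Ioi (0 : ℝ), g t * p t) :
    ∀ᵐ r, r ∈ Ioo (1 : ℝ) 2 → A r = ∫ t in Ioc 0 r, p t := by
  have hA1 : IntegrableOn A (Ioc 0 2) := by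
    have h1 : IntegrableOn (fun t => t * (t⁻¹ * A t)) (Ioc 0 2) := by
      refine Integrable.bdd_mul (c := 2) hA (by fun_prop) ?_
      filter_upwards [self_mem_ae_restrict measurableSet_Ioc] with t ht
      rw [Real.norm_of_nonneg ht.1.le]; exact ht.2
    refine h1.congr_fun (fun t ht => ?_) measurableSet_Ioc
    have : t ≠ 0 := ht.1.ne'
    simp only; field_simp
  have hD : Continuous fun r => ∫ t in (0 : ℝ)..r, (Ioc (0 : ℝ) 2).indicator p t :=
    intervalIntegral.continuous_primitive
      (fun _ _ => ((integrable_indicator_iff measurableSet_Ioc).2 hp).intervalIntegrable) _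
  have hD' : ∀ r ∈ Ioc (0 : ℝ) 2, ∫ t in (0 : ℝ)..r, (Ioc (0 : ℝ) 2).indicator p t =
      ∫ t in Ioc 0 r, p t := fun r hr => by
    rw [intervalIntegral.integral_of_le hr.1.le]
    exact setIntegral_congr_fun measurableSet_Ioc fun t ht =>
      indicator_of_mem (show t ∈ Ioc (0 : ℝ) 2 from ⟨ht.1, ht.2.trans hr.2⟩) p
  have hDi : IntegrableOn (fun r => ∫ t in Ioc 0 r, p t) (Ioc 0 2) :=
    ((hD.integrableOn_Icc (a := 0) (b := 2)).mono_set Ioc_subset_Icc_self).congr_fun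
      hD' measurableSet_Ioc
  obtain ⟨M, hM0, hM, hM'⟩ := exists_smoothTransition_deriv_bound
  have key : ∀ᵐ r, r ∈ Ioo (1 : ℝ) 2 → A r - ∫ t in Ioc 0 r, p t = 0 := by
    refine isOpen_Ioo.ae_eq_zero_of_integral_contDiff_smul_eq_zero
      (((hA1.sub hDi).mono_set fun t ht => ⟨by linarith [ht.1], ht.2.le⟩).locallyIntegrableOn)
      fun w hw hwc hws => ?_
    have hwc' := hw.continuous
    have hw0 : ∀ t, t ∉ Ioo (1 : ℝ) 2 → w t = 0 := fun t ht =>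
      image_eq_zero_of_notMem_tsupport fun h => ht (hws h)
    set ψ : ℝ → ℝ := fun t => ∫ s in t..2, w s with hψ
    have hψd : ∀ t, HasDerivAt ψ (-w t) t := hasDerivAt_tail hwc'
    have hψc : Continuous ψ := continuous_iff_continuousAt.2 fun t => (hψd t).continuousAt
    have hψ2 : ∀ t, 2 ≤ t → ψ t = 0 := fun t ht => by
      refine intervalIntegral.integral_zero_ae (Eventually.of_forall fun s hs => hw0 s ?_)
      rw [uIoc_of_ge ht] at hs
      exact fun h => not_lt.2 hs.1.le h.2
    let ζ : ℕ → ℝ → ℝ := fun k t => Real.smoothTransition (k * t - 1)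
    have hζd : ∀ k t, HasDerivAt (ζ k) (deriv Real.smoothTransition (k * t - 1) * k) t := by
      intro k t
      have h1 : HasDerivAt (fun t : ℝ => (k : ℝ) * t - 1) k t := by
        simpa using ((hasDerivAt_id t).const_mul (k : ℝ)).sub_const 1
      have h2 := ((Real.smoothTransition.contDiff (n := 1)).differentiable
        (by norm_num) ((k : ℝ) * t - 1)).hasDerivAt
      exact h2.comp t h1
    have hgd : ∀ k t, HasDerivAt (fun t => ψ t * ζ k t)
        (-w t * ζ k t + ψ t * (deriv Real.smoothTransition (k * t - 1) * k)) t :=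
      fun k t => (hψd t).mul (hζd k t)
    have hst : Continuous (deriv Real.smoothTransition) :=
      (Real.smoothTransition.contDiff (n := 1)).continuous_deriv le_rfl
    have hζc : ∀ k, Continuous (ζ k) := fun k =>
      continuous_iff_continuousAt.2 fun t => (hζd k t).continuousAt
    have hζ1 : ∀ {t : ℝ} {k : ℕ}, 2 ≤ (k : ℝ) * t → ζ k t = 1 := fun h =>
      Real.smoothTransition.one_of_one_le (by linarith)
    have heq : ∀ k : ℕ, 2 ≤ k → ∫ t in Ioc (0 : ℝ) 2,
        (-w t + ψ t * (deriv Real.smoothTransition (k * t - 1) * k)) * A t =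
        -∫ t in Ioc (0 : ℝ) 2, (ψ t * ζ k t) * p t := by
      intro k hk
      have hk2 : (2 : ℝ) ≤ k := by exact_mod_cast hk
      have hkp : (0 : ℝ) < k := by linarith
      have hsupp : tsupport (fun t => ψ t * ζ k t) ⊆ Icc ((k : ℝ)⁻¹) 2 := by
        refine closure_minimal (fun t ht => ?_) isClosed_Icc
        by_contra hcon
        refine ht ?_
        simp only
        rcases lt_or_ge t ((k : ℝ)⁻¹) with h1 | h1
        · have : (k : ℝ) * t ≤ 1 := by
            rw [← mul_inv_cancel₀ hkp.ne']; exact mul_le_mul_of_nonneg_left h1.le hkp.le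
          simp only [ζ]
          rw [Real.smoothTransition.zero_of_nonpos (by linarith), mul_zero]
        · rw [hψ2 t (le_of_lt (not_le.1 fun h' => hcon ⟨h1, h'⟩)), zero_mul]
      have hsupp' : tsupport (fun t => ψ t * ζ k t) ⊆ Ioi 0 := fun t ht =>
        lt_of_lt_of_le (by positivity) (hsupp ht).1
      have hcd : ContDiff ℝ 1 fun t => ψ t * ζ k t := by
        rw [contDiff_one_iff_deriv]
        refine ⟨fun t => (hgd k t).differentiableAt, ?_⟩
        rw [funext fun t => (hgd k t).deriv]
        have := hζc k
        fun_prop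
      have e := h _ hcd hsupp' (isCompact_Icc.of_isClosed_subset (isClosed_tsupport _) hsupp)
      have hz : ∀ t ∈ Ioi (0 : ℝ) \ Ioc (0 : ℝ) 2, t ∉ tsupport (fun t => ψ t * ζ k t) :=
        fun t ht h' => ht.2 ⟨ht.1, (hsupp h').2⟩
      have e1 : ∫ t in Ioi (0 : ℝ), deriv (fun t => ψ t * ζ k t) t * A t =
          ∫ t in Ioc (0 : ℝ) 2, deriv (fun t => ψ t * ζ k t) t * A t :=
by
        refine setIntegral_eq_of_subset_of_forall_sdiff_eq_zero measurableSet_Ioi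
          Ioc_subset_Ioi_self fun t ht => ?_
        rw [image_eq_zero_of_notMem_tsupport (f := deriv fun t => ψ t * ζ k t)
          fun h' => hz t ht (tsupport_deriv_subset h'), zero_mul]
      have e2 : ∫ t in Ioi (0 : ℝ), (ψ t * ζ k t) * p t =
          ∫ t in Ioc (0 : ℝ) 2, (ψ t * ζ k t) * p t :=
by
        refine setIntegral_eq_of_subset_of_forall_sdiff_eq_zero measurableSet_Ioi
          Ioc_subset_Ioi_self fun t ht => ?_
        rw [image_eq_zero_of_notMem_tsupport (hz t ht), zero_mul]
      rw [e1, e2] at e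
      rw [← e]
      refine setIntegral_congr_fun measurableSet_Ioc fun t ht => ?_
      rw [(hgd k t).deriv]
      by_cases hwt : t ∈ Ioo (1 : ℝ) 2
      · rw [hζ1 (by nlinarith [hwt.1]), mul_one]
      · rw [hw0 t hwt]; simp
    obtain ⟨K, hK⟩ := isCompact_Icc.exists_bound_of_continuousOn (s := Icc (0 : ℝ) 2)
      hψc.continuousOn
    have hmA := hA1.aestronglyMeasurable
    have lim1 : Tendsto (fun k : ℕ => ∫ t in Ioc (0 : ℝ) 2,
        (-w t + ψ t * (deriv Real.smoothTransition (k * t - 1) * k)) * A t) atTop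
        (nhds (∫ t in Ioc (0 : ℝ) 2, -w t * A t)) := by
      obtain ⟨W, hW⟩ := isCompact_Icc.exists_bound_of_continuousOn (s := Icc (0 : ℝ) 2)
        hwc'.continuousOn
      refine tendsto_integral_of_dominated_convergence
        (fun t => W * ‖A t‖ + K * (2 * M) * ‖t⁻¹ * A t‖)
        (fun k => ?_) ((hA1.norm.const_mul W).add (hA.norm.const_mul _)) (fun k => ?_) ?_
      · exact AEStronglyMeasurable.mul
          (Continuous.aestronglyMeasurable (by fun_prop)) hmA
      · filter_upwards [self_mem_ae_restrict measurableSet_Ioc] with t ht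
        have ht' : t ∈ Icc (0 : ℝ) 2 := ⟨ht.1.le, ht.2⟩
        have hK0 : 0 ≤ K := (norm_nonneg _).trans (hK t ht')
        have hd : |deriv Real.smoothTransition (k * t - 1) * k| ≤ 2 * M * t⁻¹ := by
          by_cases hm : (k : ℝ) * t - 1 ∈ Icc (0 : ℝ) 1
          · rw [abs_mul, abs_of_nonneg (Nat.cast_nonneg (α := ℝ) k), mul_comm 2 M, mul_assoc]
            refine mul_le_mul (hM _) ?_ (Nat.cast_nonneg k) hM0
            rw [← div_eq_mul_inv, le_div_iff₀ ht.1]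
            linarith [hm.2]
          · rw [hM' _ hm, zero_mul, abs_zero]
            have := ht.1
            positivity
        rw [norm_mul, norm_mul, norm_inv, Real.norm_of_nonneg ht.1.le]
        have : ‖-w t + ψ t * (deriv Real.smoothTransition (k * t - 1) * k)‖ ≤
            W + K * (2 * M * t⁻¹) := by
          refine (norm_add_le _ _).trans (add_le_add ?_ ?_)
          · rw [norm_neg]; exact hW t ht'
          · rw [norm_mul]
            exact mul_le_mul (hK t ht') hd (norm_nonneg _) hK0
        calc _ ≤ (W + K * (2 * M * t⁻¹)) * ‖A t‖ := mul_le_mul_of_nonneg_right this (norm_nonneg _)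
          _ = _ := by ring
      · filter_upwards [self_mem_ae_restrict measurableSet_Ioc] with t ht
        refine tendsto_const_nhds.congr' ?_
        obtain ⟨n, hn⟩ := exists_nat_gt (2 / t)
        filter_upwards [eventually_ge_atTop n] with k hk
        have h1 : 2 < (k : ℝ) * t := by
          rw [← div_lt_iff₀ ht.1]; exact hn.trans_le (by exact_mod_cast hk)
        rw [hM' _ fun h' => by linarith [h'.2]]
        ring
    have lim2 : Tendsto (fun k : ℕ => ∫ t in Ioc (0 : ℝ) 2, (ψ t * ζ k t) * p t) atTop
        (nhds (∫ t in Ioc (0 : ℝ) 2, ψ t * p t)) := by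
      refine tendsto_integral_of_dominated_convergence (fun t => K * ‖p t‖)
        (fun k => ?_) (hp.norm.const_mul K) (fun k => ?_) ?_
      · have := hζc k
        exact AEStronglyMeasurable.mul
          (Continuous.aestronglyMeasurable (by fun_prop)) hp.aestronglyMeasurable
      · filter_upwards [self_mem_ae_restrict measurableSet_Ioc] with t ht
        have ht' : t ∈ Icc (0 : ℝ) 2 := ⟨ht.1.le, ht.2⟩
        rw [norm_mul, norm_mul]
        refine mul_le_mul_of_nonneg_right ?_ (norm_nonneg _)
        have h1 : ‖ζ k t‖ ≤ 1 := by
          rw [Real.norm_of_nonneg (Real.smoothTransition.nonneg _)]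
          exact Real.smoothTransition.le_one _
        calc _ ≤ K * 1 := mul_le_mul (hK t ht') h1 (norm_nonneg _)
              ((norm_nonneg _).trans (hK t ht'))
          _ = K := mul_one K
      · filter_upwards [self_mem_ae_restrict measurableSet_Ioc] with t ht
        refine tendsto_const_nhds.congr' ?_
        obtain ⟨n, hn⟩ := exists_nat_gt (2 / t)
        filter_upwards [eventually_ge_atTop n] with k hk
        have h1 : 2 < (k : ℝ) * t := by
          rw [← div_lt_iff₀ ht.1]; exact hn.trans_le (by exact_mod_cast hk)
        rw [hζ1 h1.le, mul_one]
    have hlim := tendsto_nhds_unique (lim1.congr' ((eventually_ge_atTop 2).mono heq)) lim2.neg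
    simp only [neg_mul, integral_neg, neg_inj] at hlim
    rw [hψ, integral_mul_tail_eq hwc' hp] at hlim
    obtain ⟨W, hW⟩ := isCompact_Icc.exists_bound_of_continuousOn (s := Icc (0 : ℝ) 2)
      hwc'.continuousOn
    have hb : ∀ᵐ t ∂(volume : Measure ℝ).restrict (Ioc 0 2), ‖w t‖ ≤ W := by
      filter_upwards [self_mem_ae_restrict measurableSet_Ioc] with t ht
      exact hW t ⟨ht.1.le, ht.2⟩
    have e3 : ∫ x, w x • (A x - ∫ t in Ioc 0 x, p t) =
        ∫ x in Ioc (0 : ℝ) 2, w x • (A x - ∫ t in Ioc 0 x, p t) :=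
      (setIntegral_eq_integral_of_forall_compl_eq_zero fun t ht => by
        rw [hw0 t fun h' => ht ⟨by linarith [h'.1], h'.2.le⟩, zero_smul]).symm
    rw [e3]
    simp only [smul_eq_mul, mul_sub]
    rw [integral_sub (hA1.bdd_mul hwc'.aestronglyMeasurable hb)
      (hDi.bdd_mul hwc'.aestronglyMeasurable hb), hlim, sub_self]
  filter_upwards [key] with r hr h'
  exact sub_eq_zero.1 (hr h')

theorem pd_comp_norm {g : ℝ → ℝ} {x : Euc N} (hx : x ≠ 0) (hg : DifferentiableAt ℝ g ‖x‖)
    (i : Fin N) : pd i (fun y => g ‖y‖) x = deriv g ‖x‖ * (x i * ‖x‖⁻¹) := by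
  have hx0 : 0 < ‖x‖ := norm_pos_iff.2 hx
  have h := ((hasStrictFDerivAt_norm_sq x).hasFDerivAt.sqrt (by positivity))
  simp only [Real.sqrt_sq (norm_nonneg _)] at h
  have h1 := hg.hasDerivAt.comp_hasFDerivAt x h
  unfold pd
  rw [show (fun y : Euc N => g ‖y‖) = g ∘ fun y => ‖y‖ from rfl, h1.fderiv]
  simp [EuclideanSpace.inner_single_right]
  field_simp
  simp

theorem contDiff_comp_norm {g : ℝ → ℝ} (hg : ContDiff ℝ 1 g) (hg0 : tsupport g ⊆ Ioi 0) :
    ContDiff ℝ 1 fun x : Euc N => g ‖x‖ := by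
  refine contDiff_iff_contDiffAt.2 fun x => ?_
  by_cases hx : x = 0
  · subst hx
    have h0 : (0 : ℝ) ∉ tsupport g := fun h => lt_irrefl (0 : ℝ) (hg0 h)
    have h1 : (fun x : Euc N => g ‖x‖) =ᶠ[nhds 0] fun _ => 0 := by
      have h2 : g =ᶠ[nhds ‖(0 : Euc N)‖] fun _ => 0 := by
        rw [norm_zero]; exact notMem_tsupport_iff_eventuallyEq.1 h0
      exact (continuous_norm (E := Euc N)).continuousAt.eventually h2
    exact contDiffAt_const.congr_of_eventuallyEq h1
  · exact hg.contDiffAt.comp x (contDiffAt_norm ℝ hx)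

theorem tsupport_comp_norm_subset (g : ℝ → ℝ) :
    tsupport (fun x : Euc N => g ‖x‖) ⊆ (fun x => ‖x‖) ⁻¹' tsupport g :=
  closure_minimal (fun _ hx => subset_tsupport g hx) ((isClosed_tsupport g).preimage continuous_norm)

theorem hasCompactSupport_comp_norm {g : ℝ → ℝ} (hg : HasCompactSupport g) :
    HasCompactSupport fun x : Euc N => g ‖x‖ := by
  obtain ⟨r, hr⟩ := hg.isCompact.isBounded.subset_closedBall 0
  refine (isCompact_closedBall (0 : Euc N) r).of_isClosed_subset (isClosed_tsupport _) ?_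
  intro x hx
  have := hr (tsupport_comp_norm_subset g hx)
  simpa using this

/-- The radial component of the Pohozaev vector field. -/
noncomputable def pohoRad (a b p q a₁ a₂ : ℝ) (u v : Euc N → ℝ) (x : Euc N) : ℝ :=
  ∑ i, pohoField a b p q a₁ a₂ u v i x * (x i * ‖x‖⁻¹)

theorem IsSuperharm.contDiffOn_pd {u : Euc N → ℝ} (hu : IsSuperharm u) (i : Fin N) :
    ContDiffOn ℝ 1 (pd i u) {0}ᶜ :=
  _root_.contDiffOn_pd (n := 1) isOpen_compl_zero (by exact_mod_cast hu.contDiffOn) i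

theorem contDiffOn_norm_rpow (a : ℝ) : ContDiffOn ℝ 1 (fun x : Euc N => ‖x‖ ^ a) {0}ᶜ :=
  (contDiffOn_id.norm ℝ fun _ h => h).rpow_const_of_ne fun _ h => norm_ne_zero_iff.2 h

theorem contDiffOn_coord (i : Fin N) (U : Set (Euc N)) : ContDiffOn ℝ 1 (fun x : Euc N => x i) U :=
  ((EuclideanSpace.proj i : Euc N →L[ℝ] ℝ)).contDiff.contDiffOn

variable {a b p q : ℝ} {u v : Euc N → ℝ}

theorem IsSol.contDiffOn_pohoField (h : IsSol a b p q u v) (a₁ a₂ : ℝ) (i : Fin N) :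
    ContDiffOn ℝ 1 (pohoField a b p q a₁ a₂ u v i) {0}ᶜ := by
  have hu : ContDiffOn ℝ 1 u {0}ᶜ := h.left.contDiffOn.of_le (by norm_num)
  have hv : ContDiffOn ℝ 1 v {0}ᶜ := h.right.contDiffOn.of_le (by norm_num)
  have he : ∀ {w : Euc N → ℝ}, IsSuperharm w → ContDiffOn ℝ 1 (euler w) {0}ᶜ := fun hw =>
    ContDiffOn.sum fun j _ => (contDiffOn_coord j _).mul (hw.contDiffOn_pd j)
  have hg : ContDiffOn ℝ 1 (gradDot u v) {0}ᶜ :=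
    ContDiffOn.sum fun j _ => (h.left.contDiffOn_pd j).mul (h.right.contDiffOn_pd j)
  have hB : ContDiffOn ℝ 1 (energy a b p q u v) {0}ᶜ :=
    (((contDiffOn_norm_rpow a).mul (hv.rpow_const_of_ne fun x _ => (h.right.pos x).ne')).div_const _).add
    (((contDiffOn_norm_rpow b).mul (hu.rpow_const_of_ne fun x _ => (h.left.pos x).ne')).div_const _)
  have hx := contDiffOn_coord i ({0}ᶜ : Set (Euc N))
  exact (((((he h.left).mul (h.right.contDiffOn_pd i)).add
    ((he h.right).mul (h.left.contDiffOn_pd i))).add (hx.mul hg).neg).add (hx.mul hB)).add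
    (contDiffOn_const.mul (hv.mul (h.left.contDiffOn_pd i))) |>.add
    (contDiffOn_const.mul (hu.mul (h.right.contDiffOn_pd i)))

theorem IsSol.continuousOn_pohoRad (h : IsSol a b p q u v) (a₁ a₂ : ℝ) :
    ContinuousOn (pohoRad a b p q a₁ a₂ u v) {0}ᶜ :=
  continuousOn_finsetSum _ fun i _ => (h.contDiffOn_pohoField a₁ a₂ i).continuousOn.mul
    ((contDiffOn_coord i _).continuousOn.mul
      (continuous_norm.continuousOn.inv₀ fun _ hx => norm_ne_zero_iff.2 hx))

theorem IsSol.continuousOn_pohoDiv (h : IsSol a b p q u v) (c₁ c₂ : ℝ) :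
    ContinuousOn (pohoDiv a b p q c₁ c₂ u v) {0}ᶜ :=
  (continuousOn_const.mul ((contDiffOn_norm_rpow a).continuousOn.mul
    (h.right.continuous.continuousOn.rpow_const fun x _ => Or.inl (h.right.pos x).ne'))).add
  (continuousOn_const.mul ((contDiffOn_norm_rpow b).continuousOn.mul
    (h.left.continuous.continuousOn.rpow_const fun x _ => Or.inl (h.left.pos x).ne')))

theorem IsSol.integral_deriv_mul_pohoRad (h : IsSol a b p q u v) (hp : 0 < p) (hq : 0 < q)
    {a₁ a₂ c₁ c₂ : ℝ} (ha : a₁ + a₂ = N - 2) (hc₁ : c₁ = (N + a) / (p + 1) - a₁)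
    (hc₂ : c₂ = (N + b) / (q + 1) - a₂) {g : ℝ → ℝ}
    (hg : ContDiff ℝ 1 g) (hg0 : tsupport g ⊆ Ioi 0) (hgc : HasCompactSupport g) :
    Integrable (fun x => deriv g ‖x‖ * pohoRad a b p q a₁ a₂ u v x) ∧
    Integrable (fun x => g ‖x‖ * pohoDiv a b p q c₁ c₂ u v x) ∧
    ∫ x, deriv g ‖x‖ * pohoRad a b p q a₁ a₂ u v x =
      -∫ x, g ‖x‖ * pohoDiv a b p q c₁ c₂ u v x := by
  subst hc₁ hc₂
  have hφ := contDiff_comp_norm (N := N) hg hg0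
  have hφc := hasCompactSupport_comp_norm (N := N) hgc
  have hφs : tsupport (fun x : Euc N => g ‖x‖) ⊆ {0}ᶜ := fun x hx => by
    have := hg0 (tsupport_comp_norm_subset g hx)
    simpa using this
  have hpc : ∀ i, Continuous (pd i fun x : Euc N => g ‖x‖) := fun i =>
    (contDiff_pd (n := 0) (by exact_mod_cast hφ) i).continuous
  have hi1 : ∀ i, Integrable fun x => pohoField a b p q a₁ a₂ u v i x * pd i (fun x => g ‖x‖) x :=
    fun i => integrable_mul_of_tsupport_subset isOpen_compl_zero
      (h.contDiffOn_pohoField a₁ a₂ i).continuousOn (hpc i) (hasCompactSupport_pd hφc i)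
      ((tsupport_pd_subset _ i).trans hφs)
  have hi2 : ∀ i, Integrable fun x => pd i (pohoField a b p q a₁ a₂ u v i) x * g ‖x‖ :=
    fun i => integrable_mul_of_tsupport_subset isOpen_compl_zero
      (_root_.contDiffOn_pd (n := 0) isOpen_compl_zero
        (by exact_mod_cast h.contDiffOn_pohoField a₁ a₂ i) i).continuousOn hφ.continuous hφc hφs
  have e1 : (fun x => deriv g ‖x‖ * pohoRad a b p q a₁ a₂ u v x) =
      fun x => ∑ i, pohoField a b p q a₁ a₂ u v i x * pd i (fun x => g ‖x‖) x := by
    funext x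
    by_cases hx : x = 0
    · subst hx
      have : ∀ i, pd i (fun x : Euc N => g ‖x‖) 0 = 0 := fun i =>
        image_eq_zero_of_notMem_tsupport fun h' => hφs (tsupport_pd_subset _ i h') rfl
      simp [this, pohoRad]
    · unfold pohoRad
      rw [Finset.mul_sum]
      refine Finset.sum_congr rfl fun i _ => ?_
      rw [pd_comp_norm hx ((hg.differentiable (by norm_num)) _)]
      ring
  have e2 : (fun x => g ‖x‖ * pohoDiv a b p q ((N + a) / (p + 1) - a₁) ((N + b) / (q + 1) - a₂) u v x) =
      fun x => ∑ i, pd i (pohoField a b p q a₁ a₂ u v i) x * g ‖x‖ := by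
    funext x
    by_cases hx : x = 0
    · have : g ‖x‖ = 0 :=
        image_eq_zero_of_notMem_tsupport (f := fun x : Euc N => g ‖x‖) fun h' => hφs h' hx
      simp [this]
    · rw [← h.sum_pd_pohoField hp hq ha hx, Finset.mul_sum]
      exact Finset.sum_congr rfl fun i _ => mul_comm _ _
  rw [e1, e2]
  refine ⟨integrable_finsetSum _ fun i _ => hi1 i, integrable_finsetSum _ fun i _ => hi2 i, ?_⟩
  rw [integral_finsetSum _ fun i _ => hi1 i, integral_finsetSum _ fun i _ => hi2 i,
    ← Finset.sum_neg_distrib]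
  exact Finset.sum_congr rfl fun i _ => integral_mul_pd isOpen_compl_zero
    (h.contDiffOn_pohoField a₁ a₂ i) hφ hφc hφs i

theorem integrableOn_closedBall_of_le (hN : 3 ≤ N) {F : Euc N → ℝ} (hF : ContinuousOn F {0}ᶜ)
    {C : ℝ} (h : ∀ x, x ≠ 0 → ‖x‖ ≤ 2 → |F x| ≤ C * ‖x‖⁻¹ ^ 2) :
    IntegrableOn F (closedBall 0 2) := by
  have : Nonempty (Fin N) := ⟨⟨0, by omega⟩⟩
  have hN2 : (2 : ℝ) < N := by exact_mod_cast (by omega : 2 < N)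
  obtain ⟨K, hK, hKle⟩ := exists_lintegral_closedBall_le (N := N) hN (c := 2) (by norm_num) hN2 2
  have hae : (({0}ᶜ : Set (Euc N))) ∈ ae (volume.restrict (closedBall (0 : Euc N) 2)) :=
    ae_restrict_of_ae (compl_mem_ae_iff.2 (measure_singleton 0))
  have hm : AEStronglyMeasurable F (volume.restrict (closedBall (0 : Euc N) 2)) := by
    have h1 := hF.aestronglyMeasurable (μ := volume) isOpen_compl_zero.measurableSet
    rw [Measure.restrict_eq_self_of_ae_mem (s := {0}ᶜ) (compl_mem_ae_iff.2 (measure_singleton 0))] at h1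
    exact h1.restrict
  refine ⟨hm, lt_of_le_of_lt (b := ENNReal.ofReal C * K) ?_
    (ENNReal.mul_lt_top ENNReal.ofReal_lt_top hK.lt_top)⟩
  have h0 := hKle 0
  simp only [sub_zero] at h0
  refine le_trans ?_ (mul_le_mul_right h0 _)
  rw [← lintegral_const_mul' _ _ ENNReal.ofReal_ne_top]
  refine lintegral_mono_ae ?_
  filter_upwards [hae, self_mem_ae_restrict measurableSet_closedBall] with x hx hx2
  have hx0 : 0 < ‖x‖ := norm_pos_iff.2 hx
  rw [← ofReal_norm, ← ofReal_norm, ENNReal.ofReal_rpow_of_pos hx0,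
    ← ENNReal.ofReal_mul' (by positivity)]
  refine ENNReal.ofReal_le_ofReal ((h x hx (by simpa using hx2)).trans (le_of_eq ?_))
  rw [Real.rpow_neg hx0.le, Real.rpow_two, inv_pow]

theorem exists_norm_rpow_le (ha : -2 < a) :
    ∃ C, 0 < C ∧ ∀ x : Euc N, x ≠ 0 → ‖x‖ ≤ 2 → ‖x‖ ^ a ≤ C * ‖x‖⁻¹ ^ 2 := by
  refine ⟨2 ^ (a + 2), by positivity, fun x hx hx2 => ?_⟩
  have hx0 : 0 < ‖x‖ := norm_pos_iff.2 hx
  have h1 : ‖x‖ ^ (a + 2) ≤ 2 ^ (a + 2) := Real.rpow_le_rpow hx0.le hx2 (by linarith)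
  rw [Real.rpow_add hx0, Real.rpow_two] at h1
  rw [inv_pow, ← div_eq_mul_inv, le_div_iff₀ (by positivity)]
  exact h1

theorem IsSol.exists_energy_bound (h : IsSol a b p q u v) (ha : -2 < a) (hb : -2 < b)
    (hp : 0 < p) (hq : 0 < q) : ∃ C, 0 < C ∧ ∀ x, x ≠ 0 → ‖x‖ ≤ 2 →
      ‖x‖ ^ a * v x ^ (p + 1) ≤ C * ‖x‖⁻¹ ^ 2 ∧ ‖x‖ ^ b * u x ^ (q + 1) ≤ C * ‖x‖⁻¹ ^ 2 := by
  obtain ⟨M, hM, hMu⟩ := exists_bound_closedBall h.left.continuous 2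
  obtain ⟨M', hM', hMv⟩ := exists_bound_closedBall h.right.continuous 2
  obtain ⟨A, hA, hAle⟩ := exists_norm_rpow_le (N := N) ha
  obtain ⟨B, hB, hBle⟩ := exists_norm_rpow_le (N := N) hb
  refine ⟨A * M' ^ (p + 1) + B * M ^ (q + 1), by positivity, fun x hx hx2 => ?_⟩
  have hx0 : 0 < ‖x‖ := norm_pos_iff.2 hx
  have h1 : v x ^ (p + 1) ≤ M' ^ (p + 1) :=
    Real.rpow_le_rpow (h.right.pos x).le (hMv x hx2) (by linarith)
  have h2 : u x ^ (q + 1) ≤ M ^ (q + 1) :=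
    Real.rpow_le_rpow (h.left.pos x).le (hMu x hx2) (by linarith)
  have hv0 := (h.right.pos x).le
  have hu0 := (h.left.pos x).le
  have i0 : 0 ≤ ‖x‖⁻¹ ^ 2 := by positivity
  have j1 : 0 ≤ A * M' ^ (p + 1) * ‖x‖⁻¹ ^ 2 := by positivity
  have j2 : 0 ≤ B * M ^ (q + 1) * ‖x‖⁻¹ ^ 2 := by positivity
  have k1 := mul_le_mul (hAle x hx hx2) h1 (by positivity) (by positivity)
  have k2 := mul_le_mul (hBle x hx hx2) h2 (by positivity) (by positivity)
  constructor <;> nlinarith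

theorem IsSol.integrableOn_pohoDiv (hN : 3 ≤ N) (h : IsSol a b p q u v) (ha : -2 < a)
    (hb : -2 < b) (hp : 0 < p) (hq : 0 < q) (c₁ c₂ : ℝ) :
    IntegrableOn (pohoDiv a b p q c₁ c₂ u v) (closedBall 0 2) := by
  obtain ⟨C, hC, hle⟩ := h.exists_energy_bound ha hb hp hq
  refine integrableOn_closedBall_of_le hN (h.continuousOn_pohoDiv c₁ c₂)
    (C := (|c₁| + |c₂|) * C) fun x hx hx2 => ?_
  obtain ⟨h1, h2⟩ := hle x hx hx2
  have hv0 := (h.right.pos x).le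
  have hu0 := (h.left.pos x).le
  unfold pohoDiv
  refine (abs_add_le _ _).trans ?_
  rw [abs_mul c₁, abs_mul c₂, abs_of_nonneg (a := ‖x‖ ^ a * v x ^ (p + 1)) (by positivity),
    abs_of_nonneg (a := ‖x‖ ^ b * u x ^ (q + 1)) (by positivity)]
  have := mul_le_mul_of_nonneg_left h1 (abs_nonneg c₁)
  have := mul_le_mul_of_nonneg_left h2 (abs_nonneg c₂)
  linarith

theorem pohoRad_eq {x : Euc N} (hx : x ≠ 0) (a₁ a₂ : ℝ) : pohoRad a b p q a₁ a₂ u v x =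
    ‖x‖⁻¹ * (2 * (euler u x * euler v x) + a₁ * (v x * euler u x) + a₂ * (u x * euler v x)) +
      ‖x‖ * (energy a b p q u v x - gradDot u v x) := by
  have hx0 : ‖x‖ ≠ 0 := norm_ne_zero_iff.2 hx
  have h1 : ∀ w : Euc N → ℝ, ∑ i, x i * pd i w x = euler w x := fun w => rfl
  have h2 : ∑ i, x i * x i = ‖x‖ ^ 2 := by
    rw [EuclideanSpace.real_norm_sq_eq]; exact Finset.sum_congr rfl fun i _ => (sq _).symm
  have : pohoRad a b p q a₁ a₂ u v x = ‖x‖⁻¹ * (euler u x * ∑ i, x i * pd i v x) +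
      ‖x‖⁻¹ * (euler v x * ∑ i, x i * pd i u x) +
      ‖x‖⁻¹ * ((energy a b p q u v x - gradDot u v x) * ∑ i, x i * x i) +
      ‖x‖⁻¹ * (a₁ * v x * ∑ i, x i * pd i u x) + ‖x‖⁻¹ * (a₂ * u x * ∑ i, x i * pd i v x) := by
    unfold pohoRad pohoField
    simp only [Finset.mul_sum]
    simp only [← Finset.sum_add_distrib]
    exact Finset.sum_congr rfl fun i _ => by ring
  rw [this, h1, h1, h2]
  field_simp
  ring

theorem abs_coord_le (x : Euc N) (i : Fin N) : |x i| ≤ ‖x‖ := PiLp.norm_apply_le x i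

theorem abs_euler_le {x : Euc N} {K : ℝ} (h : ∀ i, |pd i u x| ≤ K) :
    |euler u x| ≤ N * (‖x‖ * K) := by
  unfold euler
  refine (Finset.abs_sum_le_sum_abs _ _).trans ?_
  refine (Finset.sum_le_card_nsmul _ _ (‖x‖ * K) fun i _ => ?_).trans (by simp)
  rw [abs_mul]
  exact mul_le_mul (abs_coord_le x i) (h i) (abs_nonneg _) (norm_nonneg _)

theorem abs_gradDot_le {x : Euc N} {K K' : ℝ} (hK : 0 ≤ K) (h : ∀ i, |pd i u x| ≤ K)
    (h' : ∀ i, |pd i v x| ≤ K') : |gradDot u v x| ≤ N * (K * K') := by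
  unfold gradDot
  refine (Finset.abs_sum_le_sum_abs _ _).trans ?_
  refine (Finset.sum_le_card_nsmul _ _ (K * K') fun i _ => ?_).trans (by simp)
  rw [abs_mul]
  exact mul_le_mul (h i) (h' i) (abs_nonneg _) hK

/-- The radial component of the Pohozaev field is controlled by the product of first-order
quantities and the energy density. -/
theorem exists_abs_pohoRad_le (N : ℕ) (a₁ a₂ : ℝ) : ∃ C, 0 < C ∧ ∀ (a b p q : ℝ)
    (u v : Euc N → ℝ) (x : Euc N) (K K' : ℝ), x ≠ 0 → 0 ≤ K → 0 ≤ K' → (∀ i, |pd i u x| ≤ K) →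
    (∀ i, |pd i v x| ≤ K') → |pohoRad a b p q a₁ a₂ u v x| ≤
      C * (‖x‖ * (K * K') + |v x| * K + |u x| * K') + ‖x‖ * |energy a b p q u v x| := by
  refine ⟨2 * N ^ 2 + N + |a₁| * N + |a₂| * N + 1, by positivity,
    fun a b p q u v x K K' hx hK hK' hu hv => ?_⟩
  have hx0 : 0 < ‖x‖ := norm_pos_iff.2 hx
  rw [pohoRad_eq hx]
  have h1 := abs_euler_le hu
  have h2 := abs_euler_le hv
  have h3 := abs_gradDot_le hK hu hv
  have e1 : |euler u x * euler v x| ≤ N ^ 2 * ‖x‖ ^ 2 * (K * K') := by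
    rw [abs_mul]
    calc _ ≤ (N * (‖x‖ * K)) * (N * (‖x‖ * K')) := mul_le_mul h1 h2 (abs_nonneg _) (by positivity)
      _ = _ := by ring
  have e2 : |v x * euler u x| ≤ N * ‖x‖ * (|v x| * K) := by
    rw [abs_mul]
    calc _ ≤ |v x| * (N * (‖x‖ * K)) := mul_le_mul_of_nonneg_left h1 (abs_nonneg _)
      _ = _ := by ring
  have e3 : |u x * euler v x| ≤ N * ‖x‖ * (|u x| * K') := by
    rw [abs_mul]
    calc _ ≤ |u x| * (N * (‖x‖ * K')) := mul_le_mul_of_nonneg_left h2 (abs_nonneg _)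
      _ = _ := by ring
  have e4 : |2 * (euler u x * euler v x) + a₁ * (v x * euler u x) + a₂ * (u x * euler v x)| ≤
      2 * (N ^ 2 * ‖x‖ ^ 2 * (K * K')) + |a₁| * (N * ‖x‖ * (|v x| * K)) +
      |a₂| * (N * ‖x‖ * (|u x| * K')) := by
    refine (abs_add_three _ _ _).trans ?_
    rw [abs_mul 2, abs_mul a₁, abs_mul a₂, abs_two]
    gcongr
  have e5 : |energy a b p q u v x - gradDot u v x| ≤ |energy a b p q u v x| + N * (K * K') :=
    (abs_sub _ _).trans (add_le_add le_rfl h3)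
  have hA : 0 ≤ ‖x‖ * (K * K') := by positivity
  have hB : 0 ≤ |v x| * K := by positivity
  have hD : 0 ≤ |u x| * K' := by positivity
  calc _ ≤ ‖x‖⁻¹ * (2 * (N ^ 2 * ‖x‖ ^ 2 * (K * K')) + |a₁| * (N * ‖x‖ * (|v x| * K)) +
        |a₂| * (N * ‖x‖ * (|u x| * K'))) + ‖x‖ * (|energy a b p q u v x| + N * (K * K')) := by
        refine (abs_add_le _ _).trans ?_
        rw [abs_mul ‖x‖⁻¹, abs_mul ‖x‖, abs_norm, abs_inv, abs_norm]
        gcongr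
    _ = (2 * N ^ 2 + N) * (‖x‖ * (K * K')) + (|a₁| * N) * (|v x| * K) +
        (|a₂| * N) * (|u x| * K') + ‖x‖ * |energy a b p q u v x| := by
        field_simp; ring
    _ ≤ _ := by
        have hn : (0 : ℝ) ≤ N := Nat.cast_nonneg N
        have t1 : 0 ≤ |a₁| * N := by positivity
        have t2 : 0 ≤ |a₂| * N := by positivity
        have t3 : (0:ℝ) ≤ N ^ 2 := by positivity
        rw [mul_add, mul_add]
        have hn2 : (0 : ℝ) ≤ 2 * N ^ 2 := by positivity
        have c1 : (2 * N ^ 2 + N : ℝ) ≤ 2 * N ^ 2 + N + |a₁| * N + |a₂| * N + 1 := by linarith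
        have c2 : |a₁| * N ≤ 2 * N ^ 2 + N + |a₁| * N + |a₂| * N + 1 := by linarith
        have c3 : |a₂| * N ≤ 2 * N ^ 2 + N + |a₁| * N + |a₂| * N + 1 := by linarith
        gcongr

theorem IsSol.integrableOn_pohoRad (hN : 3 ≤ N) (h : IsSol a b p q u v) (ha : -2 < a)
    (hb : -2 < b) (hp : 0 < p) (hq : 0 < q) (a₁ a₂ : ℝ) :
    IntegrableOn (fun x => ‖x‖⁻¹ * pohoRad a b p q a₁ a₂ u v x) (closedBall 0 2) := by
  obtain ⟨C, hC, hle⟩ := h.exists_energy_bound ha hb hp hq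
  obtain ⟨D, hD, hDle⟩ := h.exists_grad_bound hN ha hp
  obtain ⟨E, hE, hEle⟩ := h.symm.exists_grad_bound hN hb hq
  obtain ⟨M, hM, hMu⟩ := exists_bound_closedBall h.left.continuous 2
  obtain ⟨M', hM', hMv⟩ := exists_bound_closedBall h.right.continuous 2
  obtain ⟨P, hP, hPle⟩ := exists_abs_pohoRad_le N a₁ a₂
  refine integrableOn_closedBall_of_le hN (C := P * (D * E + M' * D + M * E) + 2 * C)
    ((continuous_norm.continuousOn.inv₀ fun _ hx => norm_ne_zero_iff.2 hx).mul
      (h.continuousOn_pohoRad a₁ a₂)) fun x hx hx2 => ?_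
  have hx0 : 0 < ‖x‖ := norm_pos_iff.2 hx
  obtain ⟨h1, h2⟩ := hle x hx hx2
  have h3 := hPle a b p q u v x _ _ hx (by positivity) (by positivity) (hDle x hx hx2) (hEle x hx hx2)
  have hv0 := (h.right.pos x).le
  have hu0 := (h.left.pos x).le
  rw [abs_of_nonneg hv0, abs_of_nonneg hu0] at h3
  have h4 : |energy a b p q u v x| ≤ 2 * (C * ‖x‖⁻¹ ^ 2) := by
    rw [abs_of_nonneg (by unfold energy; positivity)]
    unfold energy
    have g1 : ‖x‖ ^ a * v x ^ (p + 1) / (p + 1) ≤ ‖x‖ ^ a * v x ^ (p + 1) :=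
      div_le_self (by positivity) (by linarith)
    have g2 : ‖x‖ ^ b * u x ^ (q + 1) / (q + 1) ≤ ‖x‖ ^ b * u x ^ (q + 1) :=
      div_le_self (by positivity) (by linarith)
    linarith
  rw [abs_mul, abs_inv, abs_norm]
  have h5 : v x * (D * ‖x‖⁻¹) ≤ M' * (D * ‖x‖⁻¹) :=
    mul_le_mul_of_nonneg_right (hMv x hx2) (by positivity)
  have h6 : u x * (E * ‖x‖⁻¹) ≤ M * (E * ‖x‖⁻¹) :=
    mul_le_mul_of_nonneg_right (hMu x hx2) (by positivity)
  have h7 : |pohoRad a b p q a₁ a₂ u v x| ≤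
      P * (‖x‖ * (D * ‖x‖⁻¹ * (E * ‖x‖⁻¹)) + M' * (D * ‖x‖⁻¹) + M * (E * ‖x‖⁻¹)) +
      ‖x‖ * (2 * (C * ‖x‖⁻¹ ^ 2)) := by
    refine h3.trans ?_
    gcongr
  calc _ ≤ _ := mul_le_mul_of_nonneg_left h7 (by positivity)
    _ = _ := by field_simp

theorem norm_smul_sphere {t : ℝ} (ht : 0 ≤ t) (ω : sphere (0 : Euc N) 1) : ‖t • (ω : Euc N)‖ = t := by
  rw [norm_smul, norm_eq_of_mem_sphere, mul_one, Real.norm_of_nonneg ht]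

theorem setIntegral_polar (hN : 3 ≤ N) {F : Euc N → ℝ} {r : ℝ}
    (hF : IntegrableOn F (closedBall 0 r)) :
    IntegrableOn (fun t : ℝ => t ^ (N - 1) * ∫ ω, F (t • (ω : Euc N)) ∂(sph N)) (Ioc 0 r) ∧
    ∫ x in closedBall 0 r, F x =
      ∫ t in Ioc (0 : ℝ) r, t ^ (N - 1) * ∫ ω, F (t • (ω : Euc N)) ∂(sph N) := by
  obtain ⟨h1, h2⟩ := integral_polar hN ((integrable_indicator_iff measurableSet_closedBall).2 hF)
  have e1 : ∀ t ∈ Ioc 0 r, t ^ (N - 1) *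
      ∫ ω, (closedBall 0 r).indicator F (t • (ω : Euc N)) ∂(sph N) =
      t ^ (N - 1) * ∫ ω, F (t • (ω : Euc N)) ∂(sph N) := fun t ht => by
    congr 1
    refine integral_congr_ae (Eventually.of_forall fun ω => indicator_of_mem ?_ F)
    rw [mem_closedBall_zero_iff, norm_smul_sphere ht.1.le]
    exact ht.2
  refine ⟨(h1.mono_set Ioc_subset_Ioi_self).congr_fun e1 measurableSet_Ioc, ?_⟩
  rw [← integral_indicator measurableSet_closedBall, h2,
    ← setIntegral_congr_fun measurableSet_Ioc e1]
  refine setIntegral_eq_of_subset_of_forall_sdiff_eq_zero measurableSet_Ioi Ioc_subset_Ioi_self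
    fun t ht => ?_
  have : ∀ ω : sphere (0 : Euc N) 1, (closedBall 0 r).indicator F (t • (ω : Euc N)) = 0 := fun ω =>
    indicator_of_notMem (fun h' => ht.2 ⟨ht.1, by
      rwa [mem_closedBall_zero_iff, norm_smul_sphere (le_of_lt ht.1)] at h'⟩) F
  simp [this]

theorem IsSol.ae_pohozaev (hN : 3 ≤ N) {a b p q : ℝ} {u v : Euc N → ℝ} (h : IsSol a b p q u v)
    (ha : -2 < a) (hb : -2 < b) (hp : 0 < p) (hq : 0 < q)
    {a₁ a₂ c₁ c₂ : ℝ} (ha₁ : a₁ + a₂ = N - 2) (hc₁ : c₁ = (N + a) / (p + 1) - a₁)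
    (hc₂ : c₂ = (N + b) / (q + 1) - a₂) :
    ∀ᵐ r, r ∈ Ioo (1 : ℝ) 2 → r ^ (N - 1) *
      ∫ ω, pohoRad a b p q a₁ a₂ u v (r • (ω : Euc N)) ∂(sph N) =
      ∫ x in closedBall 0 r, pohoDiv a b p q c₁ c₂ u v x := by
  have hP := h.integrableOn_pohoDiv hN ha hb hp hq c₁ c₂
  have hR := setIntegral_polar hN (h.integrableOn_pohoRad hN ha hb hp hq a₁ a₂)
  have key := ae_eq_integral_of_forall_deriv
    (A := fun r => r ^ (N - 1) * ∫ ω, pohoRad a b p q a₁ a₂ u v (r • (ω : Euc N)) ∂(sph N))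
    (p := fun r => r ^ (N - 1) * ∫ ω, pohoDiv a b p q c₁ c₂ u v (r • (ω : Euc N)) ∂(sph N))
    (hR.1.congr_fun (fun t ht => ?_) measurableSet_Ioc) (setIntegral_polar hN hP).1
    fun g hg hg0 hgc => ?_
  · filter_upwards [key] with r hr hr'
    rw [hr hr', (setIntegral_polar hN (hP.mono_set (closedBall_subset_closedBall hr'.2.le))).2]
  · simp only [norm_smul_sphere ht.1.le, integral_const_mul]
    ring
  · obtain ⟨i1, i2, e⟩ := h.integral_deriv_mul_pohoRad hp hq ha₁ hc₁ hc₂ hg hg0 hgc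
    rw [(integral_polar hN i1).2, (integral_polar hN i2).2] at e
    convert e using 1
    · refine setIntegral_congr_fun measurableSet_Ioi fun t ht => ?_
      simp only [norm_smul_sphere (le_of_lt ht), integral_const_mul]
      ring
    · congr 1
      refine setIntegral_congr_fun measurableSet_Ioi fun t ht => ?_
      simp only [norm_smul_sphere (le_of_lt ht), integral_const_mul]
      ring

theorem exists_exponents {p q : ℝ} (hN : 3 ≤ N) (hq : 0 < q) (hqp : q ≤ p) (hpq : 1 < p * q)
    (halpha : 2 * (p + 1) / (p * q - 1) > (N : ℝ) - 3) :
    ∃ s σ ε : ℝ, 0 < s ∧ s * (p * (q + 1)) < 1 ∧ s < 1 / (p + 1) ∧ s + 1 / (q + 1) ≤ 1 ∧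
      s + σ ≤ 1 ∧ 1 / (q + 1) ≤ σ ∧ 0 < σ ∧ σ < 1 ∧ 0 < ε ∧ ε < 1 ∧
      (N : ℝ) - 3 + ε < (N - 1) * (s + 1 / (q + 1)) ∧
      (N : ℝ) - 2 + ε < (N - 1) * (s + σ) ∧
      (N : ℝ) - 2 + ε < (N - 1) * (1 / (q + 1) + (1 - σ)) := by
  have hp : 0 < p := hq.trans_le hqp
  have hN' : (3 : ℝ) ≤ N := by exact_mod_cast hN
  have hn : (0 : ℝ) < N - 1 := by linarith
  have hpq' : 0 < p * q - 1 := by linarith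
  have hQ : 0 < 1 / (q + 1) := by positivity
  have hU : 0 < 1 / (p * (q + 1)) := by positivity
  have hUeq : 1 / (p * (q + 1)) + 1 / (q + 1) = (p + 1) / (p * (q + 1)) := by
    field_simp
    ring
  have hU1 : 1 / (p * (q + 1)) + 1 / (q + 1) < 1 := by
    rw [hUeq, div_lt_one (by positivity)]
    nlinarith
  have hcrit : ((N : ℝ) - 3) / (N - 1) - 1 / (q + 1) < 1 / (p * (q + 1)) := by
    have : ((N : ℝ) - 3) / (N - 1) < (p + 1) / (p * (q + 1)) := by
      rw [gt_iff_lt, lt_div_iff₀ hpq'] at halpha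
      rw [div_lt_div_iff₀ hn (by positivity)]
      nlinarith
    linarith
  obtain ⟨s, hs1, hs2⟩ := exists_between (max_lt hU hcrit)
  have hs0 : 0 < s := (le_max_left _ _).trans_lt hs1
  have hs3 : ((N : ℝ) - 3) / (N - 1) - 1 / (q + 1) < s := (le_max_right _ _).trans_lt hs1
  have e1 : ((N : ℝ) - 2) / (N - 1) = 1 - 1 / (N - 1) := by field_simp; ring
  have e2 : ((N : ℝ) - 3) / (N - 1) = 1 - 2 * (1 / (N - 1)) := by field_simp; ring
  have hn1 : (0 : ℝ) < 1 / (N - 1) := by positivity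
  have hmax : max (((N : ℝ) - 2) / (N - 1) - s) (1 / (q + 1)) <
      min (1 - s) (1 / ((N : ℝ) - 1) + 1 / (q + 1)) := by
    rw [max_lt_iff, lt_min_iff, lt_min_iff, e1]
    rw [e2] at hs3
    refine ⟨⟨by linarith, by linarith⟩, by linarith, by linarith⟩
  obtain ⟨σ, hσ1, hσ2⟩ := exists_between hmax
  rw [max_lt_iff] at hσ1
  rw [lt_min_iff] at hσ2
  have f1 : (N : ℝ) - 3 < (N - 1) * (s + 1 / (q + 1)) := by
    rw [mul_comm, ← div_lt_iff₀ hn]; linarith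
  have f2 : (N : ℝ) - 2 < (N - 1) * (s + σ) := by
    rw [mul_comm, ← div_lt_iff₀ hn]; linarith
  have f3 : (N : ℝ) - 2 < (N - 1) * (1 / (q + 1) + (1 - σ)) := by
    rw [mul_comm, ← div_lt_iff₀ hn, e1]; linarith
  obtain ⟨ε, hε0, hε⟩ := exists_between (show (0 : ℝ) < min 1 (min
    ((N - 1) * (s + 1 / (q + 1)) - (N - 3)) (min ((N - 1) * (s + σ) - (N - 2))
      ((N - 1) * (1 / (q + 1) + (1 - σ)) - (N - 2)))) by
    refine lt_min one_pos (lt_min ?_ (lt_min ?_ ?_)) <;> linarith)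
  rw [lt_min_iff, lt_min_iff, lt_min_iff] at hε
  refine ⟨s, σ, ε, hs0, ?_, ?_, by linarith, by linarith, hσ1.2.le, by linarith, by linarith,
    hε0, hε.1, by linarith, by linarith, by linarith⟩
  · rwa [lt_div_iff₀ (by positivity)] at hs2
  · refine hs2.trans ?_
    apply one_div_lt_one_div_of_lt (by positivity)
    nlinarith

/-- A superlinear self-improving estimate on an increasing family of radii can be iterated. -/
theorem exists_iteration_bound {C m b₀ : ℝ} (hC : 0 < C) (hb0 : 0 ≤ b₀) (hb1 : b₀ < 1) :
    ∃ B : ℝ, ∀ (Φ : ℝ → ℝ) (M : ℝ), (∀ r ∈ Icc (1 : ℝ) 2, 1 ≤ Φ r) →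
      (∀ r ∈ Icc (1 : ℝ) 2, Φ r ≤ M) →
      (∀ r s, 1 ≤ r → r < s → s ≤ 2 → Φ r ≤ C * (s - r)⁻¹ ^ m * Φ s ^ b₀) → Φ 1 ≤ B := by
  have hb' : 0 < 1 - b₀ := by linarith
  set d := Real.log C + m * Real.log 2 with hd
  set e := m * Real.log 2 with he
  set β := e / (1 - b₀) with hβ
  set α := (d + b₀ * β) / (1 - b₀) with hα
  refine ⟨Real.exp α, fun Φ M h1 hM hstep => ?_⟩
  set r : ℕ → ℝ := fun i => 2 - (2⁻¹ : ℝ) ^ i with hr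
  have hpow0 : ∀ i : ℕ, (0 : ℝ) < 2⁻¹ ^ i := fun i => by positivity
  have hpow1 : ∀ i : ℕ, (2⁻¹ : ℝ) ^ i ≤ 1 := fun i => pow_le_one₀ (by norm_num) (by norm_num)
  have hmem : ∀ i, r i ∈ Icc (1 : ℝ) 2 := fun i =>
    ⟨by simp only [hr]; linarith [hpow1 i], by simp only [hr]; linarith [hpow0 i]⟩
  have hL : ∀ i : ℕ, Real.log (Φ (r i)) ≤ d + e * i + b₀ * Real.log (Φ (r (i + 1))) := by
    intro i
    have hdiff : r (i + 1) - r i = 2⁻¹ ^ (i + 1) := by simp only [hr]; ring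
    have hlt : r i < r (i + 1) := by rw [← sub_pos, hdiff]; exact hpow0 _
    have hs := hstep _ _ (hmem i).1 hlt (hmem (i + 1)).2
    have hp1 : 0 < Φ (r i) := one_pos.trans_le (h1 _ (hmem i))
    have hp2 : 0 < Φ (r (i + 1)) := one_pos.trans_le (h1 _ (hmem _))
    have := Real.log_le_log hp1 hs
    rw [hdiff, ← inv_pow, inv_inv, Real.log_mul (by positivity) (by positivity),
      Real.log_mul (by positivity) (by positivity), Real.log_rpow hp2,
      Real.log_rpow (by positivity), Real.log_pow] at this
    push_cast at this
    linarith
  have hα' : α = d + b₀ * (α + β) := by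
    simp only [hα]; field_simp; ring
  have hβ' : β = e + b₀ * β := by
    simp only [hβ]; field_simp; ring
  have hG : ∀ i : ℕ, Real.log (Φ (r 0)) - α ≤ b₀ ^ i * (Real.log (Φ (r i)) - (α + β * i)) := by
    intro i
    induction i with
    | zero => simp
    | succ i ih =>
      refine ih.trans ?_
      rw [pow_succ, mul_assoc]
      refine mul_le_mul_of_nonneg_left ?_ (by positivity)
      have := hL i
      push_cast
      have e3 : β * i = e * i + b₀ * (β * i) := by
        calc β * i = (e + b₀ * β) * i := by rw [← hβ']
          _ = _ := by ring
      linarith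
  have hlim : Tendsto (fun i : ℕ => b₀ ^ i * (Real.log M + |α| + |β| * i)) atTop (nhds 0) := by
    have t1 := (tendsto_pow_atTop_nhds_zero_of_lt_one hb0 hb1).mul_const (Real.log M + |α|)
    have t2 := (tendsto_self_mul_const_pow_of_lt_one hb0 hb1).const_mul |β|
    have := t1.add t2
    simp only [zero_mul, mul_zero, add_zero] at this
    refine this.congr fun i => ?_
    ring
  have hG0 : Real.log (Φ (r 0)) - α ≤ 0 := by
    refine ge_of_tendsto' hlim fun i => (hG i).trans ?_
    refine mul_le_mul_of_nonneg_left ?_ (by positivity)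
    have hlog : Real.log (Φ (r i)) ≤ Real.log M :=
      Real.log_le_log (one_pos.trans_le (h1 _ (hmem i))) (hM _ (hmem i))
    have b1 : -(β * i) ≤ |β| * i := by
      rw [← neg_mul]
      exact mul_le_mul_of_nonneg_right (neg_le_abs β) (Nat.cast_nonneg i)
    linarith [neg_le_abs α]
  have h0 : r 0 = 1 := by simp only [hr]; norm_num
  rw [h0] at hG0
  have hp1 : 0 < Φ 1 := one_pos.trans_le (h1 1 (by norm_num))
  rw [← Real.log_le_iff_le_exp hp1]
  linarith

theorem measurable_shellPot (c e r : ℝ) {f : Euc N → ENNReal} (hf : Measurable f) :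
    Measurable (fun ω : sphere (0 : Euc N) 1 => shellPot c e r f ω) := by
  unfold shellPot
  refine Measurable.lintegral_prod_right' (f := fun z : sphere (0 : Euc N) 1 × Euc N =>
    ‖‖z.2‖ - r‖ₑ ^ (-e) * (‖r • (z.1 : Euc N) - z.2‖ₑ ^ (-c) * f z.2)) ?_
  have h1 : Measurable fun z : sphere (0 : Euc N) 1 × Euc N => ‖r • (z.1 : Euc N) - z.2‖ₑ :=
    (by fun_prop : Continuous fun z : sphere (0 : Euc N) 1 × Euc N =>
      r • (z.1 : Euc N) - z.2).measurable.enorm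
  fun_prop

theorem exists_sph_norm_le {c e s m : ℝ} (hN : 3 ≤ N) (hs : 0 < s) (hm : 1 ≤ m)
    (hsm : s + 1 / m ≤ 1) (hc : 0 ≤ c) (hcN : c < (N - 1) * (s + 1 / m)) (he : 0 ≤ e)
    (he1 : e < 1) :
    ∃ C : ENNReal, C ≠ ⊤ ∧ ∀ (r : ℝ) (f : Euc N → ENNReal) (Δ : ENNReal), 1 ≤ r → Measurable f →
      (∫⁻ ω, (Δ + shellPot c e r f ω) ^ m ∂sph N) ^ (1 / m) ≤
        C * (Δ + (∫⁻ y in shell N, ‖‖y‖ - r‖ₑ ^ (-e) * f y ^ (1 / (1 - s))) ^ (1 - s)) := by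
  have hm0 : 0 < m := by linarith
  have hm1 : 0 ≤ 1 / m := by positivity
  obtain ⟨C, hC, h⟩ := exists_lintegral_shellPot_le (N := N) (e := e) hN hs hm0 hsm hc hcN he he1
  refine ⟨sph N univ ^ (1 / m) + C ^ (1 / m), ?_, fun r f Δ hr hf => ?_⟩
  · exact ENNReal.add_ne_top.2 ⟨ENNReal.rpow_ne_top_of_nonneg hm1 (measure_ne_top _ _),
      ENNReal.rpow_ne_top_of_nonneg hm1 hC⟩
  refine (ENNReal.lintegral_Lp_add_le (f := fun _ => Δ) aemeasurable_const
    (measurable_shellPot c e r hf).aemeasurable hm).trans ?_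
  rw [lintegral_const, ENNReal.mul_rpow_of_nonneg _ _ hm1, ← ENNReal.rpow_mul,
    mul_one_div_cancel hm0.ne', ENNReal.rpow_one]
  have h2 := ENNReal.rpow_le_rpow (h r f hr hf) hm1
  rw [ENNReal.mul_rpow_of_nonneg _ _ hm1, ← ENNReal.rpow_mul, mul_assoc,
    mul_one_div_cancel hm0.ne', mul_one] at h2
  refine (add_le_add le_rfl h2).trans ?_
  rw [mul_add, mul_comm Δ]
  gcongr
  · exact le_self_add
  · exact le_add_self

theorem rpow_neg_add_le_mul {t d : ENNReal} (htd : t ≤ d) (hd : d ≠ ⊤) {e c : ℝ} (he : 0 < e)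
    (hc : 0 < c) : d ^ (-(e + c)) ≤ t ^ (-e) * d ^ (-c) := by
  have hte : d ^ (-e) ≤ t ^ (-e) := by
    rw [ENNReal.rpow_neg, ENNReal.rpow_neg]
    exact ENNReal.inv_le_inv.2 (ENNReal.rpow_le_rpow htd he.le)
  refine le_trans ?_ (mul_le_mul_left hte _)
  rcases eq_or_ne d 0 with rfl | h0
  · rw [ENNReal.zero_rpow_of_neg (by linarith), ENNReal.zero_rpow_of_neg (by linarith),
      ENNReal.zero_rpow_of_neg (by linarith), ENNReal.top_mul_top]
  · rw [← ENNReal.rpow_add _ _ h0 hd, neg_add]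

/-- The nonlinear source `|y|^a v(y)^p` cut off to the half-open shell `1/2 ≤ |y| < R`. -/
noncomputable def shellSource (a p R : ℝ) (v : Euc N → ℝ) : Euc N → ENNReal :=
  indicator {y | 1 / 2 ≤ ‖y‖ ∧ ‖y‖ < R} fun y => ENNReal.ofReal (‖y‖ ^ a * v y ^ p)

theorem measurableSet_halfShell (R : ℝ) : MeasurableSet {y : Euc N | 1 / 2 ≤ ‖y‖ ∧ ‖y‖ < R} :=
  (measurableSet_le measurable_const measurable_norm).inter
    (measurableSet_lt measurable_norm measurable_const)

theorem measurable_shellSource (a p R : ℝ) {v : Euc N → ℝ} (hv : Measurable v) :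
    Measurable (shellSource a p R v) := by
  refine Measurable.indicator ?_ (measurableSet_halfShell R)
  exact ((measurable_norm.pow_const a).mul (hv.pow_const p)).ennreal_ofReal

theorem exists_potential_bound (hN : 3 ≤ N) {a b p q ε : ℝ} (hp : 0 < p) (hq : 0 < q)
    (hpq : 1 < p * q) (hε : 0 < ε) (hε1 : ε < 1) :
    ∃ C : ENNReal, C ≠ ⊤ ∧ ∀ u v : Euc N → ℝ, IsSol a b p q u v → ∀ R δ r : ℝ,
      0 < δ → δ ≤ 1 / 2 → 1 < r → r + δ < R → R ≤ 2 → ∀ ω : sphere (0 : Euc N) 1,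
      ENNReal.ofReal (u (r • (ω : Euc N))) ≤ C * (ENNReal.ofReal (δ⁻¹ ^ (N + 1)) +
        shellPot ((N : ℝ) - 3 + ε) (1 - ε) r (shellSource a p R v) ω) ∧
      ENNReal.ofReal (u (r • (ω : Euc N))) ≤ C * (ENNReal.ofReal (δ⁻¹ ^ (N + 1)) +
        shellPot ((N : ℝ) - 2 + ε) (1 - ε) r (shellSource a p R v) ω) ∧
      ∀ i, ENNReal.ofReal |pd i u (r • (ω : Euc N))| ≤ C * (ENNReal.ofReal (δ⁻¹ ^ (N + 1)) +
        shellPot ((N : ℝ) - 2 + ε) (1 - ε) r (shellSource a p R v) ω) := by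
  have hN' : (3 : ℝ) ≤ N := by exact_mod_cast hN
  obtain ⟨C₀, hC₀, hup⟩ := exists_upper hN
  obtain ⟨C₁, hC₁, hgr⟩ := exists_grad_upper hN
  obtain ⟨E, hE, hen⟩ := exists_shell_energy (N := N) (a := a) (b := b) hN hp hq hpq
  refine ⟨ENNReal.ofReal (max C₀ C₁) * ENNReal.ofReal (E + 1),
    ENNReal.mul_ne_top ENNReal.ofReal_ne_top ENNReal.ofReal_ne_top,
    fun u v h R δ r hδ hδ2 hr hrR hR ω => ?_⟩
  set x : Euc N := r • (ω : Euc N) with hx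
  have hxr : ‖x‖ = r := norm_smul_sphere (by linarith) ω
  have hball : ∀ y ∈ closedBall x δ, r - δ ≤ ‖y‖ ∧ ‖y‖ ≤ r + δ := by
    intro y hy
    rw [mem_closedBall, dist_eq_norm] at hy
    have h1 := norm_sub_norm_le x y
    have h2 := norm_sub_norm_le y x
    rw [norm_sub_rev] at h1
    constructor <;> linarith
  have hsub : closedBall x δ ⊆ shell N := fun y hy =>
    ⟨by linarith [(hball y hy).1], by linarith [(hball y hy).2]⟩
  have hδ1 : 1 ≤ δ⁻¹ := (one_le_inv₀ hδ).2 (by linarith)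
  have hint : 0 ≤ ∫ y in closedBall x δ, u y :=
    setIntegral_nonneg measurableSet_closedBall fun y _ => (h.left.pos y).le
  have hintE : ENNReal.ofReal (∫ y in closedBall x δ, u y) ≤ ENNReal.ofReal E := by
    rw [ofReal_integral_eq_lintegral_ofReal
      (h.left.continuous.continuousOn.integrableOn_compact (isCompact_closedBall x δ))
      (ae_of_all _ fun y => (h.left.pos y).le)]
    refine (lintegral_mono fun y => ?_).trans ((lintegral_mono_set hsub).trans (hen u v h).1)
    exact (Real.enorm_of_nonneg (h.left.pos y).le).ge
  have havg : ∀ k : ℕ, k ≤ N + 1 → ENNReal.ofReal (δ⁻¹ ^ k * ∫ y in closedBall x δ, u y) ≤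
      ENNReal.ofReal (E + 1) * ENNReal.ofReal (δ⁻¹ ^ (N + 1)) := by
    intro k hk
    rw [ENNReal.ofReal_mul (by positivity), mul_comm]
    refine mul_le_mul' (hintE.trans (ENNReal.ofReal_le_ofReal (by linarith)))
      (ENNReal.ofReal_le_ofReal (pow_le_pow_right₀ hδ1 hk))
  have hE1 : 1 ≤ ENNReal.ofReal (E + 1) := by
    rw [ENNReal.one_le_ofReal]; linarith
  have hsrc : ∀ y ∈ closedBall x δ, ‖lap u y‖ₑ = shellSource a p R v y := by
    intro y hy
    obtain ⟨h1, h2⟩ := hball y hy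
    have hy0 : y ≠ 0 := by
      rw [← norm_pos_iff]; linarith
    have hmem : y ∈ {y : Euc N | 1 / 2 ≤ ‖y‖ ∧ ‖y‖ < R} := ⟨by linarith, by linarith⟩
    rw [shellSource, indicator_of_mem hmem, ← h.eq_left y hy0, ← enorm_neg,
      Real.enorm_of_nonneg]
    rw [h.eq_left y hy0]
    have := (h.right.pos y).le
    positivity
  have hpot : ∀ c κ : ℝ, 0 < c → κ ≤ 1 - ε + c →
      ∫⁻ y in closedBall x δ, ‖lap u y‖ₑ * ‖y - x‖ₑ ^ (-κ) ≤
      ENNReal.ofReal (E + 1) * shellPot c (1 - ε) r (shellSource a p R v) ω := by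
    intro c κ hc hκ
    refine le_trans ?_ (le_mul_of_one_le_left zero_le hE1)
    unfold shellPot
    refine le_trans (setLIntegral_mono' measurableSet_closedBall fun y hy => ?_)
      (lintegral_mono_set hsub)
    rw [hsrc y hy, mul_comm, ← mul_assoc]
    refine mul_le_mul_left ?_ _
    have hle : ‖‖y‖ - r‖ₑ ≤ ‖r • (ω : Euc N) - y‖ₑ := by
      have := abs_norm_sub_norm_le y x
      rw [hxr] at this
      rwa [enorm_sub_rev _ y, enorm_le_iff_norm_le, Real.norm_eq_abs]
    have hle1 : ‖r • (ω : Euc N) - y‖ₑ ≤ 1 := by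
      rw [mem_closedBall, dist_eq_norm] at hy
      rw [enorm_sub_rev, ← ofReal_norm, ENNReal.ofReal_le_one]
      linarith
    rw [enorm_sub_rev]
    refine le_trans ?_ (rpow_neg_add_le_mul hle enorm_ne_top (by linarith) hc)
    rw [ENNReal.rpow_neg, ENNReal.rpow_neg]
    exact ENNReal.inv_le_inv.2 (ENNReal.rpow_le_rpow_of_exponent_ge hle1 hκ)
  have hm0 := ENNReal.ofReal_le_ofReal (le_max_left C₀ C₁)
  have hm1 := ENNReal.ofReal_le_ofReal (le_max_right C₀ C₁)
  have hδx : δ < ‖x‖ := by linarith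
  refine ⟨?_, ?_, fun i => ?_⟩
  · refine (hup u h.left x δ hδ hδx).trans ?_
    rw [mul_assoc, mul_add (ENNReal.ofReal (E + 1))]
    exact mul_le_mul' hm0 (add_le_add (havg N (by lia)) (hpot _ _ (by linarith) (by linarith)))
  · refine (hup u h.left x δ hδ hδx).trans ?_
    rw [mul_assoc, mul_add (ENNReal.ofReal (E + 1))]
    exact mul_le_mul' hm0 (add_le_add (havg N (by lia)) (hpot _ _ (by linarith) (by linarith)))
  · refine (hgr u h.left x δ i hδ hδx).trans ?_
    rw [mul_assoc, mul_add (ENNReal.ofReal (E + 1))]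
    exact mul_le_mul' hm1 (add_le_add (havg _ le_rfl) (hpot _ _ (by linarith) (by linarith)))

theorem exists_abs_energy_le {a b p q : ℝ} (hq : 0 < q) (hqp : q ≤ p) (hpq : 1 < p * q) :
    ∃ C, 0 < C ∧ ∀ u v : Euc N → ℝ, IsSol a b p q u v → ∀ x, 1 ≤ ‖x‖ → ‖x‖ ≤ 2 →
      |energy a b p q u v x| ≤ C * (1 + u x ^ (q + 1)) := by
  have hp : 0 < p := hq.trans_le hqp
  obtain ⟨C, hC, hcomp⟩ := exists_comparison (N := N) (a := a) (b := b) hq hqp hpq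
  obtain ⟨_, A, _, hA, hAx⟩ := exists_rpow_bounds (t := 2) a one_pos
  obtain ⟨_, B, _, hB, hBx⟩ := exists_rpow_bounds (t := 2) b one_pos
  refine ⟨A * (2 * C) ^ (p + 1) + B, by positivity, fun u v h x h1 h2 => ?_⟩
  have hu := h.left.pos x
  have hv := h.right.pos x
  have huq : 0 < u x ^ (q + 1) := by positivity
  have hvp : v x ^ (p + 1) ≤ (2 * C) ^ (p + 1) * (1 + u x ^ (q + 1)) := by
    set t := u x ^ ((q + 1) / (p + 1)) with ht
    have ht0 : 0 < t := by positivity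
    have hm : v x ≤ 2 * C * max t 1 := by
      have := hcomp u v h x h1 h2
      nlinarith [le_max_left t 1, le_max_right t 1]
    refine (Real.rpow_le_rpow hv.le hm (by linarith)).trans ?_
    rw [Real.mul_rpow (by positivity) (by positivity)]
    refine mul_le_mul_of_nonneg_left ?_ (by positivity)
    rcases le_total t 1 with h' | h'
    · rw [max_eq_right h', Real.one_rpow]; linarith
    · rw [max_eq_left h', ht, ← Real.rpow_mul hu.le, div_mul_cancel₀ _ (by positivity)]; linarith
  have ha := (hAx _ h1 h2).2
  have hb := (hBx _ h1 h2).2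
  have hx : 0 < ‖x‖ := by linarith
  have hav : 0 < ‖x‖ ^ a := by positivity
  have hbv : 0 < ‖x‖ ^ b := by positivity
  have hvp0 : 0 < v x ^ (p + 1) := by positivity
  unfold energy
  rw [abs_of_nonneg (by positivity)]
  have i1 : ‖x‖ ^ a * v x ^ (p + 1) / (p + 1) ≤ A * ((2 * C) ^ (p + 1) * (1 + u x ^ (q + 1))) := by
    refine (div_le_self (by positivity) (by linarith)).trans ?_
    gcongr
  have i2 : ‖x‖ ^ b * u x ^ (q + 1) / (q + 1) ≤ B * (1 + u x ^ (q + 1)) := by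
    refine (div_le_self (by positivity) (by linarith)).trans ?_
    gcongr
    linarith
  linarith

theorem exists_abs_pohoRad_le_of_mem {a b p q : ℝ} (hq : 0 < q) (hqp : q ≤ p) (hpq : 1 < p * q)
    (a₁ a₂ : ℝ) :
    ∃ C, 0 < C ∧ ∀ u v : Euc N → ℝ, IsSol a b p q u v → ∀ x, 1 ≤ ‖x‖ → ‖x‖ ≤ 2 →
      |pohoRad a b p q a₁ a₂ u v x| ≤ C * ((u x + ∑ i, |pd i u x|) * (v x + ∑ i, |pd i v x|) + 1 +
        u x ^ (q + 1)) := by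
  obtain ⟨C, hC, hrad⟩ := exists_abs_pohoRad_le N a₁ a₂
  obtain ⟨D, hD, hen⟩ := exists_abs_energy_le (N := N) (a := a) (b := b) hq hqp hpq
  refine ⟨4 * C + 2 * D, by positivity, fun u v h x h1 h2 => ?_⟩
  have hu := h.left.pos x
  have hv := h.right.pos x
  have hsum : ∀ w : Euc N → ℝ, 0 ≤ ∑ i, |pd i w x| := fun w =>
    Finset.sum_nonneg fun i _ => abs_nonneg _
  have hi : ∀ (w : Euc N → ℝ) (i : Fin N), 0 < w x → |pd i w x| ≤ w x + ∑ i, |pd i w x| := by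
    intro w i hw
    have := Finset.single_le_sum (f := fun i => |pd i w x|) (fun i _ => abs_nonneg _)
      (Finset.mem_univ i)
    linarith
  set K := u x + ∑ i, |pd i u x| with hK
  set K' := v x + ∑ i, |pd i v x| with hK'
  have hKu : u x ≤ K := by linarith [hsum u]
  have hKv : v x ≤ K' := by linarith [hsum v]
  have hK0 : 0 < K := by linarith
  have hK0' : 0 < K' := by linarith
  refine (hrad a b p q u v x K K' (by rw [← norm_pos_iff]; linarith) hK0.le hK0'.le
    (fun i => hi u i hu) fun i => hi v i hv).trans ?_
  rw [abs_of_pos hu, abs_of_pos hv]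
  have e1 : ‖x‖ * (K * K') + v x * K + u x * K' ≤ 4 * (K * K') := by
    have i1 : ‖x‖ * (K * K') ≤ 2 * (K * K') := by gcongr
    have i2 : v x * K ≤ K' * K := by gcongr
    have i3 : u x * K' ≤ K * K' := by gcongr
    linarith
  have e2 : ‖x‖ * |energy a b p q u v x| ≤ 2 * (D * (1 + u x ^ (q + 1))) :=
    mul_le_mul h2 (hen u v h x h1 h2) (abs_nonneg _) (by norm_num)
  have huq : 0 < u x ^ (q + 1) := by positivity
  have hKK : 0 < K * K' := by positivity
  nlinarith [mul_le_mul_of_nonneg_left e1 hC.le, mul_pos hC huq, mul_pos hD hKK]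

theorem mul_add_one_add_le (P Q X Y : ENNReal) : P * X + 1 + Q * Y ≤ (P + 1 + Q) * (X + 1 + Y) := by
  have j1 : P ≤ P + 1 + Q := by rw [add_assoc]; exact le_self_add
  have j2 : 1 ≤ P + 1 + Q := le_add_right le_add_self
  rw [mul_add, mul_add, mul_one]
  gcongr
  exact le_add_self

theorem exists_pohoRad_potential_bound (hN : 3 ≤ N) {a b p q ε : ℝ} (hq : 0 < q) (hqp : q ≤ p)
    (hpq : 1 < p * q) (hε : 0 < ε) (hε1 : ε < 1) (a₁ a₂ : ℝ) :
    ∃ C : ENNReal, C ≠ ⊤ ∧ ∀ u v : Euc N → ℝ, IsSol a b p q u v → ∀ R δ r : ℝ,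
      0 < δ → δ ≤ 1 / 2 → 1 < r → r + δ < R → R ≤ 2 → ∀ ω : sphere (0 : Euc N) 1,
      ENNReal.ofReal |pohoRad a b p q a₁ a₂ u v (r • (ω : Euc N))| ≤ C *
        ((ENNReal.ofReal (δ⁻¹ ^ (N + 1)) +
            shellPot ((N : ℝ) - 2 + ε) (1 - ε) r (shellSource a p R v) ω) *
          (ENNReal.ofReal (δ⁻¹ ^ (N + 1)) +
            shellPot ((N : ℝ) - 2 + ε) (1 - ε) r (shellSource b q R u) ω) + 1 +
          (ENNReal.ofReal (δ⁻¹ ^ (N + 1)) +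
            shellPot ((N : ℝ) - 3 + ε) (1 - ε) r (shellSource a p R v) ω) ^ (q + 1)) := by
  have hp : 0 < p := hq.trans_le hqp
  obtain ⟨C, hC, hrad⟩ := exists_abs_pohoRad_le_of_mem (N := N) (a := a) (b := b) hq hqp hpq a₁ a₂
  obtain ⟨D, hD, hpot⟩ := exists_potential_bound (a := a) (b := b) hN hp hq hpq hε hε1
  obtain ⟨D', hD', hpot'⟩ := exists_potential_bound (a := b) (b := a) hN hq hp
    (by rwa [mul_comm]) hε hε1
  refine ⟨ENNReal.ofReal C * ((N + 1) * D * ((N + 1) * D') + 1 + D ^ (q + 1)), ?_,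
    fun u v h R δ r hδ hδ2 hr hrR hR ω => ?_⟩
  · have : D ^ (q + 1) ≠ ⊤ := ENNReal.rpow_ne_top_of_nonneg (by linarith) hD
    finiteness
  obtain ⟨f2, f1, f3⟩ := hpot u v h R δ r hδ hδ2 hr hrR hR ω
  obtain ⟨_, g1, g3⟩ := hpot' v u h.symm R δ r hδ hδ2 hr hrR hR ω
  set x : Euc N := r • (ω : Euc N) with hx
  have hxr : ‖x‖ = r := norm_smul_sphere (by linarith) ω
  set Δ := ENNReal.ofReal (δ⁻¹ ^ (N + 1))
  set S := Δ + shellPot ((N : ℝ) - 2 + ε) (1 - ε) r (shellSource a p R v) ω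
  set S' := Δ + shellPot ((N : ℝ) - 2 + ε) (1 - ε) r (shellSource b q R u) ω
  set T := Δ + shellPot ((N : ℝ) - 3 + ε) (1 - ε) r (shellSource a p R v) ω
  have hsum : ∀ (w : Euc N → ℝ) (B : ENNReal), 0 < w x → ENNReal.ofReal (w x) ≤ B →
      (∀ i, ENNReal.ofReal |pd i w x| ≤ B) →
      ENNReal.ofReal (w x + ∑ i, |pd i w x|) ≤ (N + 1) * B := by
    intro w B hw h1 h2
    rw [ENNReal.ofReal_add hw.le (Finset.sum_nonneg fun i _ => abs_nonneg _),
      ENNReal.ofReal_sum_of_nonneg fun i _ => abs_nonneg _]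
    refine (add_le_add h1 (Finset.sum_le_sum fun i _ => h2 i)).trans ?_
    rw [Finset.sum_const, Finset.card_univ, Fintype.card_fin, nsmul_eq_mul]
    exact le_of_eq (by ring)
  have hu := h.left.pos x
  have hv := h.right.pos x
  have hsn : ∀ w : Euc N → ℝ, 0 ≤ ∑ i, |pd i w x| := fun w =>
    Finset.sum_nonneg fun i _ => abs_nonneg _
  have hK : 0 ≤ u x + ∑ i, |pd i u x| := add_nonneg hu.le (hsn u)
  have hK' : 0 ≤ v x + ∑ i, |pd i v x| := add_nonneg hv.le (hsn v)
  have huq : 0 < u x ^ (q + 1) := by positivity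
  refine (ENNReal.ofReal_le_ofReal (hrad u v h x (by linarith) (by linarith))).trans ?_
  rw [ENNReal.ofReal_mul hC.le, mul_assoc, ENNReal.ofReal_add (by positivity) huq.le,
    ENNReal.ofReal_add (by positivity) zero_le_one, ENNReal.ofReal_mul hK, ENNReal.ofReal_one,
    ← ENNReal.ofReal_rpow_of_pos hu]
  refine mul_le_mul_right ?_ _
  have i1 := hsum u (D * S) hu f1 f3
  have i2 := hsum v (D' * S') hv g1 g3
  have i3 : ENNReal.ofReal (u x) ^ (q + 1) ≤ D ^ (q + 1) * T ^ (q + 1) := by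
    rw [← ENNReal.mul_rpow_of_nonneg _ _ (by linarith : 0 ≤ q + 1)]
    exact ENNReal.rpow_le_rpow f2 (by linarith)
  refine (add_le_add (add_le_add (mul_le_mul' i1 i2) le_rfl) i3).trans ?_
  set P := (N + 1 : ENNReal) * D * ((N + 1) * D') with hP
  have e : (N + 1 : ENNReal) * (D * S) * ((N + 1) * (D' * S')) = P * (S * S') := by
    rw [hP]; ring
  rw [e]
  exact mul_add_one_add_le _ _ _ _

/-- The integral of `f` over the shell against the weight `||y| - r|^{-e}`. -/
noncomputable def shellInt (e r : ℝ) (f : Euc N → ENNReal) : ENNReal :=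
  ∫⁻ y in shell N, ‖‖y‖ - r‖ₑ ^ (-e) * f y

theorem exists_lintegral_pohoRad_le (hN : 3 ≤ N) {a b p q s σ ε : ℝ} (hq : 0 < q) (hqp : q ≤ p)
    (hpq : 1 < p * q) (hε : 0 < ε) (hε1 : ε < 1) (hs : 0 < s) (hsq : s + 1 / (q + 1) ≤ 1)
    (hsσ : s + σ ≤ 1) (hqσ : 1 / (q + 1) ≤ σ) (hσ : 0 < σ)
    (h₁ : (N : ℝ) - 3 + ε < (N - 1) * (s + 1 / (q + 1)))
    (h₂ : (N : ℝ) - 2 + ε < (N - 1) * (s + σ))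
    (h₃ : (N : ℝ) - 2 + ε < (N - 1) * (1 / (q + 1) + (1 - σ))) (a₁ a₂ : ℝ) :
    ∃ C : ENNReal, C ≠ ⊤ ∧ ∀ u v : Euc N → ℝ, IsSol a b p q u v → ∀ R δ r : ℝ,
      0 < δ → δ ≤ 1 / 2 → 1 < r → r + δ < R → R ≤ 2 →
      ∫⁻ ω, ENNReal.ofReal |pohoRad a b p q a₁ a₂ u v (r • (ω : Euc N))| ∂sph N ≤ C *
        ((ENNReal.ofReal (δ⁻¹ ^ (N + 1)) +
            shellInt (1 - ε) r (fun y => shellSource a p R v y ^ (1 / (1 - s))) ^ (1 - s)) *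
          (ENNReal.ofReal (δ⁻¹ ^ (N + 1)) +
            shellInt (1 - ε) r (fun y => shellSource b q R u y ^ (1 / (1 - 1 / (q + 1)))) ^
              (1 - 1 / (q + 1))) + 1 +
          (ENNReal.ofReal (δ⁻¹ ^ (N + 1)) +
            shellInt (1 - ε) r (fun y => shellSource a p R v y ^ (1 / (1 - s))) ^ (1 - s)) ^
              (q + 1)) := by
  have hN' : (3 : ℝ) ≤ N := by exact_mod_cast hN
  have hq1 : 0 < q + 1 := by linarith
  have hσ' : 0 < 1 - σ := by linarith
  obtain ⟨C, hC, hrad⟩ := exists_pohoRad_potential_bound (a := a) (b := b) hN hq hqp hpq hε hε1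
    a₁ a₂
  obtain ⟨D₁, hD₁, k1⟩ := exists_sph_norm_le (N := N) (m := 1 / σ) (e := 1 - ε)
    (c := (N : ℝ) - 2 + ε) hN hs (by rw [le_div_iff₀ hσ]; linarith) (by rwa [one_div_one_div])
    (by linarith) (by rwa [one_div_one_div]) (by linarith) (by linarith)
  obtain ⟨D₂, hD₂, k2⟩ := exists_sph_norm_le (N := N) (m := 1 / (1 - σ)) (e := 1 - ε)
    (s := 1 / (q + 1)) (c := (N : ℝ) - 2 + ε) hN (by positivity)
    (by rw [le_div_iff₀ hσ']; linarith) (by rw [one_div_one_div]; linarith)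
    (by linarith) (by rwa [one_div_one_div]) (by linarith) (by linarith)
  obtain ⟨D₃, hD₃, k3⟩ := exists_sph_norm_le (N := N) (m := q + 1) (e := 1 - ε)
    (c := (N : ℝ) - 3 + ε) hN hs (by linarith) hsq (by linarith) h₁ (by linarith) (by linarith)
  refine ⟨C * ((D₁ * D₂ + 1 + D₃ ^ (q + 1)) * (1 + sph N univ)), ?_,
    fun u v h R δ r hδ hδ2 hr hrR hR => ?_⟩
  · have : D₃ ^ (q + 1) ≠ ⊤ := ENNReal.rpow_ne_top_of_nonneg hq1.le hD₃
    have : sph N univ ≠ ⊤ := measure_ne_top _ _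
    finiteness
  have hf : Measurable (shellSource a p R v) :=
    measurable_shellSource a p R h.right.continuous.measurable
  have hg : Measurable (shellSource b q R u) :=
    measurable_shellSource b q R h.left.continuous.measurable
  set Δ := ENNReal.ofReal (δ⁻¹ ^ (N + 1))
  have l1 := k1 r _ Δ hr.le hf
  have l2 := k2 r _ Δ hr.le hg
  have l3 := k3 r _ Δ hr.le hf
  set X := Δ + shellInt (1 - ε) r (fun y => shellSource a p R v y ^ (1 / (1 - s))) ^ (1 - s)
  set Y := Δ + shellInt (1 - ε) r (fun y => shellSource b q R u y ^ (1 / (1 - 1 / (q + 1)))) ^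
    (1 - 1 / (q + 1))
  set S := fun ω => Δ + shellPot ((N : ℝ) - 2 + ε) (1 - ε) r (shellSource a p R v) ω with hS
  set S' := fun ω => Δ + shellPot ((N : ℝ) - 2 + ε) (1 - ε) r (shellSource b q R u) ω with hS'
  set T := fun ω => Δ + shellPot ((N : ℝ) - 3 + ε) (1 - ε) r (shellSource a p R v) ω with hT
  have mS : Measurable S := measurable_const.add (measurable_shellPot _ _ _ hf)
  have mS' : Measurable S' := measurable_const.add (measurable_shellPot _ _ _ hg)
  have mT : Measurable T := measurable_const.add (measurable_shellPot _ _ _ hf)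
  change (∫⁻ ω, S ω ^ (1 / σ) ∂sph N) ^ (1 / (1 / σ)) ≤ D₁ * X at l1
  change (∫⁻ ω, S' ω ^ (1 / (1 - σ)) ∂sph N) ^ (1 / (1 / (1 - σ))) ≤ D₂ * Y at l2
  change (∫⁻ ω, T ω ^ (q + 1) ∂sph N) ^ (1 / (q + 1)) ≤ D₃ * X at l3
  refine (lintegral_mono fun ω => hrad u v h R δ r hδ hδ2 hr hrR hR ω).trans ?_
  change ∫⁻ ω, C * (S ω * S' ω + 1 + T ω ^ (q + 1)) ∂sph N ≤ _
  rw [lintegral_const_mul' _ _ hC, mul_assoc]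
  refine mul_le_mul_right ?_ _
  rw [lintegral_add_right _ (mT.pow_const _), lintegral_add_right _ measurable_const,
    lintegral_const, one_mul]
  have hconj : (1 / σ).HolderConjugate (1 / (1 - σ)) := by
    rw [Real.holderConjugate_iff]
    refine ⟨by rw [lt_div_iff₀ hσ]; linarith, by simp⟩
  have i1 : ∫⁻ ω, S ω * S' ω ∂sph N ≤ D₁ * D₂ * (X * Y) := by
    refine (ENNReal.lintegral_mul_le_Lp_mul_Lq _ hconj mS.aemeasurable mS'.aemeasurable).trans ?_
    refine (mul_le_mul' l1 l2).trans (le_of_eq ?_)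
    ring
  have i3 : ∫⁻ ω, T ω ^ (q + 1) ∂sph N ≤ D₃ ^ (q + 1) * X ^ (q + 1) := by
    have := ENNReal.rpow_le_rpow l3 hq1.le
    rwa [← ENNReal.rpow_mul, one_div_mul_cancel hq1.ne', ENNReal.rpow_one,
      ENNReal.mul_rpow_of_nonneg _ _ hq1.le] at this
  refine (add_le_add (add_le_add i1 le_rfl) i3).trans ?_
  set M := D₁ * D₂ + 1 + D₃ ^ (q + 1)
  set Z := X * Y + 1 + X ^ (q + 1)
  have j : D₁ * D₂ * (X * Y) + 1 + D₃ ^ (q + 1) * X ^ (q + 1) ≤ M * Z :=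
    mul_add_one_add_le _ _ _ _
  have j2 : 1 ≤ M * Z := le_trans (le_add_right le_add_self) j
  calc D₁ * D₂ * (X * Y) + sph N univ + D₃ ^ (q + 1) * X ^ (q + 1)
      ≤ (D₁ * D₂ * (X * Y) + 1 + D₃ ^ (q + 1) * X ^ (q + 1)) + sph N univ := by
        rw [add_right_comm]
        exact add_le_add (by rw [add_assoc, add_comm 1, ← add_assoc]; exact le_self_add) le_rfl
    _ ≤ M * Z + sph N univ * (M * Z) := add_le_add j (le_mul_of_one_le_right zero_le j2)
    _ = _ := by ring

theorem exists_lintegral_shellInt_le {e : ℝ} (he : 0 ≤ e) (he1 : e < 1) :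
    ∃ K : ENNReal, K ≠ ⊤ ∧ ∀ F : Euc N → ENNReal, Measurable F → ∀ s : Set ℝ,
      s ⊆ Icc (1 / 2) (5 / 2) →
      ∫⁻ r in s, shellInt e r F ≤ K * ∫⁻ y in shell N, F y := by
  obtain ⟨K, hK, h⟩ := exists_lintegral_abs_sub_le he he1
  refine ⟨K, hK, fun F hF s hs => ?_⟩
  unfold shellInt
  rw [lintegral_lintegral_swap (by unfold Function.uncurry; fun_prop),
    ← lintegral_const_mul _ hF]
  refine lintegral_mono fun y => ?_
  dsimp only
  rw [lintegral_mul_const _ (by fun_prop)]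
  refine mul_le_mul_left (le_trans ?_ (h ‖y‖)) _
  simp only [enorm_sub_rev ‖y‖]
  exact lintegral_mono_set hs

theorem measurable_shellInt (e : ℝ) {F : Euc N → ENNReal} (hF : Measurable F) :
    Measurable fun r => shellInt e r F := by
  unfold shellInt
  refine Measurable.lintegral_prod_right' (f := fun z : ℝ × Euc N =>
    ‖‖z.2‖ - z.1‖ₑ ^ (-e) * F z.2) ?_
  fun_prop

theorem exists_good_radius {e : ℝ} (he : 0 ≤ e) (he1 : e < 1) :
    ∃ K : ENNReal, K ≠ ⊤ ∧ ∀ F G : Euc N → ENNReal, Measurable F → Measurable G →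
      ∀ (A B : ENNReal) (R δ : ℝ) (P : ℝ → Prop), A ≠ 0 → A ≠ ⊤ → B ≠ 0 → B ≠ ⊤ →
      ∫⁻ y in shell N, F y ≤ A → ∫⁻ y in shell N, G y ≤ B → 1 ≤ R → 0 < δ → R + δ ≤ 2 →
      (∀ᵐ r, P r) → ∃ r ∈ Ioo R (R + δ), P r ∧
        shellInt e r F ≤ K * ENNReal.ofReal δ⁻¹ * A ∧ shellInt e r G ≤ K * ENNReal.ofReal δ⁻¹ * B := by
  obtain ⟨K, hK, h⟩ := exists_lintegral_shellInt_le (N := N) he he1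
  refine ⟨2 * K, by finiteness, fun F G hF hG A B R δ P hA hA' hB hB' hFA hGB hR hδ hRδ hP => ?_⟩
  set I := Ioo R (R + δ) with hI
  have hIs : I ⊆ Icc (1 / 2) (5 / 2) := fun r hr => ⟨by linarith [hr.1], by linarith [hr.2]⟩
  set H : ℝ → ENNReal := fun r => A⁻¹ * shellInt e r F + B⁻¹ * shellInt e r G with hH
  have hHm : Measurable H :=
    ((measurable_shellInt e hF).const_mul _).add ((measurable_shellInt e hG).const_mul _)
  have hHint : ∫⁻ r in I, H r ≤ 2 * K := by
    have aux : ∀ (F : Euc N → ENNReal) (A : ENNReal), Measurable F → A ≠ 0 → A ≠ ⊤ →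
        ∫⁻ y in shell N, F y ≤ A → ∫⁻ r in I, A⁻¹ * shellInt e r F ≤ K := by
      intro F A hF hA hA' hFA
      rw [lintegral_const_mul _ (measurable_shellInt e hF)]
      calc A⁻¹ * ∫⁻ r in I, shellInt e r F ≤ A⁻¹ * (K * A) := by
            gcongr
            exact (h F hF I hIs).trans (mul_le_mul_right hFA _)
        _ = K := by rw [mul_left_comm, ENNReal.inv_mul_cancel hA hA', mul_one]
    rw [lintegral_add_left ((measurable_shellInt e hF).const_mul _), two_mul]
    exact add_le_add (aux F A hF hA hA' hFA) (aux G B hG hB hB' hGB)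
  have hvol : volume I = ENNReal.ofReal δ := by
    rw [hI, Real.volume_Ioo, add_sub_cancel_left]
  have hμ : (volume.restrict I : Measure ℝ) ≠ 0 := by
    rw [Ne, Measure.restrict_eq_zero, hvol, ENNReal.ofReal_eq_zero]
    linarith
  have hnull : (volume.restrict I) {r | ¬ (r ∈ I ∧ P r)} = 0 := by
    have : ∀ᵐ r ∂volume.restrict I, r ∈ I ∧ P r := by
      filter_upwards [ae_restrict_mem measurableSet_Ioo, ae_restrict_of_ae hP] with r h1 h2
      exact ⟨h1, h2⟩
    exact this
  obtain ⟨r, hr, hle⟩ := exists_notMem_null_le_laverage hμ hHm.aemeasurable hnull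
  rw [mem_ofPred_eq, not_not] at hr
  have hHr : H r ≤ 2 * K * ENNReal.ofReal δ⁻¹ := by
    refine hle.trans ?_
    rw [setLAverage_eq, hvol, ENNReal.ofReal_inv_of_pos hδ, ENNReal.div_eq_inv_mul, mul_comm]
    gcongr
  have fin : ∀ A Z W : ENNReal, A ≠ 0 → A ≠ ⊤ → A⁻¹ * Z ≤ W → Z ≤ W * A := by
    intro A Z W hA hA' hZ
    calc Z = A * (A⁻¹ * Z) := by rw [← mul_assoc, ENNReal.mul_inv_cancel hA hA', one_mul]
      _ ≤ A * W := by gcongr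
      _ = _ := mul_comm _ _
  exact ⟨r, hr.1, hr.2, fin _ _ _ hA hA' (le_self_add.trans hHr),
    fin _ _ _ hB hB' (le_add_self.trans hHr)⟩

theorem exists_lintegral_shellSource_rpow_le (a : ℝ) {p : ℝ} (hp : 0 < p) :
    ∃ C : ENNReal, C ≠ ⊤ ∧ ∀ v : Euc N → ℝ, (∀ x, 0 < v x) → ∀ R ≤ (2 : ℝ),
      ∫⁻ y in shell N, shellSource a p R v y ^ ((p + 1) / p) ≤
        C * ∫⁻ y in closedBall 0 R, ENNReal.ofReal (‖y‖ ^ a * v y ^ (p + 1)) := by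
  obtain ⟨_, A, _, hA, hAx⟩ := exists_rpow_bounds (t := 2) (a / p) (by norm_num : (0 : ℝ) < 1 / 2)
  refine ⟨ENNReal.ofReal A, ENNReal.ofReal_ne_top, fun v hv R hR => ?_⟩
  have hk : 0 < (p + 1) / p := by positivity
  set S := {y : Euc N | 1 / 2 ≤ ‖y‖ ∧ ‖y‖ < R} with hS
  have hSm : MeasurableSet S := measurableSet_halfShell R
  have hSb : S ⊆ closedBall 0 R := fun y hy => mem_closedBall_zero_iff.2 hy.2.le
  have e : (fun y => shellSource a p R v y ^ ((p + 1) / p)) =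
      S.indicator fun y => ENNReal.ofReal (‖y‖ ^ a * v y ^ p) ^ ((p + 1) / p) := by
    funext y
    unfold shellSource
    by_cases hy : y ∈ S
    · rw [indicator_of_mem hy, indicator_of_mem hy]
    · rw [indicator_of_notMem hy, indicator_of_notMem hy, ENNReal.zero_rpow_of_pos hk]
  rw [e, ← lintegral_const_mul' _ _ ENNReal.ofReal_ne_top]
  refine (setLIntegral_le_lintegral _ _).trans ?_
  rw [lintegral_indicator hSm]
  refine (setLIntegral_mono' hSm fun y hy => ?_).trans (lintegral_mono_set hSb)
  have hy0 : 0 < ‖y‖ := by linarith [hy.1]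
  have hvy := hv y
  rw [ENNReal.ofReal_rpow_of_pos (by positivity), ← ENNReal.ofReal_mul hA.le]
  refine ENNReal.ofReal_le_ofReal ?_
  rw [Real.mul_rpow (by positivity) (by positivity), ← Real.rpow_mul hy0.le, ← Real.rpow_mul hvy.le,
    mul_div_cancel₀ _ hp.ne', show a * ((p + 1) / p) = a / p + a by field_simp; ring,
    Real.rpow_add hy0, mul_assoc]
  refine mul_le_mul_of_nonneg_right (hAx _ hy.1 (hy.2.le.trans hR)).2 (by positivity)

theorem lintegral_rpow_le_interpolate {X : Type*} [MeasurableSpace X] {μ : Measure X}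
    {f : X → ENNReal} (hf : Measurable f) {p s θ : ℝ} (hp : 0 < p) (hθ : 0 ≤ θ) (hθ1 : θ ≤ 1)
    (hs : s < 1) (h : θ * (1 - s) = p * s) :
    ∫⁻ x, f x ^ (1 / (1 - s)) ∂μ ≤
      (∫⁻ x, f x ∂μ) ^ (1 - θ) * (∫⁻ x, f x ^ ((p + 1) / p) ∂μ) ^ θ := by
  have hs' : 0 < 1 - s := by linarith
  refine le_trans (le_of_eq ?_) (ENNReal.lintegral_mul_norm_pow_le (g := fun x => f x ^ ((p + 1) / p))
    hf.aemeasurable (hf.pow_const _).aemeasurable (by linarith : 0 ≤ 1 - θ) hθ (by ring))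
  refine lintegral_congr fun x => ?_
  rw [← ENNReal.rpow_mul, ← ENNReal.rpow_add_of_nonneg _ _ (by linarith) (by positivity)]
  congr 1
  field_simp
  linarith

theorem mul_add_one_add_rpow_le {X Y G Ψ k₁ k₂ : ENNReal} {α β κ b₀ : ℝ} (hG : 1 ≤ G)
    (hΨ : 1 ≤ Ψ) (hκ : 0 ≤ κ) (hα : 0 ≤ α) (hβ : 0 ≤ β) (hb : 0 < b₀) (h₁ : α + β ≤ b₀) (h₂ : α * κ ≤ b₀)
    (hX : X ≤ k₁ * (G * Ψ ^ α)) (hY : Y ≤ k₂ * (G * Ψ ^ β)) :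
    X * Y + 1 + X ^ κ ≤ (k₁ * k₂ + 1 + k₁ ^ κ) * (G ^ (κ + 2) * Ψ ^ b₀) := by
  have hZ : 1 ≤ G ^ (κ + 2) * Ψ ^ b₀ :=
    one_le_mul (ENNReal.one_le_rpow hG (by linarith)) (ENNReal.one_le_rpow hΨ hb)
  have i1 : X * Y ≤ k₁ * k₂ * (G ^ (κ + 2) * Ψ ^ b₀) := by
    refine (mul_le_mul' hX hY).trans ?_
    have : k₁ * (G * Ψ ^ α) * (k₂ * (G * Ψ ^ β)) = k₁ * k₂ * (G ^ (2 : ℝ) * Ψ ^ (α + β)) := by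
      rw [ENNReal.rpow_add_of_nonneg _ _ hα hβ, ENNReal.rpow_two]
      ring
    rw [this]
    gcongr
    linarith
  have i2 : X ^ κ ≤ k₁ ^ κ * (G ^ (κ + 2) * Ψ ^ b₀) := by
    refine (ENNReal.rpow_le_rpow hX hκ).trans ?_
    rw [ENNReal.mul_rpow_of_nonneg _ _ hκ, ENNReal.mul_rpow_of_nonneg _ _ hκ, ← ENNReal.rpow_mul]
    gcongr
    linarith
  rw [add_mul, add_mul, one_mul]
  exact add_le_add (add_le_add i1 hZ) i2

theorem IsSol.pohoDiv_nonneg {a b p q : ℝ} {u v : Euc N → ℝ} (h : IsSol a b p q u v) (x : Euc N) :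
    0 ≤ pohoDiv a b p q 1 1 u v x := by
  have hu := h.left.pos x
  have hv := h.right.pos x
  unfold pohoDiv
  positivity

/-- The total energy in the ball of radius `r`. -/
noncomputable def totalEnergy (a b p q : ℝ) (u v : Euc N → ℝ) (r : ℝ) : ℝ :=
  ∫ x in closedBall 0 r, pohoDiv a b p q 1 1 u v x

theorem IsSol.totalEnergy_nonneg {a b p q : ℝ} {u v : Euc N → ℝ} (h : IsSol a b p q u v) (r : ℝ) :
    0 ≤ totalEnergy a b p q u v r :=
  setIntegral_nonneg measurableSet_closedBall fun y _ => h.pohoDiv_nonneg y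

theorem IsSol.totalEnergy_mono (hN : 3 ≤ N) {a b p q : ℝ} {u v : Euc N → ℝ}
    (h : IsSol a b p q u v) (ha : -2 < a) (hb : -2 < b) (hp : 0 < p) (hq : 0 < q) {r R : ℝ}
    (hrR : r ≤ R) (hR : R ≤ 2) : totalEnergy a b p q u v r ≤ totalEnergy a b p q u v R :=
  setIntegral_mono_set
    ((h.integrableOn_pohoDiv hN ha hb hp hq 1 1).mono_set (closedBall_subset_closedBall hR))
    (ae_of_all _ fun y => h.pohoDiv_nonneg y) (closedBall_subset_closedBall hrR).eventuallyLE

theorem IsSol.lintegral_le_totalEnergy (hN : 3 ≤ N) {a b p q : ℝ} {u v : Euc N → ℝ}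
    (h : IsSol a b p q u v) (ha : -2 < a) (hb : -2 < b) (hp : 0 < p) (hq : 0 < q) {R : ℝ}
    (hR : R ≤ 2) :
    ∫⁻ y in closedBall 0 R, ENNReal.ofReal (‖y‖ ^ a * v y ^ (p + 1)) ≤
        ENNReal.ofReal (totalEnergy a b p q u v R) ∧
      ∫⁻ y in closedBall 0 R, ENNReal.ofReal (‖y‖ ^ b * u y ^ (q + 1)) ≤
        ENNReal.ofReal (totalEnergy a b p q u v R) := by
  unfold totalEnergy
  rw [ofReal_integral_eq_lintegral_ofReal
    ((h.integrableOn_pohoDiv hN ha hb hp hq 1 1).mono_set (closedBall_subset_closedBall hR))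
    (ae_of_all _ fun y => h.pohoDiv_nonneg y)]
  constructor <;> refine lintegral_mono fun y => ENNReal.ofReal_le_ofReal ?_ <;>
  · have hu := h.left.pos y
    have hv := h.right.pos y
    unfold pohoDiv
    have i1 : 0 ≤ ‖y‖ ^ a * v y ^ (p + 1) := by positivity
    have i2 : 0 ≤ ‖y‖ ^ b * u y ^ (q + 1) := by positivity
    linarith

theorem IsSol.lintegral_shellSource_le {a b p q : ℝ} {u v : Euc N → ℝ} (h : IsSol a b p q u v)
    (R : ℝ) : ∫⁻ y in shell N, shellSource a p R v y ≤ ∫⁻ y in shell N, ‖lap u y‖ₑ := by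
  refine setLIntegral_mono' isCompact_shell.measurableSet fun y hy => ?_
  have hy0 : y ≠ 0 := by
    rw [← norm_pos_iff]; linarith [hy.1]
  have hv := h.right.pos y
  refine (indicator_le_self' (fun _ _ => zero_le) y).trans (le_of_eq ?_)
  rw [← h.eq_left y hy0, ← enorm_neg, Real.enorm_of_nonneg]
  rw [h.eq_left y hy0]
  positivity

theorem add_rpow_le_of_le {Δ I K D A Ψ : ENNReal} {t α : ℝ} {n : ℕ} (hΨ : 1 ≤ Ψ) (hD : 1 ≤ D)
    (ht : 0 ≤ t) (ht1 : t ≤ 1) (hα : 0 ≤ α) (hΔ : Δ ≤ D ^ (n + 1))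
    (hI : I ≤ K * D * (A * Ψ ^ (α / t))) (ht0 : t ≠ 0) :
    Δ + I ^ t ≤ (1 + (K * A) ^ t) * (D ^ (n + 1) * Ψ ^ α) := by
  have hΨα : 1 ≤ Ψ ^ α := by
    rw [← ENNReal.one_rpow α]; exact ENNReal.rpow_le_rpow hΨ hα
  have hDt : D ^ t ≤ D ^ (n + 1) := by
    rw [← ENNReal.rpow_natCast]
    refine ENNReal.rpow_le_rpow_of_exponent_le hD (ht1.trans ?_)
    push_cast
    linarith [(Nat.cast_nonneg n : (0 : ℝ) ≤ n)]
  rw [add_mul, one_mul]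
  refine add_le_add (hΔ.trans (le_mul_of_one_le_right zero_le hΨα)) ?_
  refine (ENNReal.rpow_le_rpow hI ht).trans ?_
  rw [show K * D * (A * Ψ ^ (α / t)) = K * A * (D * Ψ ^ (α / t)) by ring,
    ENNReal.mul_rpow_of_nonneg (K * A) _ ht, ENNReal.mul_rpow_of_nonneg D _ ht, ← ENNReal.rpow_mul,
    div_mul_cancel₀ _ ht0]
  gcongr

/-- On a suitable radius the boundary terms of the Pohozaev identity are controlled by a sublinear
power of the energy on a larger ball. -/
theorem exists_energy_feedback (hN : 3 ≤ N) {a b p q : ℝ} (ha : -2 < a) (hb : -2 < b)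
    (hq : 0 < q) (hqp : q ≤ p) (hpq : 1 < p * q)
    (hsub : ((N : ℝ) + a) / (p + 1) + ((N : ℝ) + b) / (q + 1) > (N : ℝ) - 2)
    (halpha : 2 * (p + 1) / (p * q - 1) > (N : ℝ) - 3) :
    ∃ C m b₀ : ℝ, 0 < C ∧ 0 ≤ b₀ ∧ b₀ < 1 ∧ ∀ u v : Euc N → ℝ, IsSol a b p q u v →
      ∀ r R, 1 ≤ r → r < R → R ≤ 2 → 1 + totalEnergy a b p q u v r ≤
        C * (R - r)⁻¹ ^ m * (1 + totalEnergy a b p q u v R) ^ b₀ := by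
  have hp : 0 < p := hq.trans_le hqp
  have hq1 : 0 < q + 1 := by linarith
  obtain ⟨s, σ, ε, hs, hspq, hsp, hsq, hsσ, hqσ, hσ, hσ1, hε, hε1, h₁, h₂, h₃⟩ :=
    exists_exponents hN hq hqp hpq halpha
  set c := (((N : ℝ) + a) / (p + 1) + (N + b) / (q + 1) - (N - 2)) / 2 with hc
  have hc0 : 0 < c := by rw [hc]; linarith
  set a₁ := ((N : ℝ) + a) / (p + 1) - c with ha₁
  set a₂ := ((N : ℝ) + b) / (q + 1) - c with ha₂
  have ha₁₂ : a₁ + a₂ = N - 2 := by rw [ha₁, ha₂, hc]; ring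
  obtain ⟨C, hC, hrad⟩ := exists_lintegral_pohoRad_le (a := a) (b := b) hN hq hqp hpq hε hε1 hs
    hsq hsσ hqσ hσ h₁ h₂ h₃ a₁ a₂
  obtain ⟨K, hK, hgood⟩ := exists_good_radius (N := N) (e := 1 - ε) (by linarith) (by linarith)
  obtain ⟨C₁, hC₁, hsrc₁⟩ := exists_lintegral_shellSource_rpow_le (N := N) a hp
  obtain ⟨C₂, hC₂, hsrc₂⟩ := exists_lintegral_shellSource_rpow_le (N := N) b hq
  obtain ⟨E, hE, hen⟩ := exists_shell_energy (N := N) (a := a) (b := b) hN hp hq hpq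
  have hp1 : s * (p + 1) < 1 := by rwa [lt_div_iff₀ (by positivity)] at hsp
  have hs1 : 0 < 1 - s := by nlinarith
  set θ := p * s / (1 - s) with hθ
  have hθ0 : 0 ≤ θ := by positivity
  have hθ1 : θ ≤ 1 := by rw [hθ, div_le_one hs1]; linarith
  have ht1 : 0 < 1 / (q + 1) := by positivity
  have ht : 0 < 1 - 1 / (q + 1) := by linarith
  set A₁ := ENNReal.ofReal E ^ (1 - θ) * C₁ ^ θ + 1 with hA₁
  have hA₁' : A₁ ≠ ⊤ := by
    have h1 : ENNReal.ofReal E ^ (1 - θ) ≠ ⊤ :=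
      ENNReal.rpow_ne_top_of_nonneg (by linarith) ENNReal.ofReal_ne_top
    have h2 : C₁ ^ θ ≠ ⊤ := ENNReal.rpow_ne_top_of_nonneg hθ0 hC₁
    finiteness
  set A₂ := C₂ + 1 with hA₂
  have hA₂' : A₂ ≠ ⊤ := by finiteness
  set k₁ := 1 + (K * A₁) ^ (1 - s) with hk₁
  set k₂ := 1 + (K * A₂) ^ (1 - 1 / (q + 1)) with hk₂
  have hk₁' : k₁ ≠ ⊤ := ENNReal.add_ne_top.2 ⟨ENNReal.one_ne_top,
    ENNReal.rpow_ne_top_of_nonneg hs1.le (ENNReal.mul_ne_top hK hA₁')⟩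
  have hk₂' : k₂ ≠ ⊤ := ENNReal.add_ne_top.2 ⟨ENNReal.one_ne_top,
    ENNReal.rpow_ne_top_of_nonneg ht.le (ENNReal.mul_ne_top hK hA₂')⟩
  set M := ENNReal.ofReal (2 ^ (N - 1)) * (C * (k₁ * k₂ + 1 + k₁ ^ (q + 1))) with hM
  have hM' : M ≠ ⊤ := by
    have : k₁ ^ (q + 1) ≠ ⊤ := ENNReal.rpow_ne_top_of_nonneg hq1.le hk₁'
    finiteness
  set b₀ := max (p * s + (1 - 1 / (q + 1))) (p * s * (q + 1)) with hb₀
  have hb₀0 : 0 < b₀ := lt_max_of_lt_left (by positivity)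
  have hb₀1 : b₀ < 1 := by
    have h2 : p * s * (q + 1) < 1 := by linarith
    refine max_lt ?_ h2
    rw [← lt_div_iff₀ hq1] at h2
    linarith
  refine ⟨(1 + c⁻¹ * M.toReal) * 2 ^ (((N + 1 : ℕ) : ℝ) * (q + 1 + 2)),
    ((N + 1 : ℕ) : ℝ) * (q + 1 + 2), b₀, by positivity, hb₀0.le, hb₀1,
    fun u v h r₁ R hr₁ hr₁R hR => ?_⟩
  set δ := (R - r₁) / 2 with hδ
  have hδ0 : 0 < δ := by rw [hδ]; linarith
  have hδ2 : δ ≤ 1 / 2 := by rw [hδ]; linarith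
  set D := ENNReal.ofReal δ⁻¹ with hD
  have hδ1 : 1 ≤ δ⁻¹ := (one_le_inv₀ hδ0).2 (by linarith)
  have hD1 : 1 ≤ D := ENNReal.one_le_ofReal.2 hδ1
  set Φ := 1 + totalEnergy a b p q u v R with hΦ
  have hΦ1 : 1 ≤ Φ := by linarith [h.totalEnergy_nonneg R]
  set Ψ := ENNReal.ofReal Φ with hΨ
  have hΨ1 : 1 ≤ Ψ := ENNReal.one_le_ofReal.2 hΦ1
  have hf : Measurable (shellSource a p R v) :=
    measurable_shellSource a p R h.right.continuous.measurable
  have hg : Measurable (shellSource b q R u) :=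
    measurable_shellSource b q R h.left.continuous.measurable
  have hle := h.lintegral_le_totalEnergy hN ha hb hp hq hR
  have hΦle : ENNReal.ofReal (totalEnergy a b p q u v R) ≤ Ψ :=
    ENNReal.ofReal_le_ofReal (by linarith)
  have hf' : ∫⁻ y in shell N, shellSource a p R v y ^ (1 / (1 - s)) ≤ A₁ * Ψ ^ θ := by
    refine (lintegral_rpow_le_interpolate hf hp hθ0 hθ1 (by linarith)
      (div_mul_cancel₀ _ hs1.ne')).trans ?_
    have i1 : (∫⁻ y in shell N, shellSource a p R v y) ≤ ENNReal.ofReal E :=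
      (h.lintegral_shellSource_le R).trans (hen u v h).2.2.1
    have i2 : ∫⁻ y in shell N, shellSource a p R v y ^ ((p + 1) / p) ≤ C₁ * Ψ :=
      (hsrc₁ v h.right.pos R hR).trans (mul_le_mul_right (hle.1.trans hΦle) _)
    refine (mul_le_mul' (ENNReal.rpow_le_rpow i1 (by linarith))
      (ENNReal.rpow_le_rpow i2 hθ0)).trans ?_
    rw [ENNReal.mul_rpow_of_nonneg _ _ hθ0, ← mul_assoc]
    exact mul_le_mul_left le_self_add _
  have hg' : ∫⁻ y in shell N, shellSource b q R u y ^ (1 / (1 - 1 / (q + 1))) ≤ A₂ * Ψ := by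
    have e : 1 / (1 - 1 / (q + 1)) = (q + 1) / q := by
      field_simp
      rw [add_sub_cancel_right, div_self hq.ne']
    rw [e]
    refine (hsrc₂ u h.left.pos R hR).trans (mul_le_mul' le_self_add (hle.2.trans hΦle))
  have hΨ0 : Ψ ≠ 0 := (zero_lt_one.trans_le hΨ1).ne'
  have hΨθ : Ψ ^ θ ≠ 0 := by
    rw [hΨ, ENNReal.ofReal_rpow_of_pos (by linarith)]
    exact (ENNReal.ofReal_pos.2 (by positivity)).ne'
  have hΨt : Ψ ≠ ⊤ := ENNReal.ofReal_ne_top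
  obtain ⟨r, hr, hpoho, hI₁, hI₂⟩ := hgood _ _ (hf.pow_const (1 / (1 - s)))
    (hg.pow_const (1 / (1 - 1 / (q + 1)))) (A₁ * Ψ ^ θ) (A₂ * Ψ) r₁ δ _
    (mul_ne_zero (by rw [hA₁]; exact (lt_of_lt_of_le one_pos le_add_self).ne') hΨθ)
    (ENNReal.mul_ne_top hA₁' (ENNReal.rpow_ne_top_of_nonneg hθ0 hΨt))
    (mul_ne_zero (by rw [hA₂]; exact (lt_of_lt_of_le one_pos le_add_self).ne') hΨ0)
    (ENNReal.mul_ne_top hA₂' hΨt) hf' hg' hr₁ hδ0 (by rw [hδ]; linarith)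
    (h.ae_pohozaev hN ha hb hp hq ha₁₂ (c₁ := c) (c₂ := c) (by rw [ha₁]; ring)
      (by rw [ha₂]; ring))
  have hr1 : 1 < r := hr₁.trans_lt hr.1
  have hrR : r + δ < R := by linarith [hr.2]
  have hpoho := hpoho ⟨hr1, by linarith⟩
  have hI₂' : shellInt (1 - ε) r (fun y => shellSource b q R u y ^ (1 / (1 - 1 / (q + 1)))) ≤
      K * D * (A₂ * Ψ ^ ((1 - 1 / (q + 1)) / (1 - 1 / (q + 1)))) := by
    rwa [div_self ht.ne', ENNReal.rpow_one]
  have hX := add_rpow_le_of_le (n := N) (Δ := ENNReal.ofReal (δ⁻¹ ^ (N + 1))) (α := p * s) hΨ1 hD1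
    hs1.le (by linarith) (by positivity) (ENNReal.ofReal_pow (by positivity) _).le hI₁ hs1.ne'
  have hY := add_rpow_le_of_le (n := N) (Δ := ENNReal.ofReal (δ⁻¹ ^ (N + 1)))
    (α := 1 - 1 / (q + 1)) hΨ1 hD1 ht.le (by linarith) ht.le
    (ENNReal.ofReal_pow (by positivity) _).le hI₂' ht.ne'
  have hG1 : 1 ≤ D ^ (N + 1) := one_le_pow₀ hD1
  have hmain := (hrad u v h R δ r hδ0 hδ2 hr1 hrR hR).trans (mul_le_mul_right
    (mul_add_one_add_rpow_le hG1 hΨ1 hq1.le (by positivity) ht.le hb₀0 (le_max_left _ _)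
      (le_max_right _ _) hX hY) C)
  set Z := (δ⁻¹ ^ (N + 1)) ^ (q + 1 + 2) * Φ ^ b₀ with hZ
  have hZ1 : 1 ≤ Z := one_le_mul_of_one_le_of_one_le
    (Real.one_le_rpow (one_le_pow₀ hδ1) (by linarith)) (Real.one_le_rpow hΦ1 hb₀0.le)
  have hZe : (D ^ (N + 1)) ^ (q + 1 + 2) * Ψ ^ b₀ = ENNReal.ofReal Z := by
    rw [hD, hΨ, hZ, ← ENNReal.ofReal_pow (by positivity), ENNReal.ofReal_rpow_of_pos (by positivity),
      ENNReal.ofReal_rpow_of_pos (by linarith), ENNReal.ofReal_mul (by positivity)]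
  rw [hZe] at hmain
  have hcE : c * totalEnergy a b p q u v r =
      r ^ (N - 1) * ∫ ω, pohoRad a b p q a₁ a₂ u v (r • (ω : Euc N)) ∂sph N := by
    rw [hpoho, totalEnergy, ← integral_const_mul]
    refine integral_congr_ae (ae_of_all _ fun y => ?_)
    unfold pohoDiv
    ring
  have hfin : ENNReal.ofReal (c * totalEnergy a b p q u v r) ≤ M * ENNReal.ofReal Z := by
    rw [hcE, ENNReal.ofReal_mul (by positivity), hM, mul_assoc, mul_assoc]
    refine mul_le_mul' (ENNReal.ofReal_le_ofReal (pow_le_pow_left₀ (by linarith) (by linarith) _))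
      (le_trans ?_ hmain)
    refine (Real.ofReal_le_enorm _).trans ((enorm_integral_le_lintegral_enorm _).trans (le_of_eq ?_))
    refine lintegral_congr fun ω => ?_
    rw [Real.enorm_eq_ofReal_abs]
  have hreal : c * totalEnergy a b p q u v r ≤ M.toReal * Z := by
    rw [← ENNReal.ofReal_toReal hM', ← ENNReal.ofReal_mul ENNReal.toReal_nonneg] at hfin
    exact (ENNReal.ofReal_le_ofReal_iff (by positivity)).1 hfin
  have hmono := h.totalEnergy_mono hN ha hb hp hq hr.1.le (by linarith)
  have hZ2 : Z = 2 ^ (((N + 1 : ℕ) : ℝ) * (q + 1 + 2)) *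
      ((R - r₁)⁻¹ ^ (((N + 1 : ℕ) : ℝ) * (q + 1 + 2)) * Φ ^ b₀) := by
    have hRr : 0 < R - r₁ := by linarith
    rw [hZ, ← Real.rpow_natCast, ← Real.rpow_mul (by positivity), ← mul_assoc,
      ← Real.mul_rpow (by norm_num) (by positivity), hδ, inv_div, div_eq_mul_inv]
  calc 1 + totalEnergy a b p q u v r₁ ≤ Z + c⁻¹ * (c * totalEnergy a b p q u v r) := by
        rw [inv_mul_cancel_left₀ hc0.ne']; linarith
    _ ≤ Z + c⁻¹ * (M.toReal * Z) := by gcongr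
    _ = _ := by rw [hZ2]; ring

theorem exists_totalEnergy_le (hN : 3 ≤ N) {a b p q : ℝ} (ha : -2 < a) (hb : -2 < b)
    (hq : 0 < q) (hqp : q ≤ p) (hpq : 1 < p * q)
    (hsub : ((N : ℝ) + a) / (p + 1) + ((N : ℝ) + b) / (q + 1) > (N : ℝ) - 2)
    (halpha : 2 * (p + 1) / (p * q - 1) > (N : ℝ) - 3) :
    ∃ B : ℝ, ∀ u v : Euc N → ℝ, IsSol a b p q u v → totalEnergy a b p q u v 1 ≤ B := by
  have hp : 0 < p := hq.trans_le hqp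
  obtain ⟨C, m, b₀, hC, hb₀, hb₁, h⟩ := exists_energy_feedback hN ha hb hq hqp hpq hsub halpha
  obtain ⟨B, hB⟩ := exists_iteration_bound (m := m) hC hb₀ hb₁
  refine ⟨B, fun u v huv => ?_⟩
  have := hB (fun r => 1 + totalEnergy a b p q u v r) (1 + totalEnergy a b p q u v 2)
    (fun r _ => by linarith [huv.totalEnergy_nonneg r])
    (fun r hr => by linarith [huv.totalEnergy_mono hN ha hb hp hq hr.2 le_rfl]) (h u v huv)
  linarith

open Pointwise in
theorem IsSol.le_totalEnergy_scale (hN : 3 ≤ N) {a b p q α β R : ℝ} {u v : Euc N → ℝ}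
    (h : IsSol a b p q u v) (ha : -2 < a) (hb : -2 < b) (hp : 0 < p) (hq : 0 < q)
    (hα : α + 2 + a = p * β) (hβ : β + 2 + b = q * α) (hR : 1 ≤ R) :
    R ^ (α + β + 2 - N) * ∫ y in closedBall (0 : Euc N) 1, ‖y‖ ^ b * u y ^ (q + 1) ≤
      totalEnergy a b p q (fun x => R ^ α * u (R • x)) (fun x => R ^ β * v (R • x)) 1 := by
  have hR0 : 0 < R := by linarith
  have hs := h.scale hα hβ hR0
  set f : Euc N → ℝ := fun y => ‖y‖ ^ b * u y ^ (q + 1) with hf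
  set U : Euc N → ℝ := fun x => R ^ α * u (R • x) with hU
  set V : Euc N → ℝ := fun x => R ^ β * v (R • x) with hV
  have hint : IntegrableOn (pohoDiv a b p q 1 1 U V) (closedBall 0 1) :=
    (hs.integrableOn_pohoDiv hN ha hb hp hq 1 1).mono_set
      (closedBall_subset_closedBall (by norm_num))
  have hsub : closedBall (0 : Euc N) R⁻¹ ⊆ closedBall 0 1 :=
    closedBall_subset_closedBall (inv_le_one_of_one_le₀ hR)
  have hscale : R • closedBall (0 : Euc N) R⁻¹ = closedBall 0 1 := by
    rw [_root_.smul_closedBall _ _ (by positivity), smul_zero, Real.norm_of_nonneg hR0.le,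
      mul_inv_cancel₀ hR0.ne']
  have hchange : ∫ x in closedBall (0 : Euc N) R⁻¹, f (R • x) =
      (R ^ N)⁻¹ * ∫ y in closedBall (0 : Euc N) 1, f y := by
    rw [Measure.setIntegral_comp_smul_of_pos _ _ _ hR0, hscale, finrank_euclideanSpace_fin,
      smul_eq_mul]
  have hle : ∀ x : Euc N, R ^ (α + β + 2) * f (R • x) ≤ pohoDiv a b p q 1 1 U V x := by
    intro x
    have hu := h.left.pos (R • x)
    have hv := h.right.pos (R • x)
    have e : R ^ (α + β + 2) * f (R • x) = ‖x‖ ^ b * U x ^ (q + 1) := by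
      simp only [hf, hU]
      rw [norm_smul, Real.norm_of_nonneg hR0.le, Real.mul_rpow hR0.le (norm_nonneg x),
        Real.mul_rpow (by positivity) hu.le, ← Real.rpow_mul hR0.le,
        show α * (q + 1) = α + β + 2 + b by linarith, Real.rpow_add hR0 (α + β + 2) b]
      ring
    rw [e]
    have hV0 := hs.right.pos x
    have : 0 ≤ ‖x‖ ^ a * V x ^ (p + 1) := by
      have : 0 ≤ V x := hV0.le
      positivity
    unfold pohoDiv
    linarith
  have hf0 : ∀ x, 0 ≤ f x := fun x => by
    have := (h.left.pos x).le
    positivity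
  calc R ^ (α + β + 2 - N) * ∫ y in closedBall (0 : Euc N) 1, f y
      = ∫ x in closedBall (0 : Euc N) R⁻¹, R ^ (α + β + 2) * f (R • x) := by
        rw [integral_const_mul, hchange, Real.rpow_sub hR0, Real.rpow_natCast]
        ring
    _ ≤ ∫ x in closedBall (0 : Euc N) R⁻¹, pohoDiv a b p q 1 1 U V x := by
        refine integral_mono_of_nonneg (ae_of_all _ fun x => ?_) (hint.mono_set hsub)
          (ae_of_all _ hle)
        exact mul_nonneg (by positivity) (hf0 _)
    _ ≤ totalEnergy a b p q U V 1 :=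
        setIntegral_mono_set hint (ae_of_all _ fun x => hs.pohoDiv_nonneg x) hsub.eventuallyLE

theorem IsSol.integral_pos (hN : 3 ≤ N) {a b p q : ℝ} {u v : Euc N → ℝ}
    (h : IsSol a b p q u v) (ha : -2 < a) (hb : -2 < b) (hp : 0 < p) (hq : 0 < q) :
    0 < ∫ y in closedBall (0 : Euc N) 1, ‖y‖ ^ b * u y ^ (q + 1) := by
  have hint : IntegrableOn (pohoDiv a b p q 0 1 u v) (closedBall 0 1) :=
    (h.integrableOn_pohoDiv hN ha hb hp hq 0 1).mono_set
      (closedBall_subset_closedBall (by norm_num))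
  have e : pohoDiv a b p q 0 1 u v = fun y => ‖y‖ ^ b * u y ^ (q + 1) := by
    funext y
    simp [pohoDiv]
  rw [e] at hint
  have : Nonempty (Fin N) := ⟨⟨0, by lia⟩⟩
  rw [setIntegral_pos_iff_support_of_nonneg_ae (ae_of_all _ fun y => ?_) hint]
  · refine lt_of_lt_of_le ?_ (measure_mono (s := closedBall (0 : Euc N) 1 \ {0}) fun y hy => ⟨?_, hy.1⟩)
    · rw [measure_sdiff_null (measure_singleton _)]
      exact measure_closedBall_pos _ _ one_pos
    · have h0 : 0 < ‖y‖ := norm_pos_iff.2 hy.2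
      have := h.left.pos y
      exact (mul_pos (Real.rpow_pos_of_pos h0 b) (Real.rpow_pos_of_pos this _)).ne'
  · have := (h.left.pos y).le
    exact mul_nonneg (Real.rpow_nonneg (norm_nonneg y) b) (Real.rpow_nonneg this _)

end Pohozaev

/-- Theorem 1.2: Liouville theorem for positive solutions of the Hardy–Hénon system
on `ℝ^N`. -/
theorem no_positive_solution
    (N : ℕ) (hN : 3 ≤ N) (a b p q : ℝ) (ha : -2 < a) (hb : -2 < b)
    (hq : 0 < q) (hqp : q ≤ p) (hpq : 1 < p * q)
    (hhyper : (N : ℝ) / (p + 1) + (N : ℝ) / (q + 1) > (N : ℝ) - 2)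
    (hsub : ((N : ℝ) + a) / (p + 1) + ((N : ℝ) + b) / (q + 1) > (N : ℝ) - 2)
    (halpha : 2 * (p + 1) / (p * q - 1) > (N : ℝ) - 3) :
    ¬ ∃ u v : EuclideanSpace ℝ (Fin N) → ℝ,
        IsHHSol a b p q (univ : Set (EuclideanSpace ℝ (Fin N))) u v := by
  rintro ⟨u, v, huv⟩
  have h := huv.isSol
  have hp : 0 < p := hq.trans_le hqp
  have hpq' : 0 < p * q - 1 := by linarith
  obtain ⟨B, hB⟩ := exists_totalEnergy_le hN ha hb hq hqp hpq hsub halpha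
  set α := ((2 + a) + p * (2 + b)) / (p * q - 1) with hα
  set β := ((2 + b) + q * (2 + a)) / (p * q - 1) with hβ
  have hα' : α + 2 + a = p * β := by
    rw [hα, hβ]; field_simp; ring
  have hβ' : β + 2 + b = q * α := by
    rw [hα, hβ, ← mul_div_assoc, eq_comm, div_eq_iff hpq'.ne', add_mul, add_mul,
      div_mul_cancel₀ _ hpq'.ne']
    ring
  have hκ : 0 < α + β + 2 - N := by
    have e : α + β + 2 - N =
        ((2 + a) * (q + 1) + (2 + b) * (p + 1) - (N - 2) * (p * q - 1)) / (p * q - 1) := by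
      rw [hα, hβ]; field_simp; ring
    rw [e]
    refine div_pos ?_ hpq'
    rw [gt_iff_lt, div_add_div _ _ (by positivity) (by positivity),
      lt_div_iff₀ (by positivity)] at hsub
    nlinarith
  have hI := h.integral_pos hN ha hb hp hq
  have hlim := (tendsto_rpow_atTop hκ).atTop_mul_const hI
  obtain ⟨R, hR1, hR⟩ := ((eventually_ge_atTop 1).and (hlim.eventually_gt_atTop B)).exists
  have := h.le_totalEnergy_scale hN ha hb hp hq hα' hβ' hR1
  have := hB _ _ (h.scale hα' hβ' (by linarith : 0 < R))
  linarith
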